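/- Let V ⊆ ℂ^n be an irreducible variety of dimension d and let T be a finite set of hypersurfaces of ℂ^n. Let k,b ≥ 1 be integers with (k,d) ≠ (1,1), let r ≥ b, and let S be a maximal (k,b)-free subset of 𝒫_r(T) ∩ V(ℝ). Then |S| ≤ k·deg(V)·( 2·deg(T)/(r−b+1) + c_2·b^{(d−1)/(k−1)}·deg(T)^d/(r−b+1)^{1/(1−α_k(d))} ), where c_2 = C(n) is a constant depending only on n. -/

import Mathlib

open MvPolynomial Set

noncomputable section

namespace Paper

variable (n : ℕ)

/-- The zero locus in `ℂⁿ` of a set of polynomials. -/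
def zeroLocus (I : Set (MvPolynomial (Fin n) ℂ)) : Set (Fin n → ℂ) :=
  {x | ∀ f ∈ I, eval x f = 0}

/-- A subset of `ℂⁿ` is algebraic if it is the zero locus of a set of polynomials. -/
def IsAlgebraicSet (V : Set (Fin n → ℂ)) : Prop :=
  ∃ I : Set (MvPolynomial (Fin n) ℂ), V = zeroLocus n I

/-- An irreducible (affine) variety in `ℂⁿ`: a nonempty algebraic set that is not covered
by two algebraic sets unless it is contained in one of them. -/
def IsIrredVariety (V : Set (Fin n → ℂ)) : Prop :=
  IsAlgebraicSet n V ∧ V.Nonempty ∧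
    ∀ V₁ V₂ : Set (Fin n → ℂ), IsAlgebraicSet n V₁ → IsAlgebraicSet n V₂ →
      V ⊆ V₁ ∪ V₂ → V ⊆ V₁ ∨ V ⊆ V₂

/-- There is a strictly increasing chain of `d + 1` irreducible varieties inside `V`. -/
def HasChain (V : Set (Fin n → ℂ)) (d : ℕ) : Prop :=
  ∃ W : Fin (d + 1) → Set (Fin n → ℂ),
    (∀ i, IsIrredVariety n (W i)) ∧ (∀ i j : Fin (d + 1), i < j → W i ⊂ W j) ∧
      W (Fin.last d) ⊆ V

/-- The (Krull) dimension of a subset of `ℂⁿ`, as the length of the longest chain of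
irreducible subvarieties. -/
def dim (V : Set (Fin n → ℂ)) : ℕ := sSup {d | HasChain n V d}

/-- `W` is an irreducible component of `X`: an irreducible subvariety that is maximal among
irreducible subvarieties of `X`. -/
def IsIrredComponent (W X : Set (Fin n → ℂ)) : Prop :=
  IsIrredVariety n W ∧ W ⊆ X ∧
    ∀ W', IsIrredVariety n W' → W ⊆ W' → W' ⊆ X → W' = W

/-- The degree of an irreducible variety `V ⊆ ℂⁿ` of dimension `d` (i.e. the degree of its
projective closure): the largest finite number of points in which an affine-linear subspace of
dimension `n - d` meets `V`. -/
def degree (V : Set (Fin n → ℂ)) : ℕ :=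
  sSup { m | ∃ L : AffineSubspace ℂ (Fin n → ℂ),
    Module.finrank ℂ L.direction = n - dim n V ∧ (V ∩ ↑L).Finite ∧ (V ∩ ↑L).ncard = m }

/-- The degree of an algebraic set: the sum of the degrees of its irreducible components. -/
def degreeSum (X : Set (Fin n → ℂ)) : ℕ :=
  ∑ᶠ W ∈ {W | IsIrredComponent n W X}, degree n W

/-- The maximal dimension of an irreducible component of `X` containing `V` equals `e`. -/
def MaxCompDimEq (X V : Set (Fin n → ℂ)) (e : ℕ) : Prop :=
  (∃ W, IsIrredComponent n W X ∧ V ⊆ W ∧ dim n W = e) ∧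
    ∀ W, IsIrredComponent n W X → V ⊆ W → dim n W ≤ e

/-- The partial degrees `δ_i(V)` of an irreducible variety `V`:  the minimal `δ` such that there
are polynomials of degree at most `δ` cutting out an algebraic set containing `V` whose
irreducible components containing `V` have maximal dimension `n - i`.  By convention
`δ_0(V) = 0`. -/
def partialDeg (V : Set (Fin n → ℂ)) (i : ℕ) : ℕ :=
  if i = 0 then 0
  else sInf { δ | ∃ I : Finset (MvPolynomial (Fin n) ℂ),
    (∀ f ∈ I, f.totalDegree ≤ δ) ∧ V ⊆ zeroLocus n ↑I ∧
      MaxCompDimEq n (zeroLocus n ↑I) V (n - i) }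

/-- The partial degrees as extended naturals, with the convention `δ_i(V) = ∞` for
`i > n - dim V`. -/
def partialDegE (V : Set (Fin n → ℂ)) (i : ℕ) : ℕ∞ :=
  if i ≤ n - dim n V then (partialDeg n V i : ℕ∞) else ⊤

/-- `δ(V)` for an irreducible variety `V`: the minimal `δ` such that `V` is an irreducible
component of the zero set of a finite family of polynomials of degree at most `δ`. -/
def deltaIrr (V : Set (Fin n → ℂ)) : ℕ :=
  sInf { δ | ∃ I : Finset (MvPolynomial (Fin n) ℂ),
    (∀ f ∈ I, f.totalDegree ≤ δ) ∧ IsIrredComponent n V (zeroLocus n ↑I) }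

/-- `δ(V)` for a general algebraic set `V`: the minimal `δ` such that every irreducible
component of `V` is an irreducible component of the zero set of a finite family of polynomials
of degree at most `δ`. -/
def deltaSet (V : Set (Fin n → ℂ)) : ℕ :=
  sInf { δ | ∃ I : Finset (MvPolynomial (Fin n) ℂ),
    (∀ f ∈ I, f.totalDegree ≤ δ) ∧
      ∀ W, IsIrredComponent n W V → IsIrredComponent n W (zeroLocus n ↑I) }

/-- An algebraic set all of whose irreducible components have dimension `d`. -/
def IsAlgSetOfDim (V : Set (Fin n → ℂ)) (d : ℕ) : Prop :=
  IsAlgebraicSet n V ∧ V.Nonempty ∧ ∀ W, IsIrredComponent n W V → dim n W = d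

/-- `Δ_i(V) = max (deg V / (δ_{i+1}(V) ⋯ δ_{n-d}(V))) 1`. -/
def Delta (V : Set (Fin n → ℂ)) (i : ℕ) : ℝ :=
  max ((degree n V : ℝ) / ∏ j ∈ Finset.Icc (i + 1) (n - dim n V), (partialDeg n V j : ℝ)) 1

/-- `i` is admissible with respect to `V` if `δ_{i+1}(V) > 2 i δ_i(V)` (with the convention
`δ_i(V) = ∞` for `i > n - dim V`). -/
def Admissible (V : Set (Fin n → ℂ)) (i : ℕ) : Prop :=
  ((2 * i : ℕ) : ℕ∞) * partialDegE n V i < partialDegE n V (i + 1)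

/-- The interval `ℛ_i(V) = [c₁ δ_i(V)^{n-i} Δ_i(V), (c₀/2) δ_{i+1}(V)^{n-i} Δ_i(V)]`,
where `δ_{n-d+1}(V) = ∞` makes the last interval a half-line. -/
def RSet (c0 c1 : ℝ) (V : Set (Fin n → ℂ)) (i : ℕ) : Set ℝ :=
  if i = n - dim n V then
    Set.Ici (c1 * (partialDeg n V i : ℝ) ^ (n - i) * Delta n V i)
  else
    Set.Icc (c1 * (partialDeg n V i : ℝ) ^ (n - i) * Delta n V i)
      ((c0 / 2) * (partialDeg n V (i + 1) : ℝ) ^ (n - i) * Delta n V i)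

/-- The interval `ℛ^l_{s,τ}(V) = [τ δ_s(V)^{n-(s+l)} Δ_s(V), τ δ_{s+1}(V)^{n-(s+l)} Δ_s(V)]`,
where `δ_{n-d+1}(V) = ∞` makes the last interval a half-line. -/
def RlSet (τ : ℝ) (l : ℕ) (V : Set (Fin n → ℂ)) (s : ℕ) : Set ℝ :=
  if s = n - dim n V then
    Set.Ici (τ * (partialDeg n V s : ℝ) ^ (n - (s + l)) * Delta n V s)
  else
    Set.Icc (τ * (partialDeg n V s : ℝ) ^ (n - (s + l)) * Delta n V s)
      (τ * (partialDeg n V (s + 1) : ℝ) ^ (n - (s + l)) * Delta n V s)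

/-- The ideal `I(V)` of polynomials vanishing on `V ⊆ ℂⁿ`. -/
def vanishingIdeal (V : Set (Fin n → ℂ)) : Ideal (MvPolynomial (Fin n) ℂ) where
  carrier := {f | ∀ x ∈ V, eval x f = 0}
  add_mem' := by
    intro a b ha hb x hx
    simp [ha x hx, hb x hx]
  zero_mem' := by
    intro x hx
    simp
  smul_mem' := by
    intro c f hf x hx
    simp [smul_eq_mul, hf x hx]

/-- The ideal `I_ℝ(V)` of real polynomials vanishing on `V ⊆ ℂⁿ`. -/
def vanishingIdealR (V : Set (Fin n → ℂ)) : Ideal (MvPolynomial (Fin n) ℝ) :=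
  (vanishingIdeal n V).comap (MvPolynomial.map (algebraMap ℝ ℂ))

/-- The affine Hilbert function `H_{I(V)}(m) = dim_ℂ ℂ[x]_{≤ m} / I(V)_{≤ m}`, realised as the
dimension of the image of the space of polynomials of total degree at most `m` in the quotient
ring `ℂ[x]/I(V)`. -/
def hilbert (V : Set (Fin n → ℂ)) (m : ℕ) : ℕ :=
  Module.finrank ℂ
    (Submodule.map (Ideal.Quotient.mkₐ ℂ (vanishingIdeal n V)).toLinearMap
      (restrictTotalDegree (Fin n) ℂ m))

/-- The real affine Hilbert function `H_{I(V),ℝ}(m) = dim_ℝ ℝ[x]_{≤ m} / I_ℝ(V)_{≤ m}`. -/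
def hilbertR (V : Set (Fin n → ℂ)) (m : ℕ) : ℕ :=
  Module.finrank ℝ
    (Submodule.map (Ideal.Quotient.mkₐ ℝ (vanishingIdealR n V)).toLinearMap
      (restrictTotalDegree (Fin n) ℝ m))

/-- The inclusion `ℝⁿ → ℂⁿ`. -/
def toC (x : Fin n → ℝ) : Fin n → ℂ := fun i => (x i : ℂ)

/-- The set of real points of `V ⊆ ℂⁿ`. -/
def realPts (V : Set (Fin n → ℂ)) : Set (Fin n → ℝ) := {x | toC n x ∈ V}

/-- The real zero set of a real polynomial. -/
def zeroSetR (g : MvPolynomial (Fin n) ℝ) : Set (Fin n → ℝ) := {x | eval x g = 0}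

/-- The zero locus of the polynomials `P 1, …, P i` (the first `i` members of a tuple of
polynomials indexed from `1`). -/
def zeroLocusUpTo (P : ℕ → MvPolynomial (Fin n) ℂ) (i : ℕ) : Set (Fin n → ℂ) :=
  zeroLocus n {f | ∃ j : ℕ, 1 ≤ j ∧ j ≤ i ∧ f = P j}

/-- `V'` is an `(n-s)`-minimal variety of the irreducible variety `V`. -/
def IsMinimalVariety (V V' : Set (Fin n → ℂ)) (s : ℕ) : Prop :=
  IsIrredVariety n V' ∧ V ⊆ V' ∧ dim n V' = n - s ∧
    ∀ f ∈ vanishingIdeal n V, f ∉ vanishingIdeal n V' →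
      partialDegE n V (s + 1) ≤ (f.totalDegree : ℕ∞)

/-- `S` is `(k,b)`-free with respect to `T`, for the incidence relation `R`. -/
def KBFree {α β : Type*} (R : α → β → Prop) (S : Finset α) (T : Finset β) (k b : ℕ) : Prop :=
  ¬ ∃ (P : Finset α) (B : Finset β), P ⊆ S ∧ B ⊆ T ∧ P.card = k ∧ B.card = b ∧
      ∀ s ∈ P, ∀ t ∈ B, R s t

/-- The number of incidences between a finite set of points and a finite family of sets. -/
def incCountAbs {α : Type*} (S : Finset α) (T : Finset (Set α)) : ℕ :=
  ∑ t ∈ T, (↑S ∩ t).ncard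

/-- The number of incidences between a finite set of real points and a finite family of
subsets of `ℂⁿ`. -/
def incCount (S : Finset (Fin n → ℝ)) (T : Finset (Set (Fin n → ℂ))) : ℕ :=
  ∑ t ∈ T, (↑S ∩ toC n ⁻¹' t).ncard

/-- The total degree `deg T = ∑_{t ∈ T} deg t` of a finite family of algebraic sets. -/
def degFamily (T : Finset (Set (Fin n → ℂ))) : ℕ := ∑ t ∈ T, degreeSum n t

/-- The total degree of a finite family of irreducible varieties. -/
def degFamilyIrred (T : Finset (Set (Fin n → ℂ))) : ℕ := ∑ t ∈ T, degree n t

/-- `α_k(d)`. -/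
def alpha (k d : ℕ) : ℝ :=
  if k = 1 ∧ d = 1 then 0 else (k : ℝ) * ((d : ℝ) - 1) / ((d : ℝ) * (k : ℝ) - 1)

/-- `β_k(d)`. -/
def beta (k d : ℕ) : ℝ :=
  if k = 1 ∧ d = 1 then 1 else (d : ℝ) * ((k : ℝ) - 1) / ((d : ℝ) * (k : ℝ) - 1)

/-- `τ_d(b,k) = b^{1-β_k(d)} k^{1-α_k(d)}`. -/
def tauC (d b k : ℕ) : ℝ := (b : ℝ) ^ (1 - beta k d) * (k : ℝ) ^ (1 - alpha k d)

/-- The Chardin–Philippon property of the constant `c₀`: for every pure-dimensional algebraic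
set `W ⊆ ℂⁿ` and every `m ≥ 2 (n - dim W) δ(W)` one has `H_{I(W)}(m) ≥ c₀ m^{dim W} deg W`. -/
def ChardinPhilippon (c0 : ℝ) : Prop :=
  ∀ (W : Set (Fin n → ℂ)) (e : ℕ), IsAlgSetOfDim n W e →
    ∀ m : ℕ, 2 * (n - e) * deltaSet n W ≤ m →
      c0 * (m : ℝ) ^ e * (degreeSum n W : ℝ) ≤ (hilbert n W m : ℝ)

/-- The defining property of the constant `c₁`: for every irreducible variety `V`, every
positive integer lies in some interval `ℛ_i(V)` with `i` admissible with respect to `V`. -/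
def CoversPositiveIntegers (c0 c1 : ℝ) : Prop :=
  ∀ V : Set (Fin n → ℂ), IsIrredVariety n V →
    ∀ m : ℕ, 0 < m → ∃ i, Admissible n V i ∧ (m : ℝ) ∈ RSet n c0 c1 V i

/-- `i_V(M)`: the smallest admissible `i` such that `M^{n-i} Δ_i(V) ∈ ℛ_i(V)`. -/
def iV (c0 c1 : ℝ) (V : Set (Fin n → ℂ)) (M : ℕ) : ℕ :=
  sInf {i | Admissible n V i ∧ (M : ℝ) ^ (n - i) * Delta n V i ∈ RSet n c0 c1 V i}

/-- A real polynomial bisects a finite set `S ⊆ ℝⁿ` if it is positive on at most half of `S`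
and negative on at most half of `S`. -/
def Bisects (g : MvPolynomial (Fin n) ℝ) (S : Finset (Fin n → ℝ)) : Prop :=
  ((↑S ∩ {x | 0 < eval x g}).ncard : ℝ) ≤ (S.card : ℝ) / 2 ∧
    ((↑S ∩ {x | eval x g < 0}).ncard : ℝ) ≤ (S.card : ℝ) / 2

/-- The set of `r`-rich points of a family `T`: points lying in at least `r` members of `T`. -/
def richPts (T : Finset (Set (Fin n → ℂ))) (r : ℕ) : Set (Fin n → ℂ) :=
  {x | r ≤ ({t | t ∈ T ∧ x ∈ t} : Set (Set (Fin n → ℂ))).ncard}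

/-- A real hypersurface of degree at most `D`: the real zero set of a nonzero real polynomial
of degree at most `D`. -/
def IsRealHypersurfaceDegLE (t : Set (Fin n → ℝ)) (D : ℕ) : Prop :=
  ∃ p : MvPolynomial (Fin n) ℝ, p ≠ 0 ∧ t = zeroSetR n p ∧ p.totalDegree ≤ D

/-- Lexicographic comparison of the tuples `(f 1, …, f m)` and `(g 1, …, g m)`. -/
def LexLE (m : ℕ) (f g : ℕ → ℕ) : Prop :=
  (∀ j ∈ Finset.Icc 1 m, f j = g j) ∨
    ∃ i ∈ Finset.Icc 1 m, (∀ j, 1 ≤ j → j < i → f j = g j) ∧ f i < g i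

section PartA
variable {n}

/-- Hilbert function of an ideal. -/
def HI (I : Ideal (MvPolynomial (Fin n) ℂ)) (m : ℕ) : ℕ :=
  Module.finrank ℂ
    (Submodule.map (Ideal.Quotient.mkₐ ℂ I).toLinearMap (restrictTotalDegree (Fin n) ℂ m))

lemma hilbert_eq (V : Set (Fin n → ℂ)) (m : ℕ) : hilbert n V m = HI (vanishingIdeal n V) m := rfl

instance finP (m : ℕ) : Module.Finite ℂ (restrictTotalDegree (Fin n) ℂ m) := by
  have hfin : {α : Fin n →₀ ℕ | α.degree ≤ m}.Finite := by
    refine Set.Finite.subset (Set.finite_Iic (Finsupp.equivFunOnFinite.symm (fun _ : Fin n => m))) ?_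
    intro α hα i
    have : α i ≤ α.degree := Finsupp.le_degree i α
    simp only [Set.mem_ofPred_eq] at hα
    simp only [Finsupp.equivFunOnFinite_symm_apply_apply]
    omega
  have := Module.Finite.span_of_finite ℂ (hfin.image (fun α => (monomial α (1:ℂ))))
  refine Module.Finite.iff_fg.2 ?_
  refine ⟨(hfin.toFinset.image (fun α => (monomial α (1:ℂ)))), ?_⟩
  apply le_antisymm
  · rw [Submodule.span_le]
    intro p hp
    simp only [Finset.coe_image, Set.Finite.coe_toFinset, Set.mem_image, Set.mem_ofPred_eq] at hp
    obtain ⟨α, hα, rfl⟩ := hp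
    simp only [SetLike.mem_coe, mem_restrictTotalDegree]
    rw [totalDegree_monomial _ one_ne_zero]
    exact hα
  · intro p hp
    rw [mem_restrictTotalDegree] at hp
    rw [p.as_sum]
    refine Submodule.sum_mem _ fun α hα => ?_
    have : monomial α (coeff α p) = (coeff α p) • monomial α (1:ℂ) := by
      rw [smul_monomial]; simp
    rw [this]
    refine Submodule.smul_mem _ _ (Submodule.subset_span ?_)
    simp only [Finset.coe_image, Set.Finite.coe_toFinset, Set.mem_image, Set.mem_ofPred_eq]
    exact ⟨α, (le_totalDegree hα).trans hp, rfl⟩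

/-- kernel comparison -/
lemma finrank_range_le_of_ker {E F G : Type*} [AddCommGroup E] [Module ℂ E] [AddCommGroup F]
    [Module ℂ F] [AddCommGroup G] [Module ℂ G] [Module.Finite ℂ E] (u : E →ₗ[ℂ] F) (v : E →ₗ[ℂ] G)
    (h : ∀ x, u x = 0 → v x = 0) :
    Module.finrank ℂ (LinearMap.range v) ≤ Module.finrank ℂ (LinearMap.range u) := by
  have h1 := LinearMap.finrank_range_add_finrank_ker u
  have h2 := LinearMap.finrank_range_add_finrank_ker v
  have h3 : Module.finrank ℂ (LinearMap.ker u) ≤ Module.finrank ℂ (LinearMap.ker v) :=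
    Submodule.finrank_mono (fun x hx => h x hx)
  omega

/-- the map `P_m → A_I` -/
def qmap (I : Ideal (MvPolynomial (Fin n) ℂ)) (m : ℕ) :
    restrictTotalDegree (Fin n) ℂ m →ₗ[ℂ] (MvPolynomial (Fin n) ℂ ⧸ I) :=
  (Ideal.Quotient.mkₐ ℂ I).toLinearMap.comp (Submodule.subtype _)

lemma qmap_eq_zero (I : Ideal (MvPolynomial (Fin n) ℂ)) (m : ℕ)
    (p : restrictTotalDegree (Fin n) ℂ m) : qmap I m p = 0 ↔ (p : MvPolynomial (Fin n) ℂ) ∈ I := by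
  simp [qmap, Ideal.Quotient.eq_zero_iff_mem]

lemma HI_eq_range (I : Ideal (MvPolynomial (Fin n) ℂ)) (m : ℕ) :
    HI I m = Module.finrank ℂ (LinearMap.range (qmap I m)) := by
  unfold HI qmap
  rw [LinearMap.range_comp, Submodule.range_subtype]

lemma HI_le_of_le {I J : Ideal (MvPolynomial (Fin n) ℂ)} (h : I ≤ J) (m : ℕ) : HI J m ≤ HI I m := by
  rw [HI_eq_range, HI_eq_range]
  refine finrank_range_le_of_ker _ _ fun x hx => ?_
  rw [qmap_eq_zero] at *
  exact h hx

lemma HI_mono (I : Ideal (MvPolynomial (Fin n) ℂ)) {a b : ℕ} (h : a ≤ b) : HI I a ≤ HI I b := by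
  refine Submodule.finrank_mono (Submodule.map_mono ?_)
  intro p hp
  rw [mem_restrictTotalDegree] at *
  omega

lemma Ladd {I J Q : Ideal (MvPolynomial (Fin n) ℂ)} (hIJ : I ≤ J) {f : MvPolynomial (Fin n) ℂ}
    (hf : f ∈ J) (hQ : ∀ g, f * g ∈ I → g ∈ Q) {a m : ℕ} (ha : f.totalDegree ≤ a) (ham : a ≤ m) :
    HI J m + HI Q (m - a) ≤ HI I m := by
  rw [HI_eq_range, HI_eq_range, HI_eq_range]
  -- the natural map range (qmap I m) → A_J
  let φ : (MvPolynomial (Fin n) ℂ ⧸ I) →ₗ[ℂ] (MvPolynomial (Fin n) ℂ ⧸ J) :=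
    (Ideal.Quotient.factorₐ ℂ hIJ).toLinearMap
  let ψ : LinearMap.range (qmap I m) →ₗ[ℂ] (MvPolynomial (Fin n) ℂ ⧸ J) :=
    φ.comp (Submodule.subtype _)
  have hfP : ∀ p : restrictTotalDegree (Fin n) ℂ (m - a),
      f * (p : MvPolynomial (Fin n) ℂ) ∈ restrictTotalDegree (Fin n) ℂ m := by
    intro p
    have := p.2
    rw [mem_restrictTotalDegree] at *
    have := totalDegree_mul f (p : MvPolynomial (Fin n) ℂ)
    omega
  let μ : restrictTotalDegree (Fin n) ℂ (m - a) →ₗ[ℂ] restrictTotalDegree (Fin n) ℂ m :=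
    LinearMap.codRestrict _ ((LinearMap.mulLeft ℂ f).comp (Submodule.subtype _)) hfP
  let θ := (qmap I m).comp μ
  have h1 := LinearMap.finrank_range_add_finrank_ker ψ
  have h2 : Module.finrank ℂ (LinearMap.range (qmap J m)) ≤ Module.finrank ℂ (LinearMap.range ψ) := by
    refine Submodule.finrank_mono ?_
    rintro _ ⟨p, rfl⟩
    refine ⟨⟨qmap I m p, ⟨p, rfl⟩⟩, ?_⟩
    rfl
  have h3 : Module.finrank ℂ (LinearMap.range (qmap Q (m - a))) ≤
      Module.finrank ℂ (LinearMap.range θ) := by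
    refine finrank_range_le_of_ker _ _ fun x hx => ?_
    rw [qmap_eq_zero]
    apply hQ
    have : qmap I m (μ x) = 0 := hx
    rw [qmap_eq_zero] at this
    exact this
  have h4 : Module.finrank ℂ (LinearMap.range θ) ≤ Module.finrank ℂ (LinearMap.ker ψ) := by
    have hle : LinearMap.range θ ≤ (LinearMap.ker ψ).map (Submodule.subtype _) := by
      rintro _ ⟨p, rfl⟩
      refine ⟨⟨θ p, ⟨μ p, rfl⟩⟩, ?_, rfl⟩
      simp only [SetLike.mem_coe, LinearMap.mem_ker]
      have : (f * (p : MvPolynomial (Fin n) ℂ)) ∈ J := J.mul_mem_right _ hf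
      have h5 : Ideal.Quotient.mk J (f * (p : MvPolynomial (Fin n) ℂ)) = 0 :=
        Ideal.Quotient.eq_zero_iff_mem.2 this
      exact h5
    calc _ ≤ _ := Submodule.finrank_mono hle
      _ ≤ _ := Submodule.finrank_map_le _ _
  omega

/-- dimension bound: a submodule covered by another one plus images of a third -/
lemma finrank_cover {E : Type*} [AddCommGroup E] [Module ℂ E] {ι : Type*} [Fintype ι]
    (A B C D : Submodule ℂ E) [Module.Finite ℂ A] [Module.Finite ℂ B] [Module.Finite ℂ C]
    [Module.Finite ℂ D] (hDC : D ≤ C) (T : ι → E →ₗ[ℂ] E)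
    (hT : ∀ i, D.map (T i) ≤ B) (hA : A ≤ B ⊔ ⨆ i, C.map (T i)) :
    Module.finrank ℂ A + Fintype.card ι * Module.finrank ℂ D ≤
      Module.finrank ℂ B + Fintype.card ι * Module.finrank ℂ C := by
  classical
  obtain ⟨D', hD'1, hD'2⟩ := Submodule.exists_isCompl (D.comap C.subtype)
  let G := D'.map C.subtype
  have hGD : D ⊔ G = C := by
    have := Submodule.map_sup (D.comap C.subtype) D' C.subtype
    rw [hD'2.eq_top] at this
    rw [Submodule.map_comap_subtype, Submodule.map_top, Submodule.range_subtype,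
      inf_eq_right.2 hDC] at this
    exact this.symm
  have hfin : Module.finrank ℂ D + Module.finrank ℂ G = Module.finrank ℂ C := by
    have h1 := Submodule.finrank_add_eq_of_isCompl (⟨hD'1, hD'2⟩ : IsCompl (D.comap C.subtype) D')
    have h2 : Module.finrank ℂ G = Module.finrank ℂ D' :=
      Submodule.finrank_map_subtype_eq C D'
    have h3 : Module.finrank ℂ (D.comap C.subtype) = Module.finrank ℂ D := by
      rw [← Submodule.finrank_map_subtype_eq C (D.comap C.subtype),
        Submodule.map_comap_subtype, inf_eq_right.2 hDC]
    omega
  have hA2 : A ≤ B ⊔ ⨆ i, G.map (T i) := by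
    refine hA.trans (sup_le le_sup_left (iSup_le fun i => ?_))
    rw [← hGD, Submodule.map_sup]
    exact sup_le ((hT i).trans le_sup_left) ((le_iSup (fun i => G.map (T i)) i).trans le_sup_right)
  have : Module.Finite ℂ G := Module.Finite.map D' C.subtype
  have hs : Module.finrank ℂ (⨆ i, G.map (T i) : Submodule ℂ E) ≤
      Fintype.card ι * Module.finrank ℂ G := by
    have : ∀ s : Finset ι, Module.finrank ℂ (s.sup fun i => G.map (T i) : Submodule ℂ E) ≤
        s.card * Module.finrank ℂ G := by
      intro s
      induction s using Finset.induction_on with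
      | empty => simp
      | insert a s ha ih =>
        rw [Finset.sup_insert, Finset.card_insert_of_notMem ha]
        have h1 := Submodule.finrank_add_le_finrank_add_finrank (G.map (T a))
          (s.sup fun i => G.map (T i))
        have h2 := Submodule.finrank_map_le (T a) G
        nlinarith
    have h := this Finset.univ
    rwa [Finset.sup_univ_eq_iSup, Finset.card_univ] at h
  have h1 := Submodule.finrank_mono hA2
  have h2 := Submodule.finrank_add_le_finrank_add_finrank B (⨆ i, G.map (T i))
  nlinarith

end PartA

section PartB
variable {n}

lemma HI_level (I : Ideal (MvPolynomial (Fin n) ℂ)) (hn : 0 < n) {j l : ℕ} (hl : n * l ≤ j)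
    (hlj : l + 1 ≤ j) :
    HI I j + n * HI I (j - l - 1) ≤ HI I (j - 1) + n * HI I (j - l) := by
  let Q : ℕ → Submodule ℂ (MvPolynomial (Fin n) ℂ ⧸ I) := fun m =>
    Submodule.map (Ideal.Quotient.mkₐ ℂ I).toLinearMap (restrictTotalDegree (Fin n) ℂ m)
  have hQ : ∀ m, Module.Finite ℂ (Q m) := fun m => Module.Finite.map _ _
  have key := finrank_cover (Q j) (Q (j-1)) (Q (j-l)) (Q (j-l-1))
    (Submodule.map_mono (by
      intro p hp; rw [mem_restrictTotalDegree] at *; omega))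
    (fun i : Fin n => LinearMap.mulLeft ℂ (Ideal.Quotient.mk I (X i ^ l))) ?_ ?_
  · rw [Fintype.card_fin] at key; exact key
  · rintro i _ ⟨_, ⟨p, hp, rfl⟩, rfl⟩
    refine ⟨X i ^ l * p, ?_, by simp⟩
    simp only [SetLike.mem_coe, mem_restrictTotalDegree] at *
    have h1 := totalDegree_mul (X i ^ l) p
    have h2 := totalDegree_X_pow (R := ℂ) i l
    omega
  · rintro _ ⟨p, hp, rfl⟩
    simp only [SetLike.mem_coe, mem_restrictTotalDegree] at hp
    rw [p.as_sum, map_sum]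
    refine Submodule.sum_mem _ fun α hα => ?_
    have hdeg : α.degree ≤ j := (le_totalDegree hα).trans hp
    by_cases h : α.degree ≤ j - 1
    · refine Submodule.mem_sup_left ⟨monomial α (coeff α p), ?_, rfl⟩
      simp only [SetLike.mem_coe, mem_restrictTotalDegree]
      exact (totalDegree_monomial_le _ _).trans h
    · have hex : ∃ i, l ≤ α i := by
        by_contra hcon
        push Not at hcon
        have h1 : α.degree = ∑ i, α i := Finsupp.degree_eq_sum α
        have h2 : ∑ i, α i < ∑ _i : Fin n, l :=
          Finset.sum_lt_sum_of_nonempty ⟨⟨0, hn⟩, Finset.mem_univ _⟩ (fun i _ => hcon i)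
        simp at h2
        omega
      obtain ⟨i, hi⟩ := hex
      refine Submodule.mem_sup_right (Submodule.mem_iSup_of_mem i ?_)
      have hle : Finsupp.single i l ≤ α := by
        rw [Finsupp.single_le_iff]; exact hi
      refine ⟨Ideal.Quotient.mk I (monomial (α - Finsupp.single i l) (coeff α p)),
        ⟨monomial (α - Finsupp.single i l) (coeff α p), ?_, rfl⟩, ?_⟩
      · simp only [SetLike.mem_coe, mem_restrictTotalDegree]
        refine (totalDegree_monomial_le _ _).trans ?_
        have h3 : α.degree = (α - Finsupp.single i l).degree + l := by
          conv_lhs => rw [← tsub_add_cancel_of_le hle]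
          simp [map_add]
        change (α - Finsupp.single i l).degree ≤ j - l
        omega
      · simp only [LinearMap.mulLeft_apply, ← map_mul, AlgHom.toLinearMap_apply,
          Ideal.Quotient.mkₐ_eq_mk]
        congr 1
        rw [X_pow_eq_monomial, monomial_mul, one_mul, add_tsub_cancel_of_le hle]

lemma HI_N (I : Ideal (MvPolynomial (Fin n) ℂ)) (hn : 0 < n) {j : ℕ} (hj : 1 ≤ j) :
    (j : ℝ) * ((HI I j : ℝ) - HI I (j - 1)) ≤ (n : ℝ)^2 * HI I j := by
  set L := min (j / n) (j - 1) with hL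
  have h1 : ∀ l ∈ Finset.range (L + 1), ((HI I j : ℝ) - HI I (j - 1)) ≤
      n * ((HI I (j - l) : ℝ) - HI I (j - (l + 1))) := by
    intro l hl
    have hl' : l ≤ L := by simpa [Nat.lt_succ_iff] using hl
    have h2 : l ≤ j / n := hl'.trans (min_le_left _ _)
    have h3 : l ≤ j - 1 := hl'.trans (min_le_right _ _)
    have h4 : n * l ≤ j := (Nat.mul_le_mul_left n h2).trans (Nat.mul_div_le j n)
    have := HI_level I hn h4 (by omega)
    rw [Nat.sub_sub] at this
    have h5 : ((HI I j + n * HI I (j - (l + 1)) : ℕ) : ℝ) ≤ ((HI I (j - 1) + n * HI I (j - l) : ℕ) : ℝ) := by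
      exact_mod_cast this
    push_cast at h5
    linarith
  have h2 := Finset.sum_le_sum h1
  rw [Finset.sum_const, Finset.card_range, ← Finset.mul_sum, Finset.sum_range_sub'] at h2
  simp only [nsmul_eq_mul, Nat.sub_zero] at h2
  have h3 : (j : ℝ) ≤ n * ((L + 1 : ℕ) : ℝ) := by
    have : j ≤ n * (L + 1) := by
      rcases le_total (j / n) (j - 1) with h | h
      · rw [hL, min_eq_left h]
        exact (Nat.lt_mul_div_succ j hn).le
      · rw [hL, min_eq_right h]
        have : j - 1 + 1 = j := by omega
        rw [this]; nlinarith
    exact_mod_cast this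
  have h4 : 0 ≤ (HI I j : ℝ) - HI I (j - 1) := by
    have := HI_mono I (Nat.sub_le j 1)
    have : (HI I (j-1) : ℝ) ≤ HI I j := by exact_mod_cast this
    linarith
  have h5 : (0:ℝ) ≤ HI I (j - (L + 1)) := Nat.cast_nonneg _
  have hn' : (0:ℝ) ≤ n := Nat.cast_nonneg _
  calc (j : ℝ) * ((HI I j : ℝ) - HI I (j - 1)) ≤ n * ((L + 1 : ℕ) : ℝ) * ((HI I j : ℝ) - HI I (j - 1)) :=
        mul_le_mul_of_nonneg_right h3 h4
    _ = n * (((L + 1 : ℕ) : ℝ) * ((HI I j : ℝ) - HI I (j - 1))) := by ring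
    _ ≤ n * (n * ((HI I j : ℝ) - HI I (j - (L+1)))) := mul_le_mul_of_nonneg_left h2 hn'
    _ ≤ n * (n * (HI I j : ℝ)) := by gcongr; linarith
    _ = _ := by ring

lemma HI_inc (I : Ideal (MvPolynomial (Fin n) ℂ)) (hn : 0 < n) (a m : ℕ) :
    (m : ℝ) * ((HI I m : ℝ) - HI I (m - a)) ≤ (2 * (n : ℝ)^2 + 2) * a * HI I m := by
  have h0 : ∀ k, (0:ℝ) ≤ HI I k := fun k => Nat.cast_nonneg _
  rcases le_or_gt m (2 * a) with h | h
  · have h1 : (m : ℝ) ≤ 2 * a := by exact_mod_cast h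
    have : (m : ℝ) * ((HI I m : ℝ) - HI I (m - a)) ≤ (2 * a) * HI I m :=
      calc _ ≤ (m : ℝ) * (HI I m : ℝ) := by gcongr; linarith [h0 (m-a)]
        _ ≤ _ := by gcongr
    have h2 : 0 ≤ 2 * (n : ℝ)^2 * a * HI I m := by positivity
    nlinarith
  · have key : ∀ i ∈ Finset.range a, (m : ℝ) * ((HI I (m - i) : ℝ) - HI I (m - (i + 1))) ≤
        2 * (n : ℝ)^2 * HI I m := by
      intro i hi
      have hi' : i < a := by simpa using hi
      have h1 := HI_N I hn (j := m - i) (by omega)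
      rw [Nat.sub_sub] at h1
      have h2 : (m : ℝ) ≤ 2 * ((m - i : ℕ) : ℝ) := by
        have : m ≤ 2 * (m - i) := by omega
        exact_mod_cast this
      have h3 : (HI I (m - i) : ℝ) ≤ HI I m := by exact_mod_cast HI_mono I (Nat.sub_le m i)
      have h4 : (HI I (m - (i+1)) : ℝ) ≤ HI I (m - i) := by
        exact_mod_cast HI_mono I (by omega)
      calc _ ≤ 2 * ((m - i : ℕ) : ℝ) * ((HI I (m - i) : ℝ) - HI I (m - (i + 1))) :=
            mul_le_mul_of_nonneg_right h2 (by linarith)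
        _ ≤ 2 * ((n : ℝ)^2 * HI I (m - i)) := by linarith
        _ ≤ 2 * ((n : ℝ)^2 * HI I m) := by gcongr
        _ = _ := by ring
    have h2 := Finset.sum_le_sum key
    rw [← Finset.mul_sum, Finset.sum_range_sub'] at h2
    simp only [Finset.sum_const, Finset.card_range, nsmul_eq_mul, Nat.sub_zero] at h2
    have : 0 ≤ 2 * (a:ℝ) * HI I m := by positivity
    nlinarith

end PartB

section PartC
set_option linter.unusedSectionVars false
open scoped ComplexOrder Matrix
open Matrix

lemma greedy {ι : Type*} [DecidableEq ι] {E : Type*} [AddCommGroup E] [Module ℂ E]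
    (v : ι → E) (K : ℝ)
    (hX : ∀ X : Finset ι, (X.card : ℝ) ≤ K * Module.finrank ℂ (Submodule.span ℂ (v '' X)))
    (s : ι → ℝ) (X : Finset ι) :
    ∃ B : Finset ι, B ⊆ X ∧ LinearIndepOn ℂ v (B : Set ι) ∧
      Submodule.span ℂ (v '' B) = Submodule.span ℂ (v '' X) ∧
      ∀ μ : ℝ, (∀ x ∈ X, μ ≤ s x) → ∑ x ∈ X, (s x - μ) ≤ K * ∑ x ∈ B, (s x - μ) := by
  induction X using Finset.induction_on_min_value s with
  | empty => exact ⟨∅, by simp, by simp, by simp, by simp⟩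
  | insert a X ha hmin ih =>
    obtain ⟨B, hBX, hli, hsp, hsum⟩ := ih
    have haB : a ∉ B := fun h => ha (hBX h)
    have core : ∀ B' : Finset ι, LinearIndepOn ℂ v (B' : Set ι) →
        Submodule.span ℂ (v '' B') = Submodule.span ℂ (v '' (insert a X : Finset ι)) →
        (∑ x ∈ B', (s x - s a) = ∑ x ∈ B, (s x - s a)) →
        ∀ μ : ℝ, (∀ x ∈ insert a X, μ ≤ s x) →
          ∑ x ∈ insert a X, (s x - μ) ≤ K * ∑ x ∈ B', (s x - μ) := by
      intro B' hli' hsp' hs' μ hμ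
      have h0 := hsum (s a) hmin
      have h1 : ∑ x ∈ insert a X, (s x - s a) = ∑ x ∈ X, (s x - s a) := by
        rw [Finset.sum_insert ha]; simp
      have h2 : ∀ Y : Finset ι, ∑ x ∈ Y, (s x - μ) = ∑ x ∈ Y, (s x - s a) + Y.card * (s a - μ) := by
        intro Y
        have : ∀ x ∈ Y, s x - μ = (s x - s a) + (s a - μ) := fun x _ => by ring
        rw [Finset.sum_congr rfl this, Finset.sum_add_distrib, Finset.sum_const, nsmul_eq_mul]
      have h3 : (((insert a X : Finset ι).card : ℕ) : ℝ) ≤ K * B'.card := by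
        have := hX (insert a X)
        rw [← hsp'] at this
        have h4 : Module.finrank ℂ (Submodule.span ℂ (v '' (B' : Set ι))) = B'.card := by
          have h5 : LinearIndependent ℂ (fun x : B' => v x) := hli'
          have := finrank_span_eq_card h5
          rw [Fintype.card_coe] at this
          rw [← this]
          have h6 : v '' (B' : Set ι) = Set.range (fun x : B' => v x) := by
            ext z; simp
          rw [h6]
        rwa [h4] at this
      have h4 : 0 ≤ s a - μ := by linarith [hμ a (Finset.mem_insert_self _ _)]
      rw [h2, h2 B', h1, hs']
      nlinarith
    by_cases h : v a ∈ Submodule.span ℂ (v '' (B : Set ι))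
    · have hsp' : Submodule.span ℂ (v '' (B : Set ι)) =
          Submodule.span ℂ (v '' (insert a X : Finset ι)) := by
        rw [Finset.coe_insert, Set.image_insert_eq, Submodule.span_insert_eq_span]
        · exact hsp
        · rw [← hsp]; exact h
      exact ⟨B, hBX.trans (Finset.subset_insert _ _), hli, hsp', core B hli hsp' rfl⟩
    · have hli' : LinearIndepOn ℂ v ((insert a B : Finset ι) : Set ι) := by
        rw [Finset.coe_insert]; exact hli.insert h
      have hsp' : Submodule.span ℂ (v '' (insert a B : Finset ι)) =
          Submodule.span ℂ (v '' (insert a X : Finset ι)) := by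
        rw [Finset.coe_insert, Finset.coe_insert, Set.image_insert_eq, Set.image_insert_eq,
          Submodule.span_insert, Submodule.span_insert, hsp]
      refine ⟨insert a B, Finset.insert_subset_insert _ hBX, hli', hsp', core _ hli' hsp' ?_⟩
      rw [Finset.sum_insert haB]; simp

variable {ι : Type*} [DecidableEq ι] {N : ℕ}

def Mat (v : ι → Fin N → ℂ) (c : ι → ℝ) (X : Finset ι) : Matrix (Fin N) (Fin N) ℂ :=
  ∑ x ∈ X, (c x : ℂ) • vecMulVec (v x) (star (v x))

lemma psd_term (v : Fin N → ℂ) (c : ℝ) (hc : 0 ≤ c) :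
    ((c : ℂ) • vecMulVec v (star v)).PosSemidef :=
  (posSemidef_vecMulVec_self_star v).smul (by exact_mod_cast hc)

lemma det_update {A : Matrix (Fin N) (Fin N) ℂ} (hA : A.PosDef) (v : Fin N → ℂ) (t : ℝ) :
    (A + (t : ℂ) • vecMulVec v (star v)).det.re =
      A.det.re * (1 + t * (star v ⬝ᵥ (A⁻¹ *ᵥ v)).re) := by
  have hu : IsUnit A.det := (Matrix.isUnit_iff_isUnit_det A).1 hA.isUnit
  have h1 := det_add_replicateCol_mul_replicateRow (ι := Unit) hu ((t : ℂ) • v) (star v)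
  have h2 : replicateCol Unit ((t : ℂ) • v) * replicateRow Unit (star v) =
      (t : ℂ) • vecMulVec v (star v) := by
    rw [← vecMulVec_eq Unit]
    ext i j; simp [vecMulVec_apply]; ring
  rw [h2] at h1
  rw [h1, det_unique (n := Unit)]
  have h3 : (1 + replicateRow Unit (star v) * A⁻¹ * replicateCol Unit ((t : ℂ) • v) : Matrix Unit Unit ℂ) default default
      = 1 + t * (star v ⬝ᵥ (A⁻¹ *ᵥ v)) := by
    rw [Matrix.mul_assoc]
    simp [Matrix.mul_apply, dotProduct, Matrix.mulVec, Finset.mul_sum]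
  rw [h3]
  have h4 : 0 < A.det := hA.det_pos
  have h5 := (Complex.pos_iff.1 h4).2
  have h6 : (star v ⬝ᵥ (A⁻¹ *ᵥ v)).im = 0 :=
    ((Complex.nonneg_iff.1 (hA.inv.posSemidef.dotProduct_mulVec_nonneg v)).2).symm
  simp [Complex.mul_re, ← h5]

lemma det_mono (v : ι → Fin N → ℂ) (c : ι → ℝ) (hc : ∀ x, 0 ≤ c x)
    {A : Matrix (Fin N) (Fin N) ℂ} (hA : A.PosDef) (Y : Finset ι) :
    (A + Mat v c Y).PosDef ∧ A.det.re ≤ (A + Mat v c Y).det.re := by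
  induction Y using Finset.induction_on with
  | empty => simp [Mat, hA]
  | insert a Y ha ih =>
    obtain ⟨h1, h2⟩ := ih
    have h3 : A + Mat v c (insert a Y) = (A + Mat v c Y) + (c a : ℂ) • vecMulVec (v a) (star (v a)) := by
      unfold Mat; rw [Finset.sum_insert ha]; abel
    rw [h3]
    refine ⟨h1.add_posSemidef (psd_term _ _ (hc a)), ?_⟩
    rw [det_update h1]
    have h4 : 0 < (A + Mat v c Y).det.re := (Complex.pos_iff.1 h1.det_pos).1
    have h5 : 0 ≤ (star (v a) ⬝ᵥ ((A + Mat v c Y)⁻¹ *ᵥ v a)).re :=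
      (Complex.nonneg_iff.1 (h1.inv.posSemidef.dotProduct_mulVec_nonneg (v a))).1
    have := mul_nonneg (hc a) h5
    nlinarith

/-- the basis case -/
lemma det_basis (v : ι → Fin N → ℂ) (B : Finset ι) (hB : LinearIndepOn ℂ v (B : Set ι))
    (hcard : B.card = N) : ∃ κ : ℝ, 0 < κ ∧ ∀ c : ι → ℝ, (∀ x, 0 < c x) →
      (Mat v c B).PosDef ∧ (Mat v c B).det.re = κ * ∏ x ∈ B, c x := by
  let e : Fin N ≃ B := (B.equivFinOfCardEq hcard).symm
  let F : Matrix (Fin N) (Fin N) ℂ := Matrix.of fun i j => v (e j) i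
  have hF : IsUnit F.det := by
    rw [← Matrix.isUnit_iff_isUnit_det, ← Matrix.isUnit_transpose, ← Matrix.linearIndependent_rows_iff_isUnit]
    have h1 : LinearIndependent ℂ (fun x : B => v x) := hB
    exact h1.comp e e.injective
  have hM : ∀ c : ι → ℝ, Mat v c B = F * Matrix.diagonal (fun j => (c (e j) : ℂ)) * Fᴴ := by
    intro c
    unfold Mat
    rw [← Finset.sum_coe_sort B, ← e.sum_comp]
    ext i j
    simp [Matrix.sum_apply, Matrix.mul_apply, vecMulVec_apply, F, Matrix.diagonal_apply]
    refine Finset.sum_congr rfl fun k _ => by ring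
  refine ⟨Complex.normSq F.det, Complex.normSq_pos.2 hF.ne_zero, fun c hc => ⟨?_, ?_⟩⟩
  · rw [hM]
    refine PosDef.mul_mul_conjTranspose_same (PosDef.diagonal fun j => ?_) ?_
    · exact_mod_cast hc _
    · exact Matrix.vecMul_injective_of_isUnit ((Matrix.isUnit_iff_isUnit_det F).2 hF)
  · rw [hM, det_mul, det_mul, det_conjTranspose, det_diagonal]
    have h1 : ∏ j, (c (e j) : ℂ) = ((∏ x ∈ B, c x : ℝ) : ℂ) := by
      rw [← Finset.prod_coe_sort B, ← e.prod_comp]; push_cast; rfl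
    rw [h1]
    have h2 : F.det * ((∏ x ∈ B, c x : ℝ) : ℂ) * star F.det =
       ((Complex.normSq F.det * ∏ x ∈ B, c x : ℝ) : ℂ) := by
      rw [Complex.ofReal_mul, Complex.normSq_eq_conj_mul_self, Complex.star_def]; ring
    rw [h2, Complex.ofReal_re]

end PartC

section PartD
set_option linter.unusedSectionVars false
open scoped ComplexOrder Matrix
open Matrix

variable {ι : Type*} [Fintype ι] [DecidableEq ι] {N : ℕ}

lemma forster_min (v : ι → Fin N → ℂ) (K : ℝ) (hK : 0 < K)
    (hX : ∀ X : Finset ι, (X.card : ℝ) ≤ K * Module.finrank ℂ (Submodule.span ℂ (v '' X)))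
    (hcard : (Fintype.card ι : ℝ) = K * N) :
    ∃ c : ι → ℝ, (∀ x, 0 < c x) ∧ (Mat v c Finset.univ).PosDef ∧
      ∀ x, 1 / (2 * K) ≤ c x * (star (v x) ⬝ᵥ ((Mat v c Finset.univ)⁻¹ *ᵥ v x)).re := by
  -- lower bound for the determinant
  have hκB : ∀ B : Finset ι, ∃ κ : ℝ, 0 < κ ∧ (LinearIndepOn ℂ v (B : Set ι) → B.card = N →
      ∀ c : ι → ℝ, (∀ x, 0 < c x) →
        (Mat v c Finset.univ).PosDef ∧ κ * ∏ x ∈ B, c x ≤ (Mat v c Finset.univ).det.re) := by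
    intro B
    by_cases h : LinearIndepOn ℂ v (B : Set ι) ∧ B.card = N
    · obtain ⟨κ, hκ, h2⟩ := det_basis v B h.1 h.2
      refine ⟨κ, hκ, fun _ _ c hc => ?_⟩
      obtain ⟨h3, h4⟩ := h2 c hc
      have h5 := det_mono v c (fun x => (hc x).le) h3 (Finset.univ \ B)
      have h6 : Mat v c B + Mat v c (Finset.univ \ B) = Mat v c Finset.univ := by
        unfold Mat
        rw [add_comm]
        exact Finset.sum_sdiff (Finset.subset_univ B)
      rw [h6] at h5
      exact ⟨h5.1, h4 ▸ h5.2⟩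
    · exact ⟨1, one_pos, fun h1 h2 => absurd ⟨h1, h2⟩ h⟩
  choose κB hκB0 hκB1 using hκB
  obtain ⟨B₀, -, hB₀⟩ := Finset.exists_min_image (Finset.univ : Finset (Finset ι)) κB
    ⟨∅, Finset.mem_univ _⟩
  set κ := κB B₀ with hκdef
  have hκ : 0 < κ := hκB0 B₀
  let E : (ι → ℝ) → ι → ℝ := fun s x => Real.exp (s x)
  have hEpos : ∀ s x, 0 < E s x := fun s x => Real.exp_pos _
  have hbase : ∀ s : ι → ℝ, (Mat v (E s) Finset.univ).PosDef ∧
      κ * Real.exp ((∑ x, s x) / K) ≤ (Mat v (E s) Finset.univ).det.re := by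
    intro s
    obtain ⟨B, -, hli, hsp, hsum⟩ := greedy v K hX s Finset.univ
    have hBc : Module.finrank ℂ (Submodule.span ℂ (v '' (B : Set ι))) = B.card := by
      have h5 : LinearIndependent ℂ (fun x : B => v x) := hli
      have := finrank_span_eq_card h5
      rw [Fintype.card_coe] at this
      rw [← this]
      have h6 : v '' (B : Set ι) = Set.range (fun x : B => v x) := by
        ext z; simp
      rw [h6]
    have hBN : B.card = N := by
      have h1 := hX Finset.univ
      rw [← hsp, hBc, Finset.card_univ, hcard] at h1
      have h2 : (N : ℝ) ≤ B.card := le_of_mul_le_mul_left h1 hK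
      have h3 : B.card ≤ N := by
        rw [← hBc]
        refine (Submodule.finrank_le _).trans ?_
        simp
      exact le_antisymm h3 (by exact_mod_cast h2)
    obtain ⟨h1, h2⟩ := hκB1 B hli hBN (E s) (hEpos s)
    refine ⟨h1, le_trans ?_ h2⟩
    have h3 : ∏ x ∈ B, E s x = Real.exp (∑ x ∈ B, s x) := (Real.exp_sum B s).symm
    rw [h3]
    have h4 : (∑ x, s x) / K ≤ ∑ x ∈ B, s x := by
      rw [div_le_iff₀ hK]
      obtain ⟨μ, hμ⟩ : ∃ μ : ℝ, ∀ x, μ ≤ s x := by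
        obtain ⟨μ, hμ⟩ := (Set.finite_range s).bddBelow
        exact ⟨μ, fun x => hμ ⟨x, rfl⟩⟩
      have h5 := hsum μ (fun x _ => hμ x)
      rw [Finset.sum_sub_distrib, Finset.sum_sub_distrib, Finset.sum_const, Finset.sum_const,
        Finset.card_univ, nsmul_eq_mul, nsmul_eq_mul, hcard, hBN] at h5
      nlinarith
    have h6 : κ ≤ κB B := hB₀ B (Finset.mem_univ _)
    have := Real.exp_le_exp.2 h4
    have h7 := Real.exp_pos ((∑ x, s x) / K)
    have h8 := hκB0 B
    exact mul_le_mul h6 this h7.le h8.le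
  let D : (ι → ℝ) → ℝ := fun s => (Mat v (E s) Finset.univ).det.re
  have hDpos : ∀ s, 0 < D s := fun s => (Complex.pos_iff.1 (hbase s).1.det_pos).1
  have hDcont : Continuous D := by
    refine Complex.continuous_re.comp (Continuous.matrix_det ?_)
    unfold Mat
    refine continuous_finsetSum _ fun x _ => ?_
    have h1 : Continuous fun s : ι → ℝ => ((Real.exp (s x) : ℝ) : ℂ) := by fun_prop
    exact Continuous.smul h1 (continuous_const (y := vecMulVec (v x) (star (v x))))
  let Q : (ι → ℝ) → ℝ := fun s => ∑ x, (s x)^2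
  let Th : ℝ → (ι → ℝ) → ℝ := fun ε s => Real.log (D s) - (∑ x, s x) / K + ε * Q s
  have hlow : ∀ ε s, Real.log κ + ε * Q s ≤ Th ε s := by
    intro ε s
    have h1 := Real.log_le_log (mul_pos hκ (Real.exp_pos _)) (hbase s).2
    rw [Real.log_mul hκ.ne' (Real.exp_pos _).ne', Real.log_exp] at h1
    simp only [Th, D]
    linarith
  have hTh0 : ∀ ε, Th ε 0 = Real.log (D 0) := by
    intro ε; simp [Th, Q]
  set G := Real.log (D 0) - Real.log κ with hG
  have hG0 : 0 ≤ G := by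
    have := hlow 0 0
    rw [hTh0] at this
    simp at this
    linarith
  -- choose ε
  let ε : ℝ := 1 / (16 * K^2 * (G + 1))
  have hε : 0 < ε := by positivity
  have hcont : Continuous (Th ε) := by
    have h1 : Continuous fun s => Real.log (D s) := hDcont.log (fun s => (hDpos s).ne')
    have h2 : Continuous Q := by
      refine continuous_finsetSum _ fun x _ => ?_
      fun_prop
    have h3 : Continuous fun s : ι → ℝ => (∑ x, s x) / K := by fun_prop
    exact (h1.sub h3).add (continuous_const.mul h2)
  have hbd : Bornology.IsBounded {s | Th ε s ≤ Th ε 0} := by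
    refine (Metric.isBounded_closedBall (x := (0 : ι → ℝ)) (r := Real.sqrt (G / ε))).subset ?_
    intro s hs
    have hs' : Th ε s ≤ Th ε 0 := hs
    rw [hTh0] at hs'
    have h1 := hlow ε s
    have h2 : Q s ≤ G / ε := by
      rw [le_div_iff₀ hε]; linarith
    rw [mem_closedBall_zero_iff]
    refine (pi_norm_le_iff_of_nonneg (Real.sqrt_nonneg _)).2 fun x => ?_
    rw [Real.norm_eq_abs]
    refine Real.abs_le_sqrt (le_trans ?_ h2)
    exact Finset.single_le_sum (f := fun x => (s x)^2) (fun _ _ => sq_nonneg _) (Finset.mem_univ x)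
  obtain ⟨s, hs⟩ := hcont.exists_forall_le_of_isBounded 0 hbd
  refine ⟨E s, hEpos s, (hbase s).1, fun x => ?_⟩
  set τ := E s x * (star (v x) ⬝ᵥ ((Mat v (E s) Finset.univ)⁻¹ *ᵥ v x)).re with hτ
  have hQs : (s x)^2 ≤ G / ε := by
    have h1 := hlow ε s
    have h2 := hs 0
    rw [hTh0] at h2
    have h3 : Q s ≤ G / ε := by
      rw [le_div_iff₀ hε]; linarith
    exact le_trans (Finset.single_le_sum (f := fun x => (s x)^2) (fun _ _ => sq_nonneg _)
      (Finset.mem_univ x)) h3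
  have hτ0 : 0 ≤ τ := mul_nonneg (hEpos s x).le
    (Complex.nonneg_iff.1 ((hbase s).1.inv.posSemidef.dotProduct_mulVec_nonneg (v x))).1
  -- one variable function
  have hD1 : ∀ h : ℝ, D (s + Pi.single x h) = D s * (1 + (Real.exp h - 1) * τ) := by
    intro h
    have h1 : Mat v (E (s + Pi.single x h)) Finset.univ =
        Mat v (E s) Finset.univ + (((Real.exp h - 1) * E s x : ℝ) : ℂ) • vecMulVec (v x) (star (v x)) := by
      unfold Mat
      rw [← Finset.sum_erase_add _ _ (Finset.mem_univ x),
        ← Finset.sum_erase_add (s := Finset.univ) (a := x) (f := fun x => (E s x : ℂ) • vecMulVec (v x) (star (v x))) (Finset.mem_univ x), add_assoc, ← add_smul]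
      congr 1
      · refine Finset.sum_congr rfl fun y hy => ?_
        have : y ≠ x := (Finset.mem_erase.1 hy).1
        simp [E, this]
      · congr 1
        have : E (s + Pi.single x h) x = E s x + (Real.exp h - 1) * E s x := by
          simp [E, Real.exp_add]; ring
        rw [this]; push_cast; ring
    simp only [D]
    rw [h1, det_update (hbase s).1, mul_assoc (Real.exp h - 1), ← hτ]
  let φ : ℝ → ℝ := fun h => Real.log (1 + (Real.exp h - 1) * τ) - h / K + ε * (2 * h * s x + h^2)
  have hφmin : ∀ h, φ 0 ≤ φ h := by
    intro h
    have h1 := hs (s + Pi.single x h)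
    have hpos : 0 < 1 + (Real.exp h - 1) * τ := by
      have h2 := hDpos (s + Pi.single x h)
      rw [hD1] at h2
      exact (pos_iff_pos_of_mul_pos h2).1 (hDpos s)
    have h3 : Q (s + Pi.single x h) = Q s + (2 * h * s x + h^2) := by
      simp only [Q]
      rw [← Finset.sum_erase_add _ _ (Finset.mem_univ x),
        ← Finset.sum_erase_add (s := Finset.univ) (a := x) (f := fun x => (s x)^2) (Finset.mem_univ x)]
      have : ∑ y ∈ Finset.univ.erase x, ((s + Pi.single x h : ι → ℝ) y)^2 = ∑ y ∈ Finset.univ.erase x, (s y)^2 := by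
        refine Finset.sum_congr rfl fun y hy => ?_
        have : y ≠ x := (Finset.mem_erase.1 hy).1
        simp [this]
      rw [this]
      simp
      ring
    have h4 : ∑ y, (s + Pi.single x h : ι → ℝ) y = ∑ y, s y + h := by
      simp [Finset.sum_add_distrib]
    simp only [Th] at h1
    rw [hD1, h3, h4, Real.log_mul (hDpos s).ne' hpos.ne'] at h1
    simp only [φ]
    simp
    have : (∑ x, s x + h) / K = (∑ x, s x)/K + h / K := by ring
    rw [this] at h1
    linarith
  have hder : HasDerivAt φ (τ - 1 / K + ε * (2 * s x)) 0 := by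
    have h1 : HasDerivAt (fun h : ℝ => 1 + (Real.exp h - 1) * τ) (τ) 0 := by
      have := (((Real.hasDerivAt_exp 0).sub_const 1).mul_const τ).const_add 1
      simpa using this
    have h2 := h1.log (by simp)
    have h3 : HasDerivAt (fun h : ℝ => ε * (2 * h * s x + h^2)) (ε * (2 * s x)) 0 := by
      have h4 : HasDerivAt (fun h : ℝ => 2 * h * s x) (2 * s x) 0 := by
        have := ((hasDerivAt_id (0:ℝ)).const_mul 2).mul_const (s x)
        simpa using this
      have h5 : HasDerivAt (fun h : ℝ => h^2) 0 0 := by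
        have := hasDerivAt_pow 2 (0:ℝ)
        simpa using this
      have := (h4.add h5).const_mul ε
      simpa using this
    have h4 : HasDerivAt (fun h : ℝ => h / K) (1 / K) 0 := (hasDerivAt_id (0:ℝ)).div_const K
    have := (h2.sub h4).add h3
    have e : τ / (1 + (Real.exp 0 - 1) * τ) - 1 / K + ε * (2 * s x) = τ - 1 / K + ε * (2 * s x) := by
      simp
    rw [← e]
    exact this
  have hzero : τ - 1 / K + ε * (2 * s x) = 0 := by
    have : IsLocalMin φ 0 := Filter.Eventually.of_forall hφmin
    exact this.hasDerivAt_eq_zero hder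
  have hsmall : ε * (2 * s x) ≤ 1 / (2 * K) := by
    have h1 : (ε * (2 * s x))^2 ≤ (1 / (2 * K))^2 := by
      have h2 : (ε * (2 * s x))^2 ≤ 4 * ε^2 * (G / ε) := by nlinarith [sq_nonneg ε]
      have h3 : 4 * ε^2 * (G / ε) = 4 * ε * G := by field_simp
      have h4 : 4 * ε * G ≤ (1 / (2 * K))^2 := by
        have h5 : ε * (16 * K^2 * (G + 1)) = 1 := by
          simp only [ε]; field_simp
        have : (1 / (2 * K))^2 = 1 / (4 * K^2) := by field_simp; norm_num
        rw [this, le_div_iff₀ (by positivity)]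
        have h6 : 0 < ε * (16 * K^2) := by positivity
        nlinarith
      linarith
    exact (abs_le_of_sq_le_sq' h1 (by positivity)).2
  have : 1 / K = 1 / (2 * K) + 1 / (2 * K) := by field_simp; norm_num
  linarith

end PartD

section PartE
set_option linter.unusedSectionVars false
open scoped ComplexOrder Matrix
open Matrix

lemma trace_cs {ι E : Type*} [NormedAddCommGroup E] [InnerProductSpace ℂ E]
    [FiniteDimensional ℂ E] (u : ι → E) (X : Finset ι) (hu : ∀ x ∈ X, ‖u x‖ = 1) :
    (X.card : ℝ)^2 ≤ Module.finrank ℂ E * ∑ x ∈ X, ∑ y ∈ X, ‖inner ℂ (u x) (u y)‖^2 := by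
  set e := stdOrthonormalBasis ℂ E
  let G : Fin (Module.finrank ℂ E) → Fin (Module.finrank ℂ E) → ℂ := fun i j =>
    ∑ x ∈ X, inner ℂ (e i) (u x) * inner ℂ (u x) (e j)
  have h1 : ∑ i, G i i = X.card := by
    simp only [G]
    rw [Finset.sum_comm]
    have : ∀ x ∈ X, ∑ i, inner ℂ (e i) (u x) * inner ℂ (u x) (e i) = 1 := by
      intro x hx
      have h := e.sum_inner_mul_inner (u x) (u x)
      rw [inner_self_eq_norm_sq_to_K, hu x hx] at h
      simp_rw [mul_comm] at h ⊢
      simpa using h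
    rw [Finset.sum_congr rfl this]
    simp
  have h2 : ((∑ i, ∑ j, ‖G i j‖^2 : ℝ) : ℂ) = ((∑ x ∈ X, ∑ y ∈ X, ‖inner ℂ (u x) (u y)‖^2 : ℝ) : ℂ) := by
    have hn : ∀ z : ℂ, ((‖z‖^2 : ℝ) : ℂ) = z * (starRingEnd ℂ) z := by
      intro z; rw [Complex.mul_conj, Complex.normSq_eq_norm_sq]
    push_cast [hn]
    simp only [G, map_sum, map_mul, inner_conj_symm]
    have e1 : ∀ x y, inner ℂ (u x) (u y) = ∑ j, inner ℂ (u x) (e j) * inner ℂ (e j) (u y) :=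
      fun x y => (e.sum_inner_mul_inner (u x) (u y)).symm
    have e2 : ∀ i j, (∑ x ∈ X, inner ℂ (e i) (u x) * inner ℂ (u x) (e j)) *
        (∑ y ∈ X, inner ℂ (u y) (e i) * inner ℂ (e j) (u y)) = ∑ x ∈ X, ∑ y ∈ X,
        (inner ℂ (u y) (e i) * inner ℂ (e i) (u x)) * (inner ℂ (u x) (e j) * inner ℂ (e j) (u y)) := by
      intro i j
      rw [Finset.sum_mul_sum]
      refine Finset.sum_congr rfl fun x _ => Finset.sum_congr rfl fun y _ => by ring
    have e3 : ∀ x y, inner ℂ (u x) (u y) * inner ℂ (u y) (u x) = ∑ i, ∑ j, 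
        (inner ℂ (u y) (e i) * inner ℂ (e i) (u x)) * (inner ℂ (u x) (e j) * inner ℂ (e j) (u y)) := by
      intro x y
      rw [mul_comm, e1 x y, e1 y x, Finset.sum_mul_sum]
    have hn2 : ∀ z : ℂ, ((‖z‖ : ℂ)^2) = z * (starRingEnd ℂ) z := by
      intro z; rw [← hn]; push_cast; rfl
    simp only [e2, e3]
    calc _ = ∑ i, ∑ x ∈ X, ∑ j, ∑ y ∈ X, _ := Finset.sum_congr rfl fun i _ => Finset.sum_comm
      _ = ∑ x ∈ X, ∑ i, ∑ j, ∑ y ∈ X, _ := Finset.sum_comm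
      _ = ∑ x ∈ X, ∑ i, ∑ y ∈ X, ∑ j, _ := Finset.sum_congr rfl fun i _ => Finset.sum_congr rfl fun i _ => Finset.sum_comm
      _ = _ := Finset.sum_congr rfl fun i _ => Finset.sum_comm
  have h2' : ∑ i, ∑ j, ‖G i j‖^2 = ∑ x ∈ X, ∑ y ∈ X, ‖inner ℂ (u x) (u y)‖^2 := by exact_mod_cast h2
  rw [← h2']
  have h3 : (X.card : ℝ) ≤ ∑ i, ‖G i i‖ := by
    have := norm_sum_le Finset.univ (fun i => G i i)
    rw [h1] at this
    simpa using this
  have h4 : (X.card : ℝ)^2 ≤ (∑ i, ‖G i i‖)^2 := by gcongr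
  have h5 := sq_sum_le_card_mul_sum_sq (s := (Finset.univ : Finset (Fin (Module.finrank ℂ E)))) (f := fun i => ‖G i i‖)
  rw [Finset.card_univ, Fintype.card_fin] at h5
  have h6 : ∑ i, ‖G i i‖^2 ≤ ∑ i, ∑ j, ‖G i j‖^2 :=
    Finset.sum_le_sum fun i _ => Finset.single_le_sum (f := fun j => ‖G i j‖^2) (fun _ _ => by positivity) (Finset.mem_univ i)
  refine h4.trans (h5.trans ?_)
  gcongr

lemma psd_factor {N : ℕ} (B : Matrix (Fin N) (Fin N) ℂ) (hB : B.PosSemidef) :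
    ∃ C : Matrix (Fin N) (Fin N) ℂ, B = Cᴴ * C := by
  open scoped MatrixOrder Matrix.Norms.L2Operator in
  have := (CStarAlgebra.nonneg_iff_eq_star_mul_self (a := B)).1 (Matrix.nonneg_iff_posSemidef.2 hB)
  exact this

variable {ι : Type*} [Fintype ι] [DecidableEq ι] {N : ℕ}

lemma weights (v : ι → Fin N → ℂ) (K : ℝ) (hK : 0 < K)
    (hX : ∀ X : Finset ι, (X.card : ℝ) ≤ K * Module.finrank ℂ (Submodule.span ℂ (v '' X)))
    (hcard : (Fintype.card ι : ℝ) = K * N) :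
    ∃ w : ι → ι → ℝ, (∀ x y, 0 ≤ w x y ∧ w x y ≤ 1) ∧ (∀ x, ∑ y, w x y ≤ 2 * K) ∧
      ∀ X : Finset ι, (X.card : ℝ)^2 ≤
        Module.finrank ℂ (Submodule.span ℂ (v '' X)) * ∑ x ∈ X, ∑ y ∈ X, w x y := by
  obtain ⟨c, hc, hM, h1⟩ := forster_min v K hK hX hcard
  obtain ⟨C, hC⟩ := psd_factor _ hM.inv.posSemidef
  set M := Mat v c Finset.univ with hMdef
  have hdet : IsUnit M.det := (Matrix.isUnit_iff_isUnit_det _).1 hM.isUnit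
  have hCM : C * M * Cᴴ = 1 := by
    have h2 : Cᴴ * (C * M) = 1 := by
      rw [← Matrix.mul_assoc, ← hC]; exact Matrix.nonsing_inv_mul _ hdet
    exact mul_eq_one_comm.1 h2
  let L : (Fin N → ℂ) →ₗ[ℂ] EuclideanSpace ℂ (Fin N) :=
    (WithLp.linearEquiv 2 ℂ (Fin N → ℂ)).symm.toLinearMap ∘ₗ C.mulVecLin
  let a : ι → EuclideanSpace ℂ (Fin N) := fun x => L (v x)
  have ha : ∀ x, a x = WithLp.toLp 2 (C *ᵥ v x) := fun x => rfl
  have hin : ∀ p q : Fin N → ℂ, inner ℂ (WithLp.toLp 2 p : EuclideanSpace ℂ (Fin N)) (WithLp.toLp 2 q) = star p ⬝ᵥ q := by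
    intro p q
    rw [EuclideanSpace.inner_toLp_toLp, dotProduct_comm]
  have hnorm : ∀ x, (star (v x) ⬝ᵥ (M⁻¹ *ᵥ v x)).re = ‖a x‖^2 := by
    intro x
    have : star (v x) ⬝ᵥ (M⁻¹ *ᵥ v x) = inner ℂ (a x) (a x) := by
      rw [ha, hin, hC, star_mulVec, ← dotProduct_mulVec, mulVec_mulVec]
    rw [this, inner_self_eq_norm_sq_to_K]
    norm_cast
  have hpos : ∀ x, 0 < ‖a x‖ := by
    intro x
    have h2 := h1 x
    rw [hnorm] at h2
    by_contra h
    have h3 : ‖a x‖ = 0 := le_antisymm (not_lt.1 h) (norm_nonneg _)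
    rw [h3] at h2
    have : 0 < 1 / (2 * K) := by positivity
    rw [zero_pow two_ne_zero, mul_zero] at h2
    linarith
  let u : ι → EuclideanSpace ℂ (Fin N) := fun x => ((‖a x‖ : ℂ))⁻¹ • a x
  have hu : ∀ x, ‖u x‖ = 1 := by
    intro x
    simp only [u, norm_smul, norm_inv, Complex.norm_real, norm_norm]
    exact inv_mul_cancel₀ (hpos x).ne'
  have hframe : ∀ z : EuclideanSpace ℂ (Fin N), ∑ y, c y * ‖inner ℂ z (a y)‖^2 = ‖z‖^2 := by
    intro z
    obtain ⟨p, rfl⟩ : ∃ p, z = WithLp.toLp 2 p := ⟨z.ofLp, rfl⟩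
    have h2 : star p ⬝ᵥ ((C * M * Cᴴ) *ᵥ p) = ∑ y, (c y : ℂ) * ((star p ⬝ᵥ (C *ᵥ v y)) * (star (C *ᵥ v y) ⬝ᵥ p)) := by
      have h3 : C * M * Cᴴ = ∑ y, (c y : ℂ) • vecMulVec (C *ᵥ v y) (star (C *ᵥ v y)) := by
        rw [hMdef, Mat, Finset.mul_sum, Finset.sum_mul]
        refine Finset.sum_congr rfl fun y _ => ?_
        rw [Matrix.mul_smul, Matrix.smul_mul, Matrix.mul_vecMulVec, Matrix.vecMulVec_mul, star_mulVec]
      rw [h3, Matrix.sum_mulVec, dotProduct_sum]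
      refine Finset.sum_congr rfl fun y _ => ?_
      rw [smul_mulVec, dotProduct_smul, vecMulVec_mulVec]
      simp [dotProduct_smul, mul_comm, mul_left_comm]
    rw [hCM, one_mulVec] at h2
    have h4 : ((∑ y, c y * ‖inner ℂ (WithLp.toLp 2 p : EuclideanSpace ℂ (Fin N)) (a y)‖^2 : ℝ) : ℂ) = ((‖(WithLp.toLp 2 p : EuclideanSpace ℂ (Fin N))‖^2 : ℝ) : ℂ) := by
      have h5 : ((‖(WithLp.toLp 2 p : EuclideanSpace ℂ (Fin N))‖^2 : ℝ) : ℂ) = inner ℂ (WithLp.toLp 2 p : EuclideanSpace ℂ (Fin N)) (WithLp.toLp 2 p) := by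
        rw [inner_self_eq_norm_sq_to_K]; norm_cast
      rw [h5, hin, h2]
      push_cast
      refine Finset.sum_congr rfl fun y _ => ?_
      congr 1
      rw [← hin, ← hin, ← ha, ← inner_conj_symm (𝕜 := ℂ) (a y), Complex.mul_conj, Complex.normSq_eq_norm_sq]
      push_cast; rfl
    exact_mod_cast h4
  refine ⟨fun x y => ‖inner ℂ (u x) (u y)‖^2, fun x y => ⟨by positivity, ?_⟩, fun x => ?_, fun X => ?_⟩
  · have := norm_inner_le_norm (𝕜 := ℂ) (u x) (u y)
    rw [hu, hu] at this
    have h0 := norm_nonneg (inner ℂ (u x) (u y))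
    simp only
    nlinarith
  · have h2 : ∀ y, ‖inner ℂ (u x) (u y)‖^2 ≤ 2 * K * (c y * ‖inner ℂ (u x) (a y)‖^2) := by
      intro y
      have h3 : ‖inner ℂ (u x) (u y)‖ = ‖a y‖⁻¹ * ‖inner ℂ (u x) (a y)‖ := by
        simp only [u]
        rw [inner_smul_right, norm_mul, norm_inv, Complex.norm_real, norm_norm]
      rw [h3, mul_pow, ← mul_assoc]
      have h4 := h1 y
      rw [hnorm] at h4
      have h5 : (‖a y‖⁻¹)^2 ≤ 2 * K * c y := by
        rw [inv_pow, inv_le_iff_one_le_mul₀ (by have := hpos y; positivity)]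
        rw [div_le_iff₀ (by positivity)] at h4
        nlinarith
      gcongr
    calc _ ≤ ∑ y, 2 * K * (c y * ‖inner ℂ (u x) (a y)‖^2) := Finset.sum_le_sum fun y _ => h2 y
      _ = 2 * K := by rw [← Finset.mul_sum, hframe, hu]; simp
  · set U := Submodule.map L (Submodule.span ℂ (v '' X))
    have hmem : ∀ x ∈ X, u x ∈ U := by
      intro x hx
      refine U.smul_mem _ (Submodule.mem_map_of_mem (Submodule.subset_span ⟨x, hx, rfl⟩))
    let u' : X → U := fun x => ⟨u x, hmem x x.2⟩
    have h2 := trace_cs u' Finset.univ (fun x _ => hu x)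
    have h3 : ∑ x ∈ X, ∑ y ∈ X, ‖inner ℂ (u x) (u y)‖^2 = ∑ x : X, ∑ y : X, ‖inner ℂ (u' x) (u' y)‖^2 := by
      rw [← Finset.sum_coe_sort]
      refine Finset.sum_congr rfl fun x _ => ?_
      rw [← Finset.sum_coe_sort]
      rfl
    rw [h3]
    rw [Finset.card_univ, Fintype.card_coe] at h2
    refine h2.trans ?_
    have : Module.finrank ℂ U ≤ Module.finrank ℂ (Submodule.span ℂ (v '' X)) := Submodule.finrank_map_le _ _
    gcongr

end PartE

section PartF
set_option linter.unusedSectionVars false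
open Classical in
lemma kst {α β : Type*} (w : α → ℝ) (hw0 : ∀ x, 0 ≤ w x) (hw1 : ∀ x, w x ≤ 1)
    (U : Finset α) (B : ℝ) (hB0 : 0 ≤ B) (j : ℕ) : ∀ (A : Finset β) (Y : β → Finset α)
    (_ : ∀ P : Finset α, P.card = j → ((A.filter (fun t => P ⊆ Y t)).card : ℝ) ≤ B)
    (_ : ∀ t ∈ A, Y t ⊆ U) (c : ℝ) (_ : (j : ℝ) - 1 ≤ c),
    ∑ t ∈ A, (max (∑ y ∈ Y t, w y - c) 0)^j ≤ B * (∑ y ∈ U, w y)^j := by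
  induction j with
  | zero =>
    intro A Y hP hU c hc
    have := hP ∅ rfl
    simpa using this
  | succ j ih =>
    intro A Y hP hU c hc
    push_cast at hc
    have hj : (0 : ℝ) ≤ j := Nat.cast_nonneg _
    have hc0 : 0 ≤ c := by linarith
    have h1 : ∀ t ∈ A, (max (∑ y ∈ Y t, w y - c) 0)^(j+1) ≤
        ∑ y ∈ U, if y ∈ Y t then w y * (max (∑ z ∈ (Y t).erase y, w z - (c - 1)) 0)^j else 0 := by
      intro t ht
      have hf : 0 ≤ ∑ y ∈ Y t, w y := Finset.sum_nonneg fun y _ => hw0 y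
      have h2 : max (∑ y ∈ Y t, w y - c) 0 ≤ ∑ y ∈ Y t, w y := max_le (by linarith) hf
      have h3 : (0:ℝ) ≤ max (∑ y ∈ Y t, w y - c) 0 := le_max_right _ _
      calc _ = (max (∑ y ∈ Y t, w y - c) 0)^j * max (∑ y ∈ Y t, w y - c) 0 := pow_succ _ _
        _ ≤ (max (∑ y ∈ Y t, w y - c) 0)^j * ∑ y ∈ Y t, w y := by gcongr
        _ = ∑ y ∈ Y t, w y * (max (∑ y ∈ Y t, w y - c) 0)^j := by
            rw [mul_comm, Finset.sum_mul]
        _ ≤ ∑ y ∈ Y t, w y * (max (∑ z ∈ (Y t).erase y, w z - (c - 1)) 0)^j := by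
            refine Finset.sum_le_sum fun y hy => ?_
            have h4 := Finset.sum_erase_add (Y t) w hy
            have h5 := hw1 y
            have : ∑ y ∈ Y t, w y - c ≤ ∑ z ∈ (Y t).erase y, w z - (c - 1) := by linarith
            have h6 := hw0 y
            gcongr
        _ = _ := by
            rw [← Finset.sum_filter]
            congr 1
            ext y
            simp only [Finset.mem_filter]
            exact ⟨fun h => ⟨hU t ht h, h⟩, fun h => h.2⟩
    calc _ ≤ ∑ t ∈ A, ∑ y ∈ U, if y ∈ Y t then w y * (max (∑ z ∈ (Y t).erase y, w z - (c - 1)) 0)^j else 0 :=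
          Finset.sum_le_sum h1
      _ = ∑ y ∈ U, ∑ t ∈ A, if y ∈ Y t then w y * (max (∑ z ∈ (Y t).erase y, w z - (c - 1)) 0)^j else 0 := Finset.sum_comm
      _ ≤ ∑ y ∈ U, w y * (B * (∑ y ∈ U, w y)^j) := by
          refine Finset.sum_le_sum fun y hy => ?_
          rw [← Finset.sum_filter, ← Finset.mul_sum]
          refine mul_le_mul_of_nonneg_left ?_ (hw0 y)
          refine ih (A.filter fun t => y ∈ Y t) (fun t => (Y t).erase y) ?_ ?_ (c - 1) (by linarith)
          · intro P hPj
            by_cases hy : y ∈ P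
            · have : (A.filter fun t => y ∈ Y t).filter (fun t => P ⊆ (Y t).erase y) = ∅ := by
                refine Finset.filter_false_of_mem fun t _ h => ?_
                exact absurd (h hy) (by simp)
              rw [this]
              simpa using hB0
            · have h2 := hP (insert y P) (by rw [Finset.card_insert_of_notMem hy, hPj])
              refine le_trans ?_ h2
              norm_cast
              refine Finset.card_le_card fun t ht => ?_
              simp only [Finset.mem_filter] at ht ⊢
              refine ⟨ht.1.1, Finset.insert_subset ht.1.2 (ht.2.trans (Finset.erase_subset _ _))⟩
          · intro t ht
            exact (Finset.erase_subset _ _).trans (hU t (Finset.mem_filter.1 ht).1)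
      _ = _ := by rw [← Finset.sum_mul]; ring

end PartF

section PartG
set_option linter.unusedSectionVars false
open Classical in
lemma part0 {α β : Type*} (S : Finset α) (T : Finset β) (inc : α → β → Prop) (k b : ℕ)
    (hk : 2 ≤ k) (hb : 1 ≤ b)
    (hfree : ∀ P : Finset α, P ⊆ S → P.card = k →
      ((T.filter (fun t => ∀ x ∈ P, inc x t)).card : ℝ) ≤ b - 1)
    (R D q : ℝ) (hR : 0 < R) (hq : 0 < q) (hqk : q^(k-1) = b / R) (hD : (T.card : ℝ) ≤ D)
    (hrich : ∀ x ∈ S, R ≤ ((T.filter (fun t => inc x t)).card : ℝ)) (hM : q * D / R ≤ 1 / 4) :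
    (S.card : ℝ) ≤ 2 * k * D / R := by
  by_contra hcon
  push Not at hcon
  obtain ⟨j, rfl⟩ : ∃ j, k = j + 2 := ⟨k - 2, by omega⟩
  have hb1 : (1:ℝ) ≤ b := by exact_mod_cast hb
  have hD0 : 0 ≤ D := le_trans (Nat.cast_nonneg _) hD
  set N : ℝ := (S.card : ℝ) with hN
  have hN0 : 0 < N := by
    refine lt_of_le_of_lt ?_ hcon
    positivity
  have h1 := kst (fun _ : α => (1:ℝ)) (fun _ => zero_le_one) (fun _ => le_rfl) S ((b:ℝ) - 1) (by linarith)
    (j+2) T (fun t => S.filter (fun x => inc x t)) (by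
      intro P hP
      by_cases hPS : P ⊆ S
      · refine le_trans ?_ (hfree P hPS hP)
        norm_cast
        refine Finset.card_le_card fun t ht => ?_
        simp only [Finset.mem_filter] at ht ⊢
        exact ⟨ht.1, fun x hx => (Finset.mem_filter.1 (ht.2 hx)).2⟩
      · have : T.filter (fun t => P ⊆ S.filter (fun x => inc x t)) = ∅ :=
          Finset.filter_false_of_mem fun t _ h => hPS (h.trans (Finset.filter_subset _ _))
        rw [this]; simp; linarith)
      (fun t _ => Finset.filter_subset _ _) ((j:ℝ) + 1) (by push_cast; linarith)
  simp only [Finset.sum_const, nsmul_eq_mul, mul_one] at h1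
  set a : β → ℝ := fun t => max (((S.filter (fun x => inc x t)).card : ℝ) - (j+1)) 0 with ha
  have hI : R * N ≤ ∑ t ∈ T, ((S.filter (fun x => inc x t)).card : ℝ) := by
    have h2 : ∑ t ∈ T, ((S.filter (fun x => inc x t)).card : ℝ) = ∑ x ∈ S, ((T.filter (fun t => inc x t)).card : ℝ) := by
      norm_cast
      simp only [Finset.card_filter]
      exact Finset.sum_comm
    rw [h2, hN]
    have := Finset.sum_le_sum hrich
    rw [Finset.sum_const, nsmul_eq_mul] at this
    linarith
  have h2 : R * N - (j+1) * D ≤ ∑ t ∈ T, a t := by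
    have : ∑ t ∈ T, (((S.filter (fun x => inc x t)).card : ℝ) - (j+1)) ≤ ∑ t ∈ T, a t :=
      Finset.sum_le_sum fun t _ => le_max_left _ _
    rw [Finset.sum_sub_distrib, Finset.sum_const, nsmul_eq_mul] at this
    have h3 : (T.card:ℝ) * (j+1) ≤ (j+1) * D := by rw [mul_comm]; gcongr
    linarith
  have hcon2 : 2 * ((j:ℝ) + 2) * D < R * N := by
    rw [div_lt_iff₀ hR] at hcon; push_cast at hcon; linarith
  have h3 : R * N / 2 ≤ ∑ t ∈ T, a t := by
    have : ((j:ℝ)+1) * D ≤ ((j:ℝ)+2) * D := by gcongr; norm_num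
    linarith
  have h4 := pow_sum_le_card_mul_sum_pow (s := T) (f := a) (fun t _ => le_max_right _ _) (j+1)
  have h5 : (R * N / 2)^(j+2) ≤ D^(j+1) * ((b - 1) * N^(j+2)) := by
    refine (pow_le_pow_left₀ (by positivity) h3 _).trans (h4.trans ?_)
    gcongr
  have h6 : (R/2)^(j+2) ≤ D^(j+1) * (b-1) := by
    have e1 : (R * N / 2)^(j+2) = (R/2)^(j+2) * N^(j+2) := by rw [← mul_pow]; ring
    rw [e1, ← mul_assoc] at h5
    exact le_of_mul_le_mul_right h5 (by positivity)
  have hDpos : 0 < D := by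
    by_contra h
    have : D = 0 := le_antisymm (not_lt.1 h) hD0
    rw [this] at h6
    have : 0 < (R/2)^(j+2) := by positivity
    simp at h6
    linarith
  have h7 : D^(j+1) * b ≤ R^(j+2) * (1/4)^(j+1) := by
    have h8 := pow_le_pow_left₀ (by positivity) hM (j+1)
    rw [div_pow, mul_pow] at h8
    have hqk2 : q^(j+1) = b / R := hqk
    rw [hqk2, div_le_iff₀ (by positivity)] at h8
    have e1 : b / R * D^(j+1) * R = D^(j+1) * b := by field_simp
    have e2 : R^(j+2) = R^(j+1) * R := pow_succ _ _
    rw [← e1, e2]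
    nlinarith
  have h9 : (R/2)^(j+2) = R^(j+2) * ((1/2)^(j+2)) := by rw [← mul_pow]; ring
  have h10 : ((1:ℝ)/4)^(j+1) ≤ (1/2)^(j+2) := by
    have : ((1:ℝ)/4)^(j+1) = (1/2)^(2*(j+1)) := by rw [pow_mul]; norm_num
    rw [this]
    exact pow_le_pow_of_le_one (by norm_num) (by norm_num) (by omega)
  have h11 : R^(j+2) * (1/4)^(j+1) ≤ R^(j+2) * ((1/2)^(j+2)) := by gcongr
  have h12 : 0 < D^(j+1) := by positivity
  nlinarith

lemma arith1 {ρ Λ q K j : ℝ} (hρ0 : 0 < ρ) (hq : 0 < q) (hK : 0 < K) (hq16 : q ≤ 1/16)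
    (h6 : ρ * K ≤ (ρ + Λ) * ((j+1) + 2 * K * q)) (hΛ : Λ * (16 * q) ≤ ρ) (hj : 0 ≤ j) :
    6 * K * q ≤ j + 1 := by
  have h7 : (ρ + Λ) * (16 * q) ≤ 2 * ρ := by nlinarith
  have h8 : (ρ + Λ) * (2 * K * q) ≤ ρ * K / 4 := by
    have := mul_le_mul_of_nonneg_right h7 (show 0 ≤ K / 8 by positivity)
    linarith
  have h9 : (3/4) * (ρ * K) ≤ (ρ + Λ) * (j+1) := by linarith
  have h10 : (3/4) * (ρ * K) * (16 * q) ≤ 2 * ρ * (j+1) := by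
    have := mul_le_mul_of_nonneg_right h9 (show 0 ≤ 16 * q by positivity)
    have h11 := mul_le_mul_of_nonneg_right h7 (show (0:ℝ) ≤ j+1 by positivity)
    linarith
  have h12 : (6 * K * q) * ρ ≤ (j+1) * ρ := by linarith
  exact le_of_mul_le_mul_right h12 hρ0

open Classical in
lemma part1core {ι β : Type*} [Fintype ι] [Nonempty ι] (T : Finset β) (inc : ι → β → Prop)
    (k b : ℕ) (hk : 2 ≤ k) (hb : 1 ≤ b)
    (hfree : ∀ P : Finset ι, P.card = k →
      ((T.filter (fun t => ∀ x ∈ P, inc x t)).card : ℝ) ≤ b - 1)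
    (R q K N Λ : ℝ) (hR : 0 < R) (hq : 0 < q) (hqk : q^(k-1) = b / R) (hK : 0 < K) (hN : 0 < N)
    (hrich : ∀ x, R ≤ ((T.filter (fun t => inc x t)).card : ℝ))
    (hcard : (Fintype.card ι : ℝ) = K * N)
    (w : ι → ι → ℝ) (hw : ∀ x y, 0 ≤ w x y ∧ w x y ≤ 1) (hwK : ∀ x, ∑ y, w x y ≤ 2 * K)
    (h : Finset ι → ℝ) (h0 : ∀ X, 0 ≤ h X)
    (hX : ∀ X : Finset ι, (X.card : ℝ)^2 ≤ h X * ∑ x ∈ X, ∑ y ∈ X, w x y)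
    (L : β → ℝ) (hL : ∀ t ∈ T, h (Finset.univ.filter (fun x => inc x t)) ≤
      ((Finset.univ.filter (fun x => inc x t)).card : ℝ) / K + L t * N)
    (hΛ : ∑ t ∈ T, L t ≤ Λ) (hq16 : q ≤ 1/16) (hΛq : Λ * (16 * q) ≤ R) :
    K * (6 * q) ≤ k := by
  obtain ⟨j, rfl⟩ : ∃ j, k = j + 2 := ⟨k - 2, by omega⟩
  have hb1 : (1:ℝ) ≤ b := by exact_mod_cast hb
  have hqk2 : q^(j+1) = b / R := hqk
  set Y : β → Finset ι := fun t => Finset.univ.filter (fun x => inc x t) with hY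
  set A : ι → Finset β := fun x => T.filter (fun t => inc x t) with hA
  set I : ℝ := ∑ t ∈ T, ((Y t).card : ℝ) with hI
  have hdc : ∀ g : ι → β → ℝ, ∑ t ∈ T, ∑ x ∈ Y t, g x t = ∑ x, ∑ t ∈ A x, g x t := by
    intro g
    simp only [hY, hA, Finset.sum_filter]
    exact Finset.sum_comm
  have hI2 : I = ∑ x, ((A x).card : ℝ) := by
    have := hdc (fun _ _ => 1)
    simpa using this
  have hIR : R * (K * N) ≤ I := by
    rw [hI2, ← hcard]
    have := Finset.sum_le_sum fun x (_ : x ∈ (Finset.univ : Finset ι)) => hrich x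
    rw [Finset.sum_const, nsmul_eq_mul, Finset.card_univ] at this
    linarith
  set sg : ι → β → ℝ := fun x t => ∑ y ∈ Y t, w x y with hsg
  -- star KST
  have h1 : ∀ x, ∑ t ∈ A x, max (sg x t - (j+1)) 0 ≤ (A x).card * (2 * K * q) := by
    intro x
    have h2 := kst (w x) (fun y => (hw x y).1) (fun y => (hw x y).2) Finset.univ ((b:ℝ) - 1) (by linarith)
      (j+1) (A x) (fun t => (Y t).erase x) (by
        intro P hP
        by_cases hxP : x ∈ P
        · have : (A x).filter (fun t => P ⊆ (Y t).erase x) = ∅ :=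
            Finset.filter_false_of_mem fun t _ h => absurd (h hxP) (by simp)
          rw [this]; simp; linarith
        · refine le_trans ?_ (hfree (insert x P) (by rw [Finset.card_insert_of_notMem hxP, hP]))
          norm_cast
          refine Finset.card_le_card fun t ht => ?_
          simp only [Finset.mem_filter, hA] at ht ⊢
          refine ⟨ht.1.1, fun y hy => ?_⟩
          rcases Finset.mem_insert.1 hy with rfl | hy
          · exact ht.1.2
          · have := ht.2 hy
            simp [hY] at this
            exact this.2) (fun _ _ => Finset.subset_univ _) j (by push_cast; linarith)
    have h3 : ∑ t ∈ A x, (max (sg x t - (j+1)) 0)^(j+1) ≤ (b - 1) * (2 * K)^(j+1) := by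
      calc _ ≤ ∑ t ∈ A x, (max (∑ y ∈ (Y t).erase x, w x y - j) 0)^(j+1) := by
            refine Finset.sum_le_sum fun t ht => ?_
            have hxt : x ∈ Y t := by simp [hY]; exact (Finset.mem_filter.1 ht).2
            have h4 := Finset.sum_erase_add (Y t) (w x) hxt
            have h5 := (hw x x).2
            have : sg x t - (j+1) ≤ ∑ y ∈ (Y t).erase x, w x y - j := by
              simp only [hsg]; linarith
            gcongr
        _ ≤ (b - 1) * (∑ y, w x y)^(j+1) := h2
        _ ≤ _ := by
            have : 0 ≤ ∑ y, w x y := Finset.sum_nonneg fun y _ => (hw x y).1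
            have h6 := hwK x
            have h7 : (0:ℝ) ≤ b - 1 := by linarith
            gcongr
    have h4 := pow_sum_le_card_mul_sum_pow (s := A x) (f := fun t => max (sg x t - (j+1)) 0)
      (fun t _ => le_max_right _ _) j
    have hr := hrich x
    set ρ : ℝ := ((A x).card : ℝ) with hρ
    have hρ0 : 0 < ρ := lt_of_lt_of_le hR hr
    have h5 : (∑ t ∈ A x, max (sg x t - (j+1)) 0)^(j+1) ≤ (ρ * (2 * K * q))^(j+1) := by
      refine h4.trans ?_
      rw [mul_pow, mul_pow _ q, hqk2]
      have h6 : ρ^j * ((b-1) * (2*K)^(j+1)) ≤ ρ^(j+1) * ((2*K)^(j+1) * (b / R)) := by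
        have e : ρ^(j+1) * ((2*K)^(j+1) * (b / R)) = ρ^j * ((b * (ρ / R)) * (2*K)^(j+1)) := by
          rw [pow_succ]; ring
        rw [e]
        have h7 : 1 ≤ ρ / R := (one_le_div hR).2 hr
        have : (b:ℝ) - 1 ≤ b * (ρ / R) := by nlinarith
        gcongr
      refine le_trans ?_ h6
      gcongr
    exact le_of_pow_le_pow_left₀ (by omega) (by positivity) h5
  have h2 : ∑ t ∈ T, ∑ x ∈ Y t, sg x t ≤ I * ((j+1) + 2 * K * q) := by
    rw [hdc, hI2, Finset.sum_mul]
    refine Finset.sum_le_sum fun x _ => ?_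
    have h3 : ∑ t ∈ A x, sg x t ≤ ∑ t ∈ A x, ((j+1) + max (sg x t - (j+1)) 0) := by
      refine Finset.sum_le_sum fun t _ => ?_
      have := le_max_left (sg x t - (j+1)) 0
      linarith
    rw [Finset.sum_add_distrib, Finset.sum_const, nsmul_eq_mul] at h3
    have := h1 x
    linarith
  have hs0 : ∀ t, 0 ≤ ∑ x ∈ Y t, sg x t := fun t => Finset.sum_nonneg fun x _ => Finset.sum_nonneg fun y _ => (hw x y).1
  have h3 : I^2 ≤ (∑ t ∈ T, h (Y t)) * ∑ t ∈ T, ∑ x ∈ Y t, sg x t :=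
    Finset.sum_sq_le_sum_mul_sum_of_sq_le_mul T (fun t _ => h0 _) (fun t _ => hs0 t) (fun t _ => hX (Y t))
  have h4 : ∑ t ∈ T, h (Y t) ≤ I / K + Λ * N := by
    refine (Finset.sum_le_sum hL).trans ?_
    rw [Finset.sum_add_distrib, ← Finset.sum_div, ← Finset.sum_mul]
    gcongr
  have hI0 : 0 < I := lt_of_lt_of_le (by positivity) hIR
  have h5 : I ≤ (I / K + Λ * N) * ((j+1) + 2 * K * q) := by
    have h6 : I^2 ≤ (I / K + Λ * N) * (I * ((j+1) + 2 * K * q)) := by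
      refine h3.trans (mul_le_mul h4 h2 (Finset.sum_nonneg fun t _ => hs0 t) ?_)
      exact le_trans (Finset.sum_nonneg fun t _ => h0 _) h4
    have h7 : I * I ≤ ((I / K + Λ * N) * ((j+1) + 2 * K * q)) * I := by nlinarith
    exact le_of_mul_le_mul_right h7 hI0
  -- normalise
  set ρ := I / (K * N) with hρ
  have hIρ : I = ρ * (K * N) := by rw [hρ]; field_simp
  have hρR : R ≤ ρ := by rw [hρ, le_div_iff₀ (by positivity)]; exact hIR
  have h6 : ρ * K ≤ (ρ + Λ) * ((j+1) + 2 * K * q) := by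
    rw [hIρ] at h5
    have e : ρ * (K * N) / K = ρ * N := by field_simp
    rw [e] at h5
    have : (ρ * K) * N ≤ ((ρ + Λ) * ((j+1) + 2 * K * q)) * N := by nlinarith
    exact le_of_mul_le_mul_right this hN
  have hρ0 : 0 < ρ := lt_of_lt_of_le hR hρR
  have hj : (0:ℝ) ≤ j := Nat.cast_nonneg _
  have h13 := arith1 hρ0 hq hK hq16 h6 (by linarith : Λ * (16 * q) ≤ ρ) hj
  push_cast
  linarith

lemma vI_anti {n : ℕ} {X Y : Set (Fin n → ℂ)} (h : X ⊆ Y) : vanishingIdeal n Y ≤ vanishingIdeal n X :=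
  fun _ hf x hx => hf x (h hx)

lemma HI_fin {n : ℕ} (S : Finset (Fin n → ℂ)) (m : ℕ) (X : Finset S)
    (ev : restrictTotalDegree (Fin n) ℂ m →ₗ[ℂ] (X → ℂ))
    (hev : ∀ p (x : X), ev p x = eval (x : S).1 (p : MvPolynomial (Fin n) ℂ)) :
    HI (vanishingIdeal n (Subtype.val '' (X : Set S))) m = Module.finrank ℂ (LinearMap.range ev) := by
  have key : ∀ p, qmap (vanishingIdeal n (Subtype.val '' (X : Set S))) m p = 0 ↔ ev p = 0 := by
    intro p
    rw [qmap_eq_zero]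
    constructor
    · intro h
      ext x
      rw [hev]
      exact h _ ⟨x.1, x.2, rfl⟩
    · rintro h _ ⟨x, hx, rfl⟩
      have := congrFun h ⟨x, hx⟩
      rw [hev] at this
      exact this
  rw [HI_eq_range]
  exact le_antisymm (finrank_range_le_of_ker _ _ fun x hx => (key x).2 hx)
    (finrank_range_le_of_ker _ _ fun x hx => (key x).1 hx)

lemma vecs {n : ℕ} (S : Finset (Fin n → ℂ)) (m : ℕ) :
    ∃ v : S → Fin (HI (vanishingIdeal n (S : Set (Fin n → ℂ))) m) → ℂ, ∀ X : Finset S,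
      Module.finrank ℂ (Submodule.span ℂ (v '' X)) =
        HI (vanishingIdeal n (Subtype.val '' (X : Set S))) m := by
  let ev : restrictTotalDegree (Fin n) ℂ m →ₗ[ℂ] (S → ℂ) :=
    LinearMap.pi fun x => (MvPolynomial.aeval (x : Fin n → ℂ)).toLinearMap.comp (Submodule.subtype _)
  have hev : ∀ p x, ev p x = eval (x : Fin n → ℂ) (p : MvPolynomial (Fin n) ℂ) := by
    intro p x
    simp [ev, MvPolynomial.aeval_eq_eval]
  let rs : ∀ X : Finset S, (S → ℂ) →ₗ[ℂ] (X → ℂ) := fun X => LinearMap.funLeft ℂ ℂ (fun x : X => x.1)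
  have hfin : HI (vanishingIdeal n (S : Set (Fin n → ℂ))) m = Module.finrank ℂ (LinearMap.range ev) := by
    have h1 := HI_fin S m Finset.univ ((rs Finset.univ).comp ev) (fun p x => hev p x)
    have h2 : Subtype.val '' ((Finset.univ : Finset S) : Set S) = (S : Set (Fin n → ℂ)) := by
      ext x; simp
    rw [h2] at h1
    rw [h1]
    refine le_antisymm (finrank_range_le_of_ker _ _ fun p hp => ?_) (finrank_range_le_of_ker _ _ fun p hp => ?_)
    · rw [LinearMap.comp_apply, hp, map_zero]
    · ext x
      exact congrFun hp ⟨x, Finset.mem_univ _⟩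
  let bs := Module.finBasisOfFinrankEq ℂ (LinearMap.range ev) hfin.symm
  refine ⟨fun x j => (bs j : S → ℂ) x, fun X => ?_⟩
  let A : Matrix X (Fin (HI (vanishingIdeal n (S : Set (Fin n → ℂ))) m)) ℂ := fun x j => (bs j : S → ℂ) x
  have h1 := A.rank_eq_finrank_span_row
  have h2 : Set.range A.row = (fun (x : S) j => (bs j : S → ℂ) x) '' (X : Set S) := by
    ext z
    simp only [Set.mem_range, Set.mem_image]
    constructor
    · rintro ⟨x, rfl⟩; exact ⟨x.1, x.2, rfl⟩
    · rintro ⟨x, hx, rfl⟩; exact ⟨⟨x, hx⟩, rfl⟩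
  rw [← h2, ← h1, HI_fin S m X ((rs X).comp ev) (fun p x => hev p x), Matrix.rank]
  have h3 : LinearMap.range A.mulVecLin = LinearMap.range ((rs X).comp ev) := by
    rw [LinearMap.range_comp]
    ext z
    simp only [LinearMap.mem_range, Submodule.mem_map]
    have e : ∀ c, A.mulVecLin c = rs X (∑ j, c j • bs j : LinearMap.range ev) := by
      intro c
      ext x
      rw [Matrix.mulVecLin_apply]
      simp [A, rs, Matrix.mulVec, dotProduct, LinearMap.funLeft_apply, mul_comm]
    constructor
    · rintro ⟨c, rfl⟩
      exact ⟨_, (∑ j, c j • bs j : LinearMap.range ev).2, (e c).symm⟩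
    · rintro ⟨y, hy, rfl⟩
      refine ⟨bs.repr ⟨y, hy⟩, ?_⟩
      rw [e, bs.sum_repr]
  rw [h3]

end PartG

section PartH
set_option linter.unusedSectionVars false
variable {n}

lemma HI_pos {I : Ideal (MvPolynomial (Fin n) ℂ)} (hI : I ≠ ⊤) (m : ℕ) : 0 < HI I m := by
  rw [HI_eq_range]
  by_contra h
  have h0 : Module.finrank ℂ (LinearMap.range (qmap I m)) = 0 := by omega
  rw [Submodule.finrank_eq_zero] at h0
  rw [LinearMap.range_eq_bot] at h0
  have h1 : qmap I m ⟨1, by rw [mem_restrictTotalDegree]; simp⟩ = 0 := by rw [h0]; rfl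
  rw [qmap_eq_zero] at h1
  exact hI ((Ideal.eq_top_iff_one _).2 h1)

lemma vI_ne_top {X : Set (Fin n → ℂ)} (hX : X.Nonempty) : vanishingIdeal n X ≠ ⊤ := by
  intro h
  obtain ⟨x, hx⟩ := hX
  have := (Ideal.eq_top_iff_one _).1 h x hx
  simp at this

open Classical in
lemma part1 {β : Type*} (hn : 0 < n) (S : Finset (Fin n → ℂ)) (T : Finset β)
    (inc : (Fin n → ℂ) → β → Prop) (f : β → MvPolynomial (Fin n) ℂ)
    (hf : ∀ t ∈ T, ∀ x, inc x t ↔ eval x (f t) = 0) (k b : ℕ)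
    (hk : 2 ≤ k) (hb : 1 ≤ b)
    (hfree : ∀ P : Finset (Fin n → ℂ), P ⊆ S → P.card = k →
      ((T.filter (fun t => ∀ x ∈ P, inc x t)).card : ℝ) ≤ b - 1)
    (R D q : ℝ) (hR : 0 < R) (hq : 0 < q) (hqk : q^(k-1) = b / R)
    (hD : ∑ t ∈ T, ((f t).totalDegree : ℝ) ≤ D)
    (hrich : ∀ x ∈ S, R ≤ ((T.filter (fun t => inc x t)).card : ℝ)) (hq16 : q ≤ 1/16)
    (m : ℕ) (hm1 : 1 ≤ m) (hm : 16 * (2 * (n:ℝ)^2 + 2) * q * D ≤ m * R) :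
    (S.card : ℝ) * (6 * q) ≤ k * HI (vanishingIdeal n (S : Set (Fin n → ℂ))) m := by
  rcases S.eq_empty_or_nonempty with rfl | hS
  · simp; positivity
  set h : Finset (Fin n → ℂ) → ℝ := fun X => HI (vanishingIdeal n (X : Set (Fin n → ℂ))) m with hh
  have hpos : ∀ X : Finset (Fin n → ℂ), X.Nonempty → 0 < h X := fun X hX => by
    have := HI_pos (vI_ne_top (X := (X : Set (Fin n → ℂ))) hX) m
    simp only [hh]; exact_mod_cast this
  obtain ⟨X, hXmem, hXmax⟩ := Finset.exists_max_image (S.powerset.filter (fun X => X.Nonempty))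
    (fun X => (X.card : ℝ) / h X) ⟨S, by simp [hS]⟩
  simp only [Finset.mem_filter, Finset.mem_powerset] at hXmem hXmax
  obtain ⟨hXS, hXne⟩ := hXmem
  set K := (X.card : ℝ) / h X with hKdef
  have hX0 := hpos X hXne
  have hXc : (0:ℝ) < X.card := by exact_mod_cast hXne.card_pos
  have hK : 0 < K := div_pos hXc hX0
  have hsub : ∀ Y : Finset (Fin n → ℂ), Y ⊆ S → (Y.card : ℝ) ≤ K * h Y := by
    intro Y hY
    rcases Y.eq_empty_or_nonempty with rfl | hYn
    · simp; have : 0 ≤ h ∅ := by simp only [hh]; positivity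
      positivity
    · have := hXmax Y ⟨hY, hYn⟩
      rwa [div_le_iff₀ (hpos Y hYn)] at this
  have hSle := hsub S le_rfl
  suffices hmain : K * (6 * q) ≤ k by
    have h1 : (S.card : ℝ) * (6 * q) ≤ K * h S * (6 * q) := by gcongr
    have h2 : K * (6*q) * h S ≤ k * h S := by
      have := (hpos S hS).le
      gcongr
    simp only [hh] at h1 h2
    linarith
  have : Nonempty X := hXne.to_subtype
  obtain ⟨v, hv⟩ := vecs X m
  have himg : ∀ Y : Finset X, (Subtype.val '' (Y : Set X)) = ((Y.map (Function.Embedding.subtype _) : Finset (Fin n → ℂ)) : Set (Fin n → ℂ)) := by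
    intro Y; ext z; simp
  have hmapS : ∀ Y : Finset X, Y.map (Function.Embedding.subtype _) ⊆ X := by
    intro Y z hz
    simp only [Finset.mem_map] at hz
    obtain ⟨a, _, rfl⟩ := hz
    exact a.2
  have hrank : ∀ Y : Finset X, ((Module.finrank ℂ (Submodule.span ℂ (v '' Y)) : ℕ) : ℝ) = h (Y.map (Function.Embedding.subtype _)) := by
    intro Y
    rw [hv, himg]
  have hcard : (Fintype.card X : ℝ) = K * ((HI (vanishingIdeal n (X : Set (Fin n → ℂ))) m : ℕ) : ℝ) := by
    rw [Fintype.card_coe, hKdef]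
    change (X.card : ℝ) = (X.card : ℝ) / h X * h X
    field_simp
  obtain ⟨w, hw, hwK, hwX⟩ := weights v K hK (by
    intro Y
    rw [hrank]
    have := hsub _ ((hmapS Y).trans hXS)
    rwa [Finset.card_map] at this) hcard
  have hm0 : (0:ℝ) < m := by exact_mod_cast hm1
  refine part1core T (fun (x : X) t => inc x t) k b hk hb ?_ R q K (h X)
    ((2 * (n:ℝ)^2 + 2) * D / m) hR hq hqk hK hX0 (fun x => hrich x (hXS x.2)) hcard w hw hwK
    (fun Y => (Module.finrank ℂ (Submodule.span ℂ (v '' Y)) : ℝ)) (fun _ => Nat.cast_nonneg _) hwX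
    (fun t => (2 * (n:ℝ)^2 + 2) * (f t).totalDegree / m) ?_ ?_ hq16 ?_
  · intro P hP
    have := hfree (P.map (Function.Embedding.subtype _)) ((hmapS P).trans hXS) (by rw [Finset.card_map, hP])
    simpa using this
  · intro t ht
    rw [hrank]
    set Y : Finset X := Finset.univ.filter (fun x : X => inc x t) with hY
    set Y1 : Finset (Fin n → ℂ) := Y.map (Function.Embedding.subtype _) with hY1
    have hY1m : ∀ x, x ∈ Y1 ↔ x ∈ X ∧ inc x t := by
      intro x; simp [hY1, hY, and_comm]
    set Y2 := X \ Y1 with hY2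
    set a := (f t).totalDegree with ha
    have hcY : (Y.card : ℝ) = Y1.card := by rw [hY1, Finset.card_map]
    rw [hcY]
    have hXX : h X = HI (vanishingIdeal n (X : Set (Fin n → ℂ))) m := rfl
    by_cases ham : a ≤ m
    · have hL := Ladd (I := vanishingIdeal n (X : Set (Fin n → ℂ))) (J := vanishingIdeal n (Y1 : Set (Fin n → ℂ)))
        (Q := vanishingIdeal n (Y2 : Set (Fin n → ℂ))) (vI_anti (fun x hx => ((hY1m x).1 hx).1)) (f := f t)
        (fun x hx => (hf t ht x).1 ((hY1m x).1 hx).2) (by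
          intro g hg x hx
          have hx1 : x ∈ X := (Finset.mem_sdiff.1 hx).1
          have hx2 : x ∉ Y1 := (Finset.mem_sdiff.1 hx).2
          have h1 := hg x hx1
          rw [map_mul] at h1
          rcases mul_eq_zero.1 h1 with h2 | h2
          · exact absurd ((hY1m x).2 ⟨hx1, (hf t ht x).2 h2⟩) hx2
          · exact h2) (le_refl a) ham
      have hL' : h Y1 + (HI (vanishingIdeal n (Y2 : Set (Fin n → ℂ))) (m - a) : ℝ) ≤ h X := by
        simp only [hh]; exact_mod_cast hL
      have hinc := HI_inc (vanishingIdeal n (Y2 : Set (Fin n → ℂ))) hn a m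
      have h3 := hsub Y2 (Finset.sdiff_subset.trans hXS)
      have h4 : h Y2 ≤ h X := by
        simp only [hh]
        exact_mod_cast HI_le_of_le (vI_anti (fun x hx => (Finset.mem_sdiff.1 hx).1)) m
      have h5 : (Y2.card : ℝ) = X.card - Y1.card := by
        rw [hY2, Finset.card_sdiff_of_subset (fun x hx => ((hY1m x).1 hx).1), Nat.cast_sub]
        exact Finset.card_le_card (fun x hx => ((hY1m x).1 hx).1)
      have h6 : (X.card : ℝ) = K * h X := by rw [hKdef]; field_simp
      set z : ℝ := (HI (vanishingIdeal n (Y2 : Set (Fin n → ℂ))) (m - a) : ℝ) with hz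
      have hinc2 : (m:ℝ) * (h Y2 - z) ≤ (2 * (n:ℝ)^2 + 2) * a * h X := by
        refine hinc.trans ?_
        change _ * h Y2 ≤ _
        gcongr
      have h7 : h Y2 - z ≤ (2 * (n:ℝ)^2 + 2) * a / m * h X := by
        rw [div_mul_eq_mul_div, le_div_iff₀ hm0]; linarith
      have h8 : h X - Y1.card / K ≤ h Y2 := by
        have : (h X - Y1.card / K) * K ≤ h Y2 * K := by
          rw [sub_mul, div_mul_cancel₀ _ hK.ne']; linarith
        exact le_of_mul_le_mul_right this hK
      linarith
    · push Not at ham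
      have h1 : h Y1 ≤ h X := by
        simp only [hh]
        exact_mod_cast HI_le_of_le (vI_anti (fun x hx => ((hY1m x).1 hx).1)) m
      have h2 : 1 ≤ (2 * (n:ℝ)^2 + 2) * a / m := by
        rw [le_div_iff₀ hm0]
        have : (m:ℝ) ≤ a := by exact_mod_cast ham.le
        nlinarith [sq_nonneg (n:ℝ)]
      have h3 : 0 ≤ (Y1.card : ℝ) / K := by positivity
      nlinarith
  · rw [← Finset.sum_div, ← Finset.mul_sum]
    gcongr
  · rw [div_mul_eq_mul_div, div_le_iff₀ hm0]
    linarith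

end PartH

section PartI
variable {A : Type} [CommRing A] [Algebra ℂ A]

lemma prod_toMS {M : Type} [CommMonoid M] {s : ℕ} (y : Fin s → M) (α : Fin s →₀ ℕ) :
    (Multiset.map y (Finsupp.toMultiset α)).prod = α.prod fun i k => y i ^ k := by
  rw [Finsupp.toMultiset_map, Finsupp.prod_toMultiset, Finsupp.prod_mapDomain_index] <;>
    simp [pow_add]

/-- span of `1` and the `y i` -/
def sp {s : ℕ} (y : Fin s → A) : Submodule ℂ A := Submodule.span ℂ (insert 1 (Set.range y))

lemma one_mem_sp {s : ℕ} (y : Fin s → A) : (1 : A) ∈ sp y := Submodule.subset_span (by simp)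
lemma mem_sp {s : ℕ} (y : Fin s → A) (i : Fin s) : y i ∈ sp y := Submodule.subset_span (by simp)

lemma sp_le {s : ℕ} {y : Fin s → A} {X : Submodule ℂ A} (h1 : (1:A) ∈ X) (h : ∀ i, y i ∈ X) :
    sp y ≤ X := by
  rw [sp, Submodule.span_le]
  rintro a (rfl | ⟨i, rfl⟩)
  · exact h1
  · exact h i

lemma pow_mono_one {X : Submodule ℂ A} (h1 : (1:A) ∈ X) {a b : ℕ} (h : a ≤ b) : X ^ a ≤ X ^ b := by
  obtain ⟨c, rfl⟩ := Nat.exists_eq_add_of_le h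
  rw [pow_add]
  intro x hx
  have : x = x * 1 := by simp
  rw [this]
  exact Submodule.mul_mem_mul hx (by simpa using Submodule.pow_mem_pow _ h1 c)

lemma aeval_mem {s : ℕ} {y : Fin s → A} {Y : Submodule ℂ A} (h1 : (1:A) ∈ Y) (hy : ∀ i, y i ∈ Y)
    {p : MvPolynomial (Fin s) ℂ} {m : ℕ} (hp : p.totalDegree ≤ m) : aeval y p ∈ Y ^ m := by
  have hM : ∀ M : Multiset (Fin s), (M.map y).prod ∈ Y ^ M.card := by
    intro M
    induction M using Multiset.induction with
    | empty => simpa using Submodule.one_le.1 (le_refl (1 : Submodule ℂ A))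
    | cons a M ih =>
      rw [Multiset.map_cons, Multiset.prod_cons, Multiset.card_cons, pow_succ']
      exact Submodule.mul_mem_mul (hy a) ih
  rw [p.as_sum, map_sum]
  refine Submodule.sum_mem _ fun α hα => ?_
  rw [aeval_monomial, ← Algebra.smul_def]
  refine Submodule.smul_mem _ _ ?_
  rw [← prod_toMS]
  refine pow_mono_one h1 ?_ (hM _)
  rw [Finsupp.card_toMultiset]
  exact (le_totalDegree hα).trans hp

lemma exists_of_mem_sp_pow {s : ℕ} {y : Fin s → A} {m : ℕ} {F : A} (hF : F ∈ (sp y) ^ m) :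
    ∃ p : MvPolynomial (Fin s) ℂ, p.totalDegree ≤ m ∧ aeval y p = F := by
  have key : (sp y) ^ m ≤ Submodule.map (aeval (R := ℂ) y).toLinearMap (restrictTotalDegree (Fin s) ℂ m) := by
    clear hF
    induction m with
    | zero =>
      rw [pow_zero, Submodule.one_le]
      exact ⟨1, by simp [mem_restrictTotalDegree], by simp⟩
    | succ m ih =>
      rw [pow_succ]
      refine (mul_le_mul' ih le_rfl).trans ?_
      rw [Submodule.mul_le]
      rintro _ ⟨p, hp, rfl⟩ b hb
      have : sp y ≤ Submodule.map (aeval (R := ℂ) y).toLinearMap (restrictTotalDegree (Fin s) ℂ 1) := by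
        refine sp_le ⟨1, by simp [mem_restrictTotalDegree], by simp⟩ fun i => ⟨X i, ?_, by simp⟩
        simp [mem_restrictTotalDegree]
      obtain ⟨q, hq, rfl⟩ := this hb
      refine ⟨p * q, ?_, by simp⟩
      simp only [SetLike.mem_coe, mem_restrictTotalDegree] at *
      exact (totalDegree_mul _ _).trans (add_le_add hp hq)
  obtain ⟨p, hp, rfl⟩ := key hF
  exact ⟨p, by simpa [mem_restrictTotalDegree] using hp, rfl⟩

/-- linear Noether normalisation data -/
def NN (X : Submodule ℂ A) (s : ℕ) : Prop :=
  ∃ y : Fin s → A, (∀ i, y i ∈ X) ∧ ∃ G : Submodule ℂ A, G.FG ∧ (1:A) ∈ G ∧ X * G ≤ sp y * G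

lemma NN_elim_core {s : ℕ} (y z : Fin s → A) (lam : Fin s → ℂ) (u : A)
    (hyz : ∀ i, y i = z i + lam i • u) (hu : u ∈ sp y) (M : Multiset (Fin s)) :
    M = 0 ∨ (M.map y).prod - (M.map lam).prod • u ^ M.card ∈ sp z * (sp y) ^ (M.card - 1) := by
  have hprod : ∀ M : Multiset (Fin s), (M.map y).prod ∈ sp y ^ M.card := by
    intro M
    induction M using Multiset.induction with
    | empty => simpa using Submodule.one_le.1 (le_refl (1 : Submodule ℂ A))
    | cons a M ih =>
      rw [Multiset.map_cons, Multiset.prod_cons, Multiset.card_cons, pow_succ']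
      exact Submodule.mul_mem_mul (mem_sp y a) ih
  induction M using Multiset.induction with
  | empty => left; rfl
  | cons a M ih =>
    right
    have e : ((a ::ₘ M).map y).prod - ((a ::ₘ M).map lam).prod • u ^ (a ::ₘ M).card
        = z a * (M.map y).prod + lam a • (u * ((M.map y).prod - (M.map lam).prod • u ^ M.card)) := by
      simp only [Multiset.map_cons, Multiset.prod_cons, Multiset.card_cons, hyz a]
      simp only [Algebra.smul_def, map_mul]
      ring
    rw [e, Multiset.card_cons, Nat.add_sub_cancel]
    refine Submodule.add_mem _ (Submodule.mul_mem_mul (mem_sp z a) (hprod M)) ?_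
    refine Submodule.smul_mem _ _ ?_
    rcases ih with rfl | ih
    · simp
    · have hM : 0 < M.card ∨ M = 0 := by
        rcases Nat.eq_zero_or_pos M.card with h | h
        · right; simpa using h
        · left; exact h
      rcases hM with h | rfl
      · have h3 : sp y ^ M.card = sp y * sp y ^ (M.card - 1) := by
          rw [← pow_succ', Nat.sub_add_cancel h]
        rw [h3, mul_left_comm]
        exact Submodule.mul_mem_mul hu ih
      · simp

lemma NN_elim {X : Submodule ℂ A} [Nontrivial A] {s : ℕ} (y : Fin s → A) (hyX : ∀ i, y i ∈ X)
    {G : Submodule ℂ A} (hG : G.FG) (h1G : (1:A) ∈ G) (hXG : X * G ≤ sp y * G)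
    (f : MvPolynomial (Fin s) ℂ) (hf : f ≠ 0) (hfy : aeval y f = 0) :
    ∃ s', s = s' + 1 ∧ NN X s' := by
  set a := f.totalDegree with ha
  have hfa : homogeneousComponent a f ≠ 0 := by
    intro h0
    obtain ⟨α, hα, h⟩ := Finset.exists_mem_eq_sup f.support (by simpa using hf) (fun s => s.sum fun _ e => e)
    have : coeff α (homogeneousComponent a f) = coeff α f := by
      rw [coeff_homogeneousComponent, if_pos]
      rw [ha, totalDegree, h]; rfl
    rw [h0] at this
    simp only [coeff_zero] at this
    exact (mem_support_iff.1 hα) this.symm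
  have hapos : 0 < a := by
    rcases Nat.eq_zero_or_pos a with h | h
    · exfalso
      rw [ha] at h
      rw [totalDegree_eq_zero_iff_eq_C] at h
      rw [h, aeval_C] at hfy
      have : coeff 0 f = 0 := by simpa using hfy
      rw [this] at h; simp at h; exact hf h
    · exact h
  obtain ⟨l0, hl0⟩ : ∃ l : Fin s → ℂ, eval l (homogeneousComponent a f) ≠ 0 := by
    by_contra hcon
    push Not at hcon
    exact hfa (MvPolynomial.funext (by simpa using hcon))
  obtain ⟨j, hj⟩ : ∃ j, l0 j ≠ 0 := by
    by_contra hcon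
    push Not at hcon
    have hz : l0 = 0 := _root_.funext hcon
    apply hl0
    have hh := (homogeneousComponent_isHomogeneous a f)
    rw [hz]
    have h0 : constantCoeff (homogeneousComponent a f) = 0 := by
      rw [constantCoeff_eq, coeff_homogeneousComponent, if_neg]
      simpa using hapos.ne
    rw [← h0, ← eval_zero]
  obtain ⟨s', rfl⟩ : ∃ s', s = s' + 1 := ⟨s - 1, by have := j.pos; omega⟩
  refine ⟨s', rfl, ?_⟩
  set u : A := (l0 j)⁻¹ • y j with hu
  have huY : u ∈ sp y := Submodule.smul_mem _ _ (mem_sp y j)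
  set z : Fin (s'+1) → A := fun i => y i - l0 i • u with hz
  have hyz : ∀ i, y i = z i + l0 i • u := fun i => by simp [hz]
  have hzj : z j = 0 := by simp [hz, hu, smul_smul, hj]
  set z' : Fin s' → A := fun i => z (j.succAbove i) with hz'
  have hzz : sp z = sp z' := by
    apply le_antisymm
    · refine sp_le (one_mem_sp _) fun i => ?_
      by_cases hij : i = j
      · rw [hij, hzj]; exact Submodule.zero_mem _
      · obtain ⟨i', rfl⟩ := Fin.exists_succAbove_eq hij
        exact mem_sp z' i'
    · exact sp_le (one_mem_sp _) fun i => mem_sp z _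
  have hzY : sp z ≤ sp y := sp_le (one_mem_sp _) fun i =>
    Submodule.sub_mem _ (mem_sp y i) (Submodule.smul_mem _ _ huY)
  have hmon : ∀ α : Fin (s'+1) →₀ ℕ, α.degree ≤ a →
      aeval y (monomial α (1:ℂ)) - (if α.degree = a then eval l0 (monomial α (1:ℂ)) else 0) • u ^ a ∈ sp z * sp y ^ (a-1) := by
    intro α hα
    by_cases hd : α.degree = a
    · rw [if_pos hd]
      have hcard : (Finsupp.toMultiset α).card = a := by rw [Finsupp.card_toMultiset]; exact hd
      have := NN_elim_core y z l0 u hyz huY (Finsupp.toMultiset α)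
      rcases this with h | h
      · rw [h] at hcard; simp at hcard; omega
      · rw [hcard] at h
        convert h using 2
        · rw [aeval_monomial, prod_toMS]; simp
        · rw [eval_monomial, prod_toMS]; simp
    · rw [if_neg hd, zero_smul, sub_zero]
      have h2 : aeval y (monomial α (1:ℂ)) ∈ sp y ^ (a-1) := by
        refine aeval_mem (one_mem_sp y) (mem_sp y) ?_
        rw [totalDegree_monomial _ one_ne_zero]
        change α.degree ≤ a - 1
        omega
      rw [← one_mul (aeval y _)]
      exact Submodule.mul_mem_mul (one_mem_sp z) h2
  have hua : u ^ a ∈ sp z * sp y ^ (a-1) := by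
    have h3 : aeval y f - (eval l0 (homogeneousComponent a f)) • u ^ a ∈ sp z * sp y ^ (a-1) := by
      have e1 : aeval y f = ∑ α ∈ f.support, coeff α f • aeval y (monomial α (1:ℂ)) := by
        conv_lhs => rw [f.as_sum, map_sum]
        refine Finset.sum_congr rfl fun α _ => ?_
        rw [← map_smul, smul_monomial]; simp
      have e2 : eval l0 (homogeneousComponent a f) = ∑ α ∈ f.support,
          coeff α f * (if α.degree = a then eval l0 (monomial α (1:ℂ)) else 0) := by
        rw [homogeneousComponent_apply, map_sum, Finset.sum_filter]
        refine Finset.sum_congr rfl fun α _ => ?_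
        split_ifs with h
        · rw [eval_monomial, eval_monomial]; ring
        · simp
      rw [e1, e2, Finset.sum_smul, ← Finset.sum_sub_distrib]
      refine Submodule.sum_mem _ fun α hα => ?_
      rw [mul_smul, ← smul_sub]
      exact Submodule.smul_mem _ _ (hmon α (le_totalDegree hα))
    rw [hfy, zero_sub] at h3
    have := Submodule.smul_mem _ (eval l0 (homogeneousComponent a f))⁻¹ (Submodule.neg_mem _ h3)
    rwa [neg_neg, smul_smul, inv_mul_cancel₀ hl0, one_smul] at this
  have hYa : sp y ^ a ≤ sp z * sp y ^ (a-1) := by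
    intro F hF
    obtain ⟨p, hp, rfl⟩ := exists_of_mem_sp_pow hF
    rw [p.as_sum, map_sum]
    refine Submodule.sum_mem _ fun α hα => ?_
    have hda : α.degree ≤ a := (le_totalDegree hα).trans hp
    have : monomial α (coeff α p) = coeff α p • monomial α (1:ℂ) := by rw [smul_monomial]; simp
    rw [this, map_smul]
    refine Submodule.smul_mem _ _ ?_
    have h4 := Submodule.add_mem _ (hmon α hda) (Submodule.smul_mem _ (if α.degree = a then eval l0 (monomial α (1:ℂ)) else 0) hua)
    rwa [sub_add_cancel] at h4
  refine ⟨z', ?_, sp y ^ (a-1) * G, ?_, ?_, ?_⟩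
  · intro i
    simp only [hz', hz, hu]
    exact Submodule.sub_mem _ (hyX _) (Submodule.smul_mem _ _ (Submodule.smul_mem _ _ (hyX _)))
  · refine Submodule.FG.mul (Submodule.FG.pow ?_ _) hG
    exact Submodule.fg_span ((Set.finite_range y).insert 1)
  · rw [← one_mul (1:A)]
    exact Submodule.mul_mem_mul (by simpa using Submodule.pow_mem_pow _ (one_mem_sp y) (a-1)) h1G
  · calc X * (sp y ^ (a-1) * G) = sp y ^ (a-1) * (X * G) := by ring
      _ ≤ sp y ^ (a-1) * (sp y * G) := mul_le_mul' le_rfl hXG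
      _ = sp y ^ a * G := by
          rw [← mul_assoc, ← pow_succ, Nat.sub_add_cancel hapos]
      _ ≤ (sp z * sp y ^ (a-1)) * G := mul_le_mul' hYa le_rfl
      _ = sp z' * (sp y ^ (a-1) * G) := by rw [hzz, mul_assoc]

/-- Noether normalisation -/
lemma NN_exists [Nontrivial A] {s : ℕ} (x : Fin s → A) :
    ∃ e ≤ s, ∃ y : Fin e → A, (∀ i, y i ∈ sp x) ∧ (∀ f, aeval (R := ℂ) y f = 0 → f = 0) ∧
      ∃ G : Submodule ℂ A, G.FG ∧ (1:A) ∈ G ∧ sp x * G ≤ sp y * G := by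
  classical
  have hex : ∃ s, NN (sp x) s := ⟨s, x, mem_sp x, 1, ⟨{1}, by simp [Submodule.one_eq_span]⟩, Submodule.one_le.1 le_rfl, le_rfl⟩
  obtain ⟨y, hyX, G, hG, h1, hXG⟩ := Nat.find_spec hex
  refine ⟨Nat.find hex, Nat.find_min' hex ⟨x, mem_sp x, 1, ⟨{1}, by simp [Submodule.one_eq_span]⟩, Submodule.one_le.1 le_rfl, le_rfl⟩, y, hyX, ?_, G, hG, h1, hXG⟩
  intro f hfy
  by_contra hf
  obtain ⟨s', hs', hN⟩ := NN_elim y hyX hG h1 hXG f hf hfy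
  exact Nat.find_min hex (by omega) hN

lemma pow_le_of_NN {X Y G : Submodule ℂ A} (h1 : (1:A) ∈ G) (h : X * G ≤ Y * G) (m : ℕ) :
    X ^ m ≤ Y ^ m * G := by
  have : X ^ m * G ≤ Y ^ m * G := by
    induction m with
    | zero => simp
    | succ m ih =>
      calc X ^ (m+1) * G = X ^ m * (X * G) := by ring
        _ ≤ X ^ m * (Y * G) := mul_le_mul' le_rfl h
        _ = Y * (X ^ m * G) := by ring
        _ ≤ Y * (Y ^ m * G) := mul_le_mul' le_rfl ih
        _ = Y ^ (m+1) * G := by ring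
  refine le_trans ?_ this
  intro x hx
  rw [← mul_one x]
  exact Submodule.mul_mem_mul hx h1

end PartI

section PartJ
attribute [local instance] FractionRing.liftAlgebra

lemma prim_elt (B A : Type) [CommRing B] [IsDomain B] [IsIntegrallyClosed B] [CharZero B]
    [CommRing A] [IsDomain A] [Algebra B A] [Module.Finite B A] [FaithfulSMul B A] :
    ∃ θ : A, (∀ a : A, ∃ g : B, g ≠ 0 ∧ ∃ p : Polynomial B,
        p.degree < (minpoly B θ).degree ∧ g • a = Polynomial.aeval θ p) ∧
      (∃ g : B, g ≠ 0 ∧ ∃ u v : Polynomial B,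
        u * minpoly B θ + v * Polynomial.derivative (minpoly B θ) = Polynomial.C g) ∧
      (∀ p : Polynomial B, p.degree < (minpoly B θ).degree → Polynomial.aeval θ p = 0 → p = 0) := by
  let K := FractionRing B
  let L := FractionRing A
  have : Algebra.IsIntegral B A := inferInstance
  have : Module.IsTorsionFree B A := inferInstance
  have : FiniteDimensional K L := .of_isLocalization B A (nonZeroDivisors B)
  have : CharZero K := inferInstance
  obtain ⟨θ0, hθ0⟩ := Field.exists_primitive_element K L
  obtain ⟨⟨θ, ⟨_, s, hs, rfl⟩⟩, hθs⟩ := IsLocalization.surj (Algebra.algebraMapSubmonoid A (nonZeroDivisors B)) θ0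
  simp only at hθs
  have hinjA : Function.Injective (algebraMap A L) := IsFractionRing.injective A L
  have hinjK : Function.Injective (algebraMap B K) := IsFractionRing.injective B K
  have htop : IntermediateField.adjoin K {algebraMap A L θ} = ⊤ := by
    rw [eq_top_iff, ← hθ0, IntermediateField.adjoin_simple_le_iff]
    have hs0 : algebraMap A L (algebraMap B A s) ≠ 0 := by
      rw [Ne, map_eq_zero_iff _ hinjA, map_eq_zero_iff _ (FaithfulSMul.algebraMap_injective B A)]
      exact nonZeroDivisors.ne_zero hs
    have e : θ0 = algebraMap A L θ * (algebraMap K L (algebraMap B K s))⁻¹ := by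
      rw [← IsScalarTower.algebraMap_apply B K L, IsScalarTower.algebraMap_apply B A L, ← hθs]
      rw [mul_assoc, mul_inv_cancel₀ hs0, mul_one]
    rw [e]
    exact mul_mem (IntermediateField.mem_adjoin_simple_self _ _) (inv_mem (IntermediateField.algebraMap_mem _ _))
  have hint : IsIntegral B θ := Algebra.IsIntegral.isIntegral θ
  have hmin : minpoly K (algebraMap A L θ) = (minpoly B θ).map (algebraMap B K) :=
    minpoly.isIntegrallyClosed_eq_field_fractions K L hint
  have hmonic : (minpoly K (algebraMap A L θ)).Monic := by
    rw [hmin]; exact (minpoly.monic hint).map _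
  have hdeg : (minpoly K (algebraMap A L θ)).degree = (minpoly B θ).degree := by
    rw [hmin]; exact Polynomial.degree_map_eq_of_injective hinjK _
  have hev : ∀ p : Polynomial B, algebraMap A L (Polynomial.aeval θ p) =
      Polynomial.aeval (algebraMap A L θ) (p.map (algebraMap B K)) := by
    intro p
    rw [Polynomial.aeval_map_algebraMap, Polynomial.aeval_algebraMap_apply]
  refine ⟨θ, ?_, ?_, ?_⟩
  · intro a
    have hmem : algebraMap A L a ∈ Algebra.adjoin K {algebraMap A L θ} := by
      have hh := IntermediateField.adjoin_simple_toSubalgebra_of_isAlgebraic (F := K)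
        (α := algebraMap A L θ) (Algebra.IsAlgebraic.isAlgebraic _)
      rw [← hh, htop]
      trivial
    rw [Algebra.adjoin_singleton_eq_range_aeval] at hmem
    obtain ⟨p, hp⟩ := hmem
    set p' := p %ₘ minpoly K (algebraMap A L θ) with hp'
    have hp'a : Polynomial.aeval (algebraMap A L θ) p' = algebraMap A L a := by
      rw [hp', Polynomial.aeval_modByMonic_eq_self_of_root (minpoly.aeval _ _)]
      exact hp
    have hp'd : p'.degree < (minpoly B θ).degree := by
      rw [← hdeg]; exact Polynomial.degree_modByMonic_lt _ hmonic
    obtain ⟨b, hb, hP⟩ := IsLocalization.integerNormalization_spec (nonZeroDivisors B) p'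
    have hsupp := IsLocalization.integerNormalization_support (nonZeroDivisors B) p'
    set P := IsLocalization.integerNormalization (nonZeroDivisors B) p'
    refine ⟨b, nonZeroDivisors.ne_zero hb, P, lt_of_le_of_lt (Finset.sup_mono hsupp) hp'd, ?_⟩
    apply hinjA
    rw [hev, hP]
    rw [Algebra.smul_def b a, map_mul, ← hp'a]
    rw [← IsScalarTower.algebraMap_smul K b p', map_smul, Algebra.smul_def,
      ← IsScalarTower.algebraMap_apply B K L, ← IsScalarTower.algebraMap_apply B A L]
  · have hsep : (minpoly K (algebraMap A L θ)).Separable :=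
      (minpoly.irreducible (Algebra.IsIntegral.isIntegral _)).separable
    obtain ⟨u, v, huv⟩ := hsep
    obtain ⟨b, hb, hP⟩ := IsLocalization.integerNormalization_spec (nonZeroDivisors B) u
    obtain ⟨c, hc, hQ⟩ := IsLocalization.integerNormalization_spec (nonZeroDivisors B) v
    set P := IsLocalization.integerNormalization (nonZeroDivisors B) u
    set Q := IsLocalization.integerNormalization (nonZeroDivisors B) v
    refine ⟨b * c, mul_ne_zero (nonZeroDivisors.ne_zero hb) (nonZeroDivisors.ne_zero hc),
      Polynomial.C c * P, Polynomial.C b * Q, ?_⟩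
    apply Polynomial.map_injective _ hinjK
    simp only [Polynomial.map_add, Polynomial.map_mul, Polynomial.map_C, hP, hQ, ← Polynomial.derivative_map,
      ← hmin]
    rw [← IsScalarTower.algebraMap_smul K b u, ← IsScalarTower.algebraMap_smul K c v,
      Polynomial.smul_eq_C_mul, Polynomial.smul_eq_C_mul, map_mul, Polynomial.C_mul]
    linear_combination (Polynomial.C (algebraMap B K b) * Polynomial.C (algebraMap B K c)) * huv
  · intro p hp h0
    by_contra hne
    have h1 := hev p
    rw [h0, map_zero] at h1
    have h3 := minpoly.degree_le_of_ne_zero K (algebraMap A L θ) (p := p.map (algebraMap B K))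
      (by rwa [Ne, Polynomial.map_eq_zero_iff hinjK]) h1.symm
    rw [hdeg, Polynomial.degree_map_eq_of_injective hinjK] at h3
    exact absurd hp (not_lt.2 h3)

end PartJ

section PartK
variable {A : Type} [CommRing A] [Algebra ℂ A]

/-- dimension of the space of polynomials of degree at most `K` in `e` variables -/
def bq (e K : ℕ) : ℕ := Module.finrank ℂ (restrictTotalDegree (Fin e) ℂ K)

/-- the map `p ↦ ∑ p_i(y) b_i` -/
def Psi {e δ : ℕ} (y : Fin e → A) (b : Fin δ → A) :
    (Fin δ → MvPolynomial (Fin e) ℂ) →ₗ[ℂ] A :=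
  ∑ i, (LinearMap.mulRight ℂ (b i)).comp ((aeval (R := ℂ) y).toLinearMap.comp (LinearMap.proj i))

lemma Psi_apply {e δ : ℕ} (y : Fin e → A) (b : Fin δ → A) (p : Fin δ → MvPolynomial (Fin e) ℂ) :
    Psi y b p = ∑ i, aeval y (p i) * b i := by
  simp [Psi]

lemma core_lower {e δ c K : ℕ} {X : Submodule ℂ A} (h1 : (1:A) ∈ X) (hX : X.FG)
    {y : Fin e → A} (hy : ∀ i, y i ∈ X) {b : Fin δ → A} (hb : ∀ i, b i ∈ X ^ c)
    (hinj : ∀ p, Psi y b p = 0 → p = 0) : δ * bq e K ≤ Module.finrank ℂ ↥(X ^ (K + c)) := by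
  have hfin : Module.Finite ℂ ↥(X ^ (K+c)) := Module.Finite.iff_fg.2 (hX.pow _)
  let ι : (Fin δ → restrictTotalDegree (Fin e) ℂ K) →ₗ[ℂ] (Fin δ → MvPolynomial (Fin e) ℂ) :=
    LinearMap.pi fun i => (Submodule.subtype _).comp (LinearMap.proj i)
  let f : (Fin δ → restrictTotalDegree (Fin e) ℂ K) →ₗ[ℂ] ↥(X ^ (K + c)) :=
    ((Psi y b).comp ι).codRestrict _ (by
      intro p
      rw [LinearMap.comp_apply, Psi_apply]
      refine Submodule.sum_mem _ fun i _ => ?_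
      rw [pow_add]
      refine Submodule.mul_mem_mul (aeval_mem h1 hy ?_) (hb i)
      have := (p i).2
      rwa [mem_restrictTotalDegree] at this)
  have hf : Function.Injective f := by
    rw [← LinearMap.ker_eq_bot, LinearMap.ker_eq_bot']
    intro p hp
    have h2 : Psi y b (ι p) = 0 := congrArg Subtype.val hp
    have h3 := hinj _ h2
    funext i
    exact Subtype.ext (congrFun h3 i)
  have := LinearMap.finrank_le_finrank_of_injective hf
  rw [Module.finrank_pi_fintype] at this
  simpa [bq] using this

/-- truncation -/
def trunc (e m : ℕ) : MvPolynomial (Fin e) ℂ →ₗ[ℂ] restrictTotalDegree (Fin e) ℂ m :=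
  (∑ k ∈ Finset.range (m+1), homogeneousComponent k).codRestrict _ (by
    intro p
    rw [LinearMap.sum_apply]
    refine Submodule.sum_mem _ fun k hk => ?_
    rw [mem_restrictTotalDegree]
    refine (IsHomogeneous.totalDegree_le (homogeneousComponent_isHomogeneous k p)).trans ?_
    simpa [Nat.lt_succ_iff] using hk)

lemma trunc_eq_zero {e m : ℕ} {p : MvPolynomial (Fin e) ℂ} (h : trunc e m p = 0) :
    p ∈ idealOfVars (Fin e) ℂ ^ (m+1) := by
  rw [mem_pow_idealOfVars_iff]
  intro α hα
  by_contra hlt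
  push Not at hlt
  have h1 : (∑ k ∈ Finset.range (m+1), homogeneousComponent k) p = 0 := congrArg Subtype.val h
  have h2 := congrArg (coeff α) h1
  rw [LinearMap.sum_apply, coeff_sum] at h2
  simp only [coeff_homogeneousComponent, coeff_zero] at h2
  rw [Finset.sum_ite_eq, if_pos (by simpa using hlt)] at h2
  exact (mem_support_iff.1 hα) h2

lemma core_upper [IsDomain A] {e δ c m : ℕ} {X : Submodule ℂ A} (hX : X.FG)
    {y : Fin e → A} (hgen : ∀ a, ∃ K, a ∈ X ^ K)
    (hind : ∀ p : MvPolynomial (Fin e) ℂ, aeval y p = 0 → p = 0) {b : Fin δ → A}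
    (hinj : ∀ p, Psi y b p = 0 → p = 0) (g : MvPolynomial (Fin e) ℂ) (hg : constantCoeff g ≠ 0)
    (hrep : ∀ K, ∀ F ∈ X ^ K, ∃ p, (∀ i, (p i).totalDegree ≤ K + c) ∧ aeval y g * F = Psi y b p) :
    Module.finrank ℂ ↥(X ^ m) ≤ δ * bq e m := by
  have hgy : aeval y g ≠ 0 := by
    intro h
    rw [hind g h] at hg; simp at hg
  set 𝔪 := idealOfVars (Fin e) ℂ with h𝔪
  have hcop : ∀ N j : ℕ, ∀ P : MvPolynomial (Fin e) ℂ, g ^ j * P ∈ 𝔪 ^ N → P ∈ 𝔪 ^ N := by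
    intro N j P hP
    have h1 : IsCoprime (Ideal.span {g}) 𝔪 := by
      rw [Ideal.isCoprime_iff_exists]
      refine ⟨C (constantCoeff g)⁻¹ * g, Ideal.mul_mem_left _ _ (Ideal.mem_span_singleton_self g),
        1 - C (constantCoeff g)⁻¹ * g, ?_, by ring⟩
      have := mem_pow_idealOfVars_iff 1 (1 - C (constantCoeff g)⁻¹ * g)
      rw [pow_one] at this
      rw [h𝔪, this]
      intro α hα
      by_contra hlt
      have h0 : α = 0 := by
        rw [← Finsupp.degree_eq_zero_iff]; omega
      rw [h0, mem_support_iff] at hα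
      apply hα
      rw [← constantCoeff_eq, map_sub, map_mul]
      simp [hg]
    have h2 : IsCoprime (Ideal.span {g} ^ j) (𝔪 ^ N) := IsCoprime.pow h1
    obtain ⟨a, ha, t, ht, hat⟩ := Ideal.isCoprime_iff_exists.1 h2
    rw [Ideal.span_singleton_pow, Ideal.mem_span_singleton] at ha
    obtain ⟨a', rfl⟩ := ha
    have : P = a' * (g ^ j * P) + t * P := by linear_combination (-P) * hat
    rw [this]
    exact Ideal.add_mem _ (Ideal.mul_mem_left _ _ hP) (Ideal.mul_mem_right _ _ ht)
  have hfin : Module.Finite ℂ ↥(X ^ m) := Module.Finite.iff_fg.2 (hX.pow _)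
  have hΨinj : Function.Injective (Psi y b) := by
    rw [← LinearMap.ker_eq_bot, LinearMap.ker_eq_bot']; exact hinj
  let mg : ↥(X ^ m) →ₗ[ℂ] LinearMap.range (Psi y b) :=
    ((LinearMap.mulLeft ℂ (aeval y g)).comp (Submodule.subtype _)).codRestrict _ (by
      intro F
      obtain ⟨p, -, hp⟩ := hrep m F.1 F.2
      exact ⟨p, by simpa using hp.symm⟩)
  let ψ := (LinearEquiv.ofInjective (Psi y b) hΨinj).symm
  let tr : (Fin δ → MvPolynomial (Fin e) ℂ) →ₗ[ℂ] (Fin δ → restrictTotalDegree (Fin e) ℂ m) :=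
    LinearMap.pi fun i => (trunc e m).comp (LinearMap.proj i)
  let f := tr.comp (ψ.toLinearMap.comp mg)
  have key : ∀ F ∈ X ^ m, ∀ p : Fin δ → MvPolynomial (Fin e) ℂ, aeval y g * F = Psi y b p →
      (∀ i, p i ∈ 𝔪 ^ (m+1)) → F = 0 := by
    intro F hF p hp hpm
    -- powers
    have hpow : ∀ j : ℕ, ∃ P : Fin δ → MvPolynomial (Fin e) ℂ, (∀ i, P i ∈ 𝔪 ^ (j*(m+1))) ∧
        aeval y g ^ (2*j+1) * F ^ j = Psi y b P := by
      intro j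
      induction j with
      | zero =>
        obtain ⟨P, -, hP⟩ := hrep 0 1 (by simpa using Submodule.one_le.1 (le_refl (1 : Submodule ℂ A)))
        exact ⟨P, fun i => by simp, by simpa using hP⟩
      | succ j ih =>
        obtain ⟨P, hP, hPe⟩ := ih
        have hbb : ∀ i k : Fin δ, ∃ Q, aeval y g * (b i * b k) = Psi y b Q := by
          intro i k
          obtain ⟨K, hK⟩ := hgen (b i * b k)
          obtain ⟨Q, -, hQ⟩ := hrep K _ hK
          exact ⟨Q, hQ⟩
        choose Q hQ using hbb
        refine ⟨fun l => ∑ i, ∑ k, p i * P k * Q i k l, ?_, ?_⟩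
        · intro l
          refine Ideal.sum_mem _ fun i _ => Ideal.sum_mem _ fun k _ => Ideal.mul_mem_right _ _ ?_
          have e1 : 𝔪 ^ ((j+1)*(m+1)) = 𝔪 ^ (m+1) * 𝔪 ^ (j*(m+1)) := by rw [← pow_add]; ring_nf
          rw [e1]
          exact Ideal.mul_mem_mul (hpm i) (hP k)
        · have e2 : aeval y g ^ (2*(j+1)+1) * F ^ (j+1) =
              aeval y g * ((aeval y g * F) * (aeval y g ^ (2*j+1) * F ^ j)) := by ring
          rw [e2, hp, hPe, Psi_apply, Psi_apply, Psi_apply, Finset.sum_mul_sum, Finset.mul_sum]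
          simp only [map_sum, map_mul, Finset.sum_mul]
          conv_rhs => rw [Finset.sum_comm]
          refine Finset.sum_congr rfl fun i _ => ?_
          rw [Finset.mul_sum]
          conv_rhs => rw [Finset.sum_comm]
          refine Finset.sum_congr rfl fun k _ => ?_
          have := hQ i k
          rw [Psi_apply] at this
          have e3 : aeval y g * (aeval y (p i) * b i * (aeval y (P k) * b k)) =
            aeval y (p i) * aeval y (P k) * (aeval y g * (b i * b k)) := by ring
          rw [e3, this, Finset.mul_sum]
          refine Finset.sum_congr rfl fun l _ => ?_
          ring
    obtain ⟨P, hP, hPe⟩ := hpow (c+1)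
    obtain ⟨R, hR, hRe⟩ := hrep (m*(c+1)) (F^(c+1)) (by
      rw [pow_mul]; exact Submodule.pow_mem_pow _ hF _)
    have h5 : P = fun i => g ^ (2*(c+1)) * R i := by
      apply hΨinj
      rw [← hPe, Psi_apply]
      rw [Psi_apply] at hRe
      rw [pow_succ, mul_assoc, hRe, Finset.mul_sum]
      refine Finset.sum_congr rfl fun i _ => ?_
      simp only [map_mul, map_pow]; ring
    have hR0 : R = 0 := by
      funext i
      have h6 : R i ∈ 𝔪 ^ ((c+1)*(m+1)) := hcop _ (2*(c+1)) _ (by have := hP i; rwa [h5] at this)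
      rw [h𝔪, mem_pow_idealOfVars_iff] at h6
      by_contra hne
      obtain ⟨α, hα⟩ := (support_nonempty).2 hne
      have h7 := h6 α hα
      have h8 : α.degree ≤ _ := (le_totalDegree hα).trans (hR i)
      nlinarith
    rw [hR0, map_zero] at hRe
    rcases mul_eq_zero.1 hRe with h | h
    · exact absurd h hgy
    · exact pow_eq_zero_iff (by omega) |>.1 h
  have hf : Function.Injective f := by
    rw [← LinearMap.ker_eq_bot, LinearMap.ker_eq_bot']
    intro F hF
    have h1 : Psi y b (ψ (mg F)) = aeval y g * F.1 := by
      have := LinearEquiv.apply_symm_apply (LinearEquiv.ofInjective (Psi y b) hΨinj) (mg F)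
      exact congrArg Subtype.val this
    refine Subtype.ext (key F.1 F.2 _ h1.symm fun i => ?_)
    apply trunc_eq_zero
    exact congrFun hF i
  have := LinearMap.finrank_le_finrank_of_injective hf
  rw [Module.finrank_pi_fintype] at this
  simpa [bq] using this

end PartK

section PartL
variable {A : Type} [CommRing A] [Algebra ℂ A]

lemma translate {e δ c m : ℕ} [IsDomain A] {X : Submodule ℂ A} (hX : X.FG)
    {y : Fin e → A} (hgen : ∀ a, ∃ K, a ∈ X ^ K)
    (hind : ∀ p : MvPolynomial (Fin e) ℂ, aeval y p = 0 → p = 0) {b : Fin δ → A}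
    (hinj : ∀ p, Psi y b p = 0 → p = 0) (g : MvPolynomial (Fin e) ℂ) (hg : g ≠ 0)
    (hrep : ∀ K, ∀ F ∈ X ^ K, ∃ p, (∀ i, (p i).totalDegree ≤ K + c) ∧ aeval y g * F = Psi y b p) :
    Module.finrank ℂ ↥(X ^ m) ≤ δ * bq e m := by
  obtain ⟨c0, hc0⟩ : ∃ l : Fin e → ℂ, eval l g ≠ 0 := by
    by_contra hcon
    push Not at hcon
    exact hg (MvPolynomial.funext (by simpa using hcon))
  let τ : MvPolynomial (Fin e) ℂ →ₐ[ℂ] MvPolynomial (Fin e) ℂ := aeval (fun i => MvPolynomial.X i + C (c0 i))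
  let σ : MvPolynomial (Fin e) ℂ →ₐ[ℂ] MvPolynomial (Fin e) ℂ := aeval (fun i => MvPolynomial.X i - C (c0 i))
  let y' : Fin e → A := fun i => y i - algebraMap ℂ A (c0 i)
  have hτ : ∀ p, aeval y p = aeval y' (τ p) := by
    intro p
    have : (aeval (R := ℂ) y) = (aeval y').comp τ := by
      ext i; simp [τ, y', ← algebraMap_eq]
    rw [this]; rfl
  have hσ : ∀ p, aeval y' p = aeval y (σ p) := by
    intro p
    have : (aeval (R := ℂ) y') = (aeval y).comp σ := by
      ext i; simp [σ, y', ← algebraMap_eq]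
    rw [this]; rfl
  have hτσ : ∀ p, τ (σ p) = p := by
    intro p
    have : τ.comp σ = AlgHom.id ℂ _ := by
      ext i; simp [σ, τ, ← algebraMap_eq]
    exact DFunLike.congr_fun this p
  have hdeg : ∀ p, (τ p).totalDegree ≤ p.totalDegree := by
    intro p
    have h1 := aeval_mem (A := MvPolynomial (Fin e) ℂ) (y := fun i => MvPolynomial.X i + C (c0 i))
      (Y := sp MvPolynomial.X) (one_mem_sp _) (fun i => Submodule.add_mem _ (mem_sp _ i) (by
        have : (C (c0 i) : MvPolynomial (Fin e) ℂ) = c0 i • 1 := by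
          rw [smul_eq_C_mul, mul_one]
        rw [this]
        exact Submodule.smul_mem _ _ (one_mem_sp _))) (le_refl p.totalDegree)
    obtain ⟨q, hq, hqe⟩ := exists_of_mem_sp_pow h1
    rw [aeval_X_left] at hqe
    have h5 : τ p = q := hqe.symm
    rw [h5]; exact hq
  refine core_upper (y := y') (b := b) (c := c) hX hgen ?_ ?_ (τ g) ?_ ?_
  · intro p hp
    rw [hσ] at hp
    rw [← hτσ p, hind _ hp, map_zero]
  · intro p hp
    have : Psi y b (fun i => σ (p i)) = 0 := by
      rw [Psi_apply] at hp ⊢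
      rw [← hp]
      exact Finset.sum_congr rfl fun i _ => by rw [hσ]
    have h2 := hinj _ this
    funext i
    rw [← hτσ (p i)]
    have h3 : σ (p i) = 0 := congrFun h2 i
    rw [h3, map_zero]; rfl
  · have : constantCoeff (τ g) = eval c0 g := by
      have h4 : (constantCoeff.comp τ.toRingHom : MvPolynomial (Fin e) ℂ →+* ℂ) = eval c0 := by
        ext i <;> simp [τ]
      rw [← h4]; rfl
    rw [this]; exact hc0
  · intro K F hF
    obtain ⟨p, hp, he⟩ := hrep K F hF
    refine ⟨fun i => τ (p i), fun i => (hdeg _).trans (hp i), ?_⟩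
    rw [← hτ, he, Psi_apply, Psi_apply]
    exact Finset.sum_congr rfl fun i _ => by rw [hτ]

lemma points_exist {e : ℕ} [IsDomain A] [Algebra (MvPolynomial (Fin e) ℂ) A]
    [IsScalarTower ℂ (MvPolynomial (Fin e) ℂ) A] [Module.Finite (MvPolynomial (Fin e) ℂ) A]
    [FaithfulSMul (MvPolynomial (Fin e) ℂ) A] (θ : A) (g : MvPolynomial (Fin e) ℂ) (hg : g ≠ 0)
    (u v : Polynomial (MvPolynomial (Fin e) ℂ))
    (huv : u * minpoly (MvPolynomial (Fin e) ℂ) θ +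
      v * Polynomial.derivative (minpoly (MvPolynomial (Fin e) ℂ) θ) = Polynomial.C g) :
    ∃ c : Fin e → ℂ, ∃ φ : Fin (minpoly (MvPolynomial (Fin e) ℂ) θ).natDegree → (A →ₐ[ℂ] ℂ),
      Function.Injective φ ∧ ∀ k i, φ k (algebraMap _ A (MvPolynomial.X i : MvPolynomial (Fin e) ℂ)) = c i := by
  obtain ⟨c, hc⟩ : ∃ l : Fin e → ℂ, eval l g ≠ 0 := by
    by_contra hcon
    push Not at hcon
    exact hg (MvPolynomial.funext (by simpa using hcon))
  have hint : IsIntegral (MvPolynomial (Fin e) ℂ) θ := Algebra.IsIntegral.isIntegral θ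
  set p := (minpoly (MvPolynomial (Fin e) ℂ) θ).map (eval c) with hp
  have hpm : p.Monic := (minpoly.monic hint).map _
  have hpd : p.natDegree = (minpoly (MvPolynomial (Fin e) ℂ) θ).natDegree := (minpoly.monic hint).natDegree_map _
  have hsep : p.Separable := by
    refine ⟨Polynomial.C (eval c g)⁻¹ * u.map (eval c), Polynomial.C (eval c g)⁻¹ * v.map (eval c), ?_⟩
    have := congrArg (Polynomial.map (eval c)) huv
    simp only [Polynomial.map_add, Polynomial.map_mul, Polynomial.map_C, ← Polynomial.derivative_map] at this
    rw [mul_assoc, mul_assoc, ← mul_add, this, ← Polynomial.C_mul, inv_mul_cancel₀ hc, Polynomial.C_1]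
  have hcard : p.roots.toFinset.card = (minpoly (MvPolynomial (Fin e) ℂ) θ).natDegree := by
    rw [Multiset.toFinset_card_of_nodup (Polynomial.nodup_roots hsep), ← hpd]
    exact (IsAlgClosed.splits p).natDegree_eq_card_roots.symm
  have : Algebra.FiniteType ℂ A := Algebra.FiniteType.trans (S := (MvPolynomial (Fin e) ℂ)) inferInstance inferInstance
  have hroot : ∀ α ∈ p.roots.toFinset, ∃ φ : A →ₐ[ℂ] ℂ, (∀ i, φ (algebraMap (MvPolynomial (Fin e) ℂ) A (X i)) = c i) ∧ φ θ = α := by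
    intro α hα
    rw [Multiset.mem_toFinset, Polynomial.mem_roots hpm.ne_zero, Polynomial.IsRoot.def] at hα
    let ev : Polynomial (MvPolynomial (Fin e) ℂ) →+* ℂ := Polynomial.eval₂RingHom (eval c) α
    let ρ : Polynomial (MvPolynomial (Fin e) ℂ) →+* A := (Polynomial.aeval θ).toRingHom
    letI : Algebra (Polynomial (MvPolynomial (Fin e) ℂ)) A := ρ.toAlgebra
    have hst : IsScalarTower (MvPolynomial (Fin e) ℂ) (Polynomial (MvPolynomial (Fin e) ℂ)) A := IsScalarTower.of_algebraMap_eq fun b => by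
      change _ = Polynomial.aeval θ _
      simp
    have hI : Algebra.IsIntegral (Polynomial (MvPolynomial (Fin e) ℂ)) A :=
      ⟨fun a => (Algebra.IsIntegral.isIntegral (R := (MvPolynomial (Fin e) ℂ)) a).tower_top⟩
    have hev : (RingHom.ker ev).IsPrime := RingHom.ker_isPrime ev
    have hle : (⊥ : Ideal A).comap (algebraMap (Polynomial (MvPolynomial (Fin e) ℂ)) A) ≤ RingHom.ker ev := by
      intro f hf
      have hf1 : algebraMap (Polynomial (MvPolynomial (Fin e) ℂ)) A f = 0 := by simpa [Ideal.mem_comap] using hf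
      have hf0 : Polynomial.aeval θ f = 0 := hf1
      obtain ⟨w, rfl⟩ := minpoly.isIntegrallyClosed_dvd hint hf0
      rw [RingHom.mem_ker, map_mul]
      have : ev (minpoly (MvPolynomial (Fin e) ℂ) θ) = 0 := by
        change Polynomial.eval₂ (eval c) α (minpoly (MvPolynomial (Fin e) ℂ) θ) = 0
        rw [← Polynomial.eval_map]; exact hα
      rw [this, zero_mul]
    obtain ⟨Q, -, hQ, hQc⟩ := Ideal.exists_ideal_over_prime_of_isIntegral (RingHom.ker ev) (⊥ : Ideal A) hle
    have hmem : ∀ f, ev f = 0 → Polynomial.aeval θ f ∈ Q := by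
      intro f hf
      have : f ∈ Q.comap (algebraMap (Polynomial (MvPolynomial (Fin e) ℂ)) A) := by rw [hQc]; exact hf
      exact this
    have hmax : (RingHom.ker ev).IsMaximal := RingHom.ker_isMaximal_of_surjective ev (fun z => by
      refine ⟨Polynomial.C (C z), ?_⟩
      change Polynomial.eval₂ _ _ _ = _
      simp)
    have hQmax : Q.IsMaximal := Ideal.isMaximal_of_isIntegral_of_isMaximal_comap Q (by rw [hQc]; exact hmax)
    letI : Field (A ⧸ Q) := Ideal.Quotient.field Q
    have : Algebra.FiniteType ℂ (A ⧸ Q) := inferInstance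
    have hfin : Module.Finite ℂ (A ⧸ Q) := finite_of_finite_type_of_isJacobsonRing ℂ (A ⧸ Q)
    let ψ : (A ⧸ Q) →ₐ[ℂ] ℂ := IsAlgClosed.lift
    let φ : A →ₐ[ℂ] ℂ := ψ.comp (Ideal.Quotient.mkₐ ℂ Q)
    have hφ : ∀ a ∈ Q, φ a = 0 := by
      intro a ha
      change ψ (Ideal.Quotient.mk Q a) = 0
      rw [Ideal.Quotient.eq_zero_iff_mem.2 ha, map_zero]
    refine ⟨φ, ?_, ?_⟩
    · intro i
      have h1 := hφ _ (hmem (Polynomial.C (MvPolynomial.X i - C (c i))) (by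
        change Polynomial.eval₂ _ _ _ = _
        simp))
      rw [Polynomial.aeval_C, map_sub, map_sub, sub_eq_zero] at h1
      rw [h1]
      have : algebraMap (MvPolynomial (Fin e) ℂ) A (C (c i)) = algebraMap ℂ A (c i) := by
        rw [IsScalarTower.algebraMap_apply ℂ (MvPolynomial (Fin e) ℂ) A]; rfl
      rw [this, AlgHom.commutes]; rfl
    · have h1 := hφ _ (hmem (Polynomial.X - Polynomial.C (C α)) (by
        change Polynomial.eval₂ _ _ _ = _
        simp))
      rw [map_sub, Polynomial.aeval_X, Polynomial.aeval_C, map_sub, sub_eq_zero] at h1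
      rw [h1]
      have : algebraMap (MvPolynomial (Fin e) ℂ) A (C α) = algebraMap ℂ A α := by
        rw [IsScalarTower.algebraMap_apply ℂ (MvPolynomial (Fin e) ℂ) A]; rfl
      rw [this, AlgHom.commutes]; rfl
  choose φ hφ1 hφ2 using hroot
  let eqv := (p.roots.toFinset.equivFinOfCardEq hcard).symm
  refine ⟨c, fun k => φ (eqv k) (eqv k).2, ?_, fun k i => hφ1 _ (eqv k).2 i⟩
  intro k l hkl
  have h1 : (eqv k : ℂ) = eqv l := by
    rw [← hφ2 _ (eqv k).2, ← hφ2 _ (eqv l).2]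
    exact congrArg (fun f => f θ) hkl
  exact eqv.injective (Subtype.ext h1)

end PartL

section PartM
variable {A : Type} [CommRing A] [Algebra ℂ A]

lemma struct [IsDomain A] {s : ℕ} (x : Fin s → A) (hgen : ∀ a, ∃ K, a ∈ sp x ^ K) :
    ∃ e ≤ s, ∃ δ, 1 ≤ δ ∧ (∀ m, Module.finrank ℂ ↥(sp x ^ m) ≤ δ * bq e m) ∧
      (∃ c, ∀ K, δ * bq e K ≤ Module.finrank ℂ ↥(sp x ^ (K + c))) ∧
      ∃ y : Fin e → A, (∀ i, y i ∈ sp x) ∧ (∀ f, aeval (R := ℂ) y f = 0 → f = 0) ∧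
        (aeval (R := ℂ) y).toRingHom.IsIntegral ∧
        ∃ c : Fin e → ℂ, ∃ φ : Fin δ → (A →ₐ[ℂ] ℂ), Function.Injective φ ∧ ∀ k i, φ k (y i) = c i := by
  obtain ⟨e, he, y, hyx, hind, G, hG, h1G, hGG⟩ := NN_exists x
  letI alg : Algebra (MvPolynomial (Fin e) ℂ) A := (aeval (R := ℂ) y).toRingHom.toAlgebra
  have hst : IsScalarTower ℂ (MvPolynomial (Fin e) ℂ) A := IsScalarTower.of_algebraMap_eq fun z => by
    change _ = aeval y _
    simp
  have hfs : FaithfulSMul (MvPolynomial (Fin e) ℂ) A := (faithfulSMul_iff_algebraMap_injective _ A).2 (by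
    rw [injective_iff_map_eq_zero]; exact hind)
  classical
  have hX : (sp x).FG := ⟨insert 1 (Finset.univ.image x), by simp [sp]⟩
  have hXY : ∀ a K, a ∈ sp x ^ K → a ∈ sp y ^ K * G := fun a K h => pow_le_of_NN h1G hGG K h
  obtain ⟨S, hS⟩ := hG
  have hfin : Module.Finite (MvPolynomial (Fin e) ℂ) A := by
    refine ⟨⟨S, ?_⟩⟩
    rw [eq_top_iff]
    rintro a -
    obtain ⟨K, hK⟩ := hgen a
    refine Submodule.mul_induction_on (hXY a K hK) ?_ (fun u v => Submodule.add_mem _)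
    intro u hu w hw
    obtain ⟨p, -, rfl⟩ := exists_of_mem_sp_pow hu
    change p • w ∈ _
    refine Submodule.smul_mem _ _ ?_
    rw [← hS] at hw
    exact Submodule.span_subset_span ℂ _ _ hw
  obtain ⟨θ, hθ1, ⟨g0, hg0, u, v, huv⟩, hθ3⟩ := prim_elt (MvPolynomial (Fin e) ℂ) A
  have hint : IsIntegral (MvPolynomial (Fin e) ℂ) θ := Algebra.IsIntegral.isIntegral θ
  set δ := (minpoly (MvPolynomial (Fin e) ℂ) θ).natDegree with hδ
  have hδpos : 0 < δ := minpoly.natDegree_pos hint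
  have hdeg : (minpoly (MvPolynomial (Fin e) ℂ) θ).degree = δ :=
    Polynomial.degree_eq_natDegree (minpoly.monic hint).ne_zero
  let b : Fin δ → A := fun i => θ ^ (i : ℕ)
  have hinj : ∀ p, Psi y b p = 0 → p = 0 := by
    intro p hp
    have h1 : Polynomial.aeval θ (Polynomial.ofFn δ p) = 0 := by
      rw [← hp, Psi_apply, Polynomial.ofFn_eq_sum_monomial, map_sum]
      refine Finset.sum_congr rfl fun i _ => ?_
      rw [Polynomial.aeval_monomial]; rfl
    have h2 := hθ3 _ (by rw [hdeg]; exact Polynomial.ofFn_degree_lt p) h1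
    funext i
    rw [← Polynomial.ofFn_coeff_eq_val_of_lt p i.2, h2]; rfl
  have hb : ∃ c, ∀ i, b i ∈ sp x ^ c := by
    choose K hK using fun i => hgen (b i)
    exact ⟨Finset.univ.sup K, fun i => pow_mono_one (one_mem_sp x)
      (Finset.le_sup (Finset.mem_univ i)) (hK i)⟩
  obtain ⟨c1, hc1⟩ := hb
  choose g hg0' p hpdeg hp using hθ1
  set gg := ∏ γ ∈ S, g γ with hgg
  have hggne : gg ≠ 0 := Finset.prod_ne_zero_iff.2 fun γ _ => hg0' γ
  have hPp : ∀ γ ∈ S, ∃ P, aeval y gg * γ = Psi y b P := by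
    intro γ hγ
    refine ⟨fun i => (∏ γ' ∈ S.erase γ, g γ') * (p γ).coeff i, ?_⟩
    have h1 : aeval y gg * γ = aeval y (∏ γ' ∈ S.erase γ, g γ') * (g γ • γ) := by
      have h2 : g γ • γ = aeval y (g γ) * γ := rfl
      rw [h2, hgg, ← Finset.mul_prod_erase S g hγ, map_mul]; ring
    have hlt : (p γ).natDegree < δ := by
      have h4 := hpdeg γ
      rw [hdeg] at h4
      rcases eq_or_ne (p γ) 0 with h5 | h5
      · rw [h5]; simpa using hδpos
      · exact (Polynomial.natDegree_lt_iff_degree_lt h5).2 h4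
    rw [h1, hp γ, Polynomial.aeval_eq_sum_range' hlt, Psi_apply, Finset.sum_range, Finset.mul_sum]
    refine Finset.sum_congr rfl fun i _ => ?_
    have h3 : (p γ).coeff i • θ ^ (i:ℕ) = aeval y ((p γ).coeff i) * b i := rfl
    rw [h3, map_mul, mul_assoc]
  choose! P hP using hPp
  set c := S.sup fun γ => Finset.univ.sup fun i => (P γ i).totalDegree with hc
  have hGrep : ∀ w ∈ G, ∃ q : Fin δ → MvPolynomial (Fin e) ℂ, (∀ i, (q i).totalDegree ≤ c) ∧
      aeval y gg * w = Psi y b q := by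
    intro w hw
    rw [← hS] at hw
    induction hw using Submodule.span_induction with
    | mem γ hγ =>
      refine ⟨P γ, fun i => ?_, hP γ hγ⟩
      exact (Finset.le_sup (f := fun i => (P γ i).totalDegree) (Finset.mem_univ i)).trans
        (Finset.le_sup (f := fun γ => Finset.univ.sup fun i => (P γ i).totalDegree) hγ)
    | zero => exact ⟨0, by simp, by simp⟩
    | add a a' _ _ h1 h2 =>
      obtain ⟨q1, h1, h1'⟩ := h1
      obtain ⟨q2, h2, h2'⟩ := h2
      refine ⟨q1 + q2, fun i => (totalDegree_add _ _).trans (max_le (h1 i) (h2 i)), ?_⟩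
      rw [map_add, mul_add, h1', h2']
    | smul z a _ h1 =>
      obtain ⟨q1, h1, h1'⟩ := h1
      refine ⟨z • q1, fun i => (totalDegree_smul_le _ _).trans (h1 i), ?_⟩
      rw [map_smul, ← h1', mul_smul_comm]
  have hrep : ∀ K, ∀ F ∈ sp x ^ K, ∃ q : Fin δ → MvPolynomial (Fin e) ℂ,
      (∀ i, (q i).totalDegree ≤ K + c) ∧ aeval y gg * F = Psi y b q := by
    intro K F hF
    refine Submodule.mul_induction_on (hXY F K hF) ?_ ?_
    · intro u hu w hw
      obtain ⟨q, hq, rfl⟩ := exists_of_mem_sp_pow hu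
      obtain ⟨r, hr, hr'⟩ := hGrep w hw
      refine ⟨fun i => q * r i, fun i => (totalDegree_mul _ _).trans (add_le_add hq (hr i)), ?_⟩
      rw [mul_left_comm, hr', Psi_apply, Psi_apply, Finset.mul_sum]
      exact Finset.sum_congr rfl fun i _ => by rw [map_mul, mul_assoc]
    · rintro a a' ⟨q1, h1, h1'⟩ ⟨q2, h2, h2'⟩
      refine ⟨q1 + q2, fun i => (totalDegree_add _ _).trans (max_le (h1 i) (h2 i)), ?_⟩
      rw [map_add, mul_add, h1', h2']
  obtain ⟨cc, φ, hφ, hφc⟩ := points_exist θ g0 hg0 u v huv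
  refine ⟨e, he, δ, hδpos, fun m => translate hX hgen hind hinj gg hggne hrep,
    ⟨c1, fun K => core_lower (one_mem_sp x) hX hyx hc1 hinj⟩, y, hyx, hind, ?_, cc, φ, hφ, ?_⟩
  · exact fun a => Algebra.IsIntegral.isIntegral (R := MvPolynomial (Fin e) ℂ) a
  · intro k i
    rw [← hφc k i]
    congr 1
    change _ = aeval y _
    simp

end PartM

section PartN
variable {n}

def ND (I : Ideal (MvPolynomial (Fin n) ℂ)) (e δ : ℕ) : Prop :=
  1 ≤ δ ∧ (∀ m, HI I m ≤ δ * bq e m) ∧ ∃ c, ∀ K, δ * bq e K ≤ HI I (K + c)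

lemma mk_eq_aeval (I : Ideal (MvPolynomial (Fin n) ℂ)) (f : MvPolynomial (Fin n) ℂ) :
    aeval (fun i => Ideal.Quotient.mkₐ ℂ I (X i)) f = Ideal.Quotient.mkₐ ℂ I f := by
  have : aeval (fun i => Ideal.Quotient.mkₐ ℂ I (X i)) = Ideal.Quotient.mkₐ ℂ I := by
    ext i; simp
  rw [this]

lemma HI_eq_sp (I : Ideal (MvPolynomial (Fin n) ℂ)) (m : ℕ) :
    HI I m = Module.finrank ℂ ↥(sp (fun i => Ideal.Quotient.mkₐ ℂ I (X i)) ^ m) := by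
  have : Submodule.map (Ideal.Quotient.mkₐ ℂ I).toLinearMap (restrictTotalDegree (Fin n) ℂ m) =
      sp (fun i => Ideal.Quotient.mkₐ ℂ I (X i)) ^ m := by
    ext a
    constructor
    · rintro ⟨f, hf, rfl⟩
      have hf' : f.totalDegree ≤ m := (mem_restrictTotalDegree _ _ _).1 hf
      have := aeval_mem (one_mem_sp (fun i => Ideal.Quotient.mkₐ ℂ I (X i))) (mem_sp _) hf'
      rw [mk_eq_aeval] at this
      exact this
    · intro ha
      obtain ⟨p, hp, rfl⟩ := exists_of_mem_sp_pow ha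
      exact ⟨p, (mem_restrictTotalDegree _ _ _).2 hp, (mk_eq_aeval I p).symm⟩
  rw [HI, this]

lemma struct_ideal (I : Ideal (MvPolynomial (Fin n) ℂ)) [hI : I.IsPrime] :
    ∃ e ≤ n, ∃ δ, ND I e δ ∧ ∃ y : Fin e → MvPolynomial (Fin n) ℂ, (∀ i, (y i).totalDegree ≤ 1) ∧
      (∀ f, aeval (R := ℂ) y f ∈ I → f = 0) ∧
      ((Ideal.Quotient.mkₐ ℂ I).comp (aeval (R := ℂ) y)).toRingHom.IsIntegral ∧
      ∃ c : Fin e → ℂ, ∃ φ : Fin δ → (Fin n → ℂ), Function.Injective φ ∧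
        ∀ k, (∀ f ∈ I, eval (φ k) f = 0) ∧ ∀ i, eval (φ k) (y i) = c i := by
  let x : Fin n → MvPolynomial (Fin n) ℂ ⧸ I := fun i => Ideal.Quotient.mkₐ ℂ I (X i)
  have hx : ∀ f, aeval x f = Ideal.Quotient.mkₐ ℂ I f := mk_eq_aeval I
  have hgen : ∀ a, ∃ K, a ∈ sp x ^ K := by
    intro a
    obtain ⟨f, rfl⟩ := Ideal.Quotient.mkₐ_surjective ℂ I a
    refine ⟨f.totalDegree, ?_⟩
    rw [← hx]
    exact aeval_mem (one_mem_sp x) (mem_sp x) le_rfl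
  obtain ⟨e, he, δ, hδ, h1, ⟨c0, h2⟩, y, hy, hind, hint, c, φ, hφ, hφc⟩ := struct x hgen
  have hy' : ∀ i, ∃ p : MvPolynomial (Fin n) ℂ, p.totalDegree ≤ 1 ∧ Ideal.Quotient.mkₐ ℂ I p = y i := by
    intro i
    have h3 : y i ∈ sp x ^ 1 := by rw [pow_one]; exact hy i
    obtain ⟨p, hp, hpe⟩ := exists_of_mem_sp_pow h3
    exact ⟨p, hp, by rw [← hx, hpe]⟩
  choose z hz hzy using hy'
  have hcomp : (Ideal.Quotient.mkₐ ℂ I).comp (aeval (R := ℂ) z) = aeval y := by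
    ext i; simp only [AlgHom.comp_apply, aeval_X]; exact hzy i
  refine ⟨e, he, δ, ⟨hδ, fun m => ?_, c0, fun K => ?_⟩, z, hz, ?_, ?_, c,
    fun k j => φ k (x j), ?_, ?_⟩
  · rw [HI_eq_sp]; exact h1 m
  · rw [HI_eq_sp]; exact h2 K
  · intro f hf
    apply hind
    rw [← hcomp]
    exact Ideal.Quotient.eq_zero_iff_mem.2 hf
  · rw [hcomp]; exact hint
  · intro k l hkl
    apply hφ
    have : (φ k).comp (Ideal.Quotient.mkₐ ℂ I) = (φ l).comp (Ideal.Quotient.mkₐ ℂ I) := by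
      ext j; exact congrFun hkl j
    ext a
    obtain ⟨f, rfl⟩ := Ideal.Quotient.mkₐ_surjective ℂ I a
    exact DFunLike.congr_fun this f
  · intro k
    have hev : ∀ f, eval (fun j => φ k (x j)) f = φ k (Ideal.Quotient.mkₐ ℂ I f) := by
      intro f
      have : aeval (fun j => φ k (x j)) = (φ k).comp (Ideal.Quotient.mkₐ ℂ I) := by
        ext j; simp [x]
      have h5 := DFunLike.congr_fun this f
      exact (RingHom.congr_fun (coe_aeval_eq_eval _) f).symm.trans h5
    refine ⟨fun f hf => ?_, fun i => ?_⟩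
    · rw [hev]
      have : Ideal.Quotient.mkₐ ℂ I f = 0 := Ideal.Quotient.eq_zero_iff_mem.2 hf
      rw [this, map_zero]
    · rw [hev, hzy, hφc]

end PartN

section PartO
variable {n}

lemma bq_eq (e K : ℕ) : bq e K = Nat.card {α : Fin e →₀ ℕ | (α.sum fun _ m => m) ≤ K} := by
  rw [bq]
  exact Module.finrank_eq_nat_card_basis (basisRestrictSupport ℂ _)

lemma fsum {e : ℕ} (α : Fin e →₀ ℕ) : (α.sum fun _ m => m) = ∑ i, α i :=
  Finsupp.sum_fintype _ _ (by simp)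

lemma bq_le (e K : ℕ) : bq e K ≤ (K + 1) ^ e := by
  rw [bq_eq]
  let F : {α : Fin e →₀ ℕ | (α.sum fun _ m => m) ≤ K} → (Fin e → Fin (K + 1)) :=
    fun α i => ⟨α.1 i, by
      have h := α.2
      simp only [Set.mem_ofPred_eq, fsum] at h
      have := Finset.single_le_sum (f := fun i => α.1 i) (fun _ _ => Nat.zero_le _) (Finset.mem_univ i)
      omega⟩
  have hF : Function.Injective F := by
    intro α β h
    apply Subtype.ext
    ext i
    have := congrArg Fin.val (congrFun h i)
    exact this
  have := Nat.card_le_card_of_injective F hF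
  simpa using this

lemma bq_ge' (e K : ℕ) : (K + 1) ^ e ≤ bq e (e * K) := by
  rw [bq_eq]
  let F : (Fin e → Fin (K + 1)) → {α : Fin e →₀ ℕ | (α.sum fun _ m => m) ≤ e * K} :=
    fun v => ⟨Finsupp.equivFunOnFinite.symm (fun i => (v i : ℕ)), by
      simp only [Set.mem_ofPred_eq, fsum]
      refine (Finset.sum_le_card_nsmul Finset.univ _ K fun i _ => ?_).trans (by simp)
      have := (v i).2
      simp only [Finsupp.equivFunOnFinite_symm_apply_apply]
      omega⟩
  have hF : Function.Injective F := by
    intro α β h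
    funext i
    have h1 := congrArg Subtype.val h
    have h2 := DFunLike.congr_fun h1 i
    exact Fin.ext h2
  have : Finite {α : Fin e →₀ ℕ | (α.sum fun _ m => m) ≤ e * K} := by
    have hi : Function.Injective (fun α : {α : Fin e →₀ ℕ | (α.sum fun _ m => m) ≤ e * K} =>
        (fun i => (⟨α.1 i, by
          have h := α.2
          simp only [Set.mem_ofPred_eq, fsum] at h
          have := Finset.single_le_sum (f := fun i => α.1 i) (fun _ _ => Nat.zero_le _) (Finset.mem_univ i)
          omega⟩ : Fin (e * K + 1)))) := by
      intro α β h
      apply Subtype.ext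
      ext i
      exact congrArg Fin.val (congrFun h i)
    exact Finite.of_injective _ hi
  have := Nat.card_le_card_of_injective F hF
  simpa using this

lemma bq_mono (e : ℕ) {K L : ℕ} (h : K ≤ L) : bq e K ≤ bq e L :=
  Submodule.finrank_mono fun p hp => (mem_restrictTotalDegree _ _ _).2
    (((mem_restrictTotalDegree _ _ _).1 hp).trans h)

lemma bq_ge {e : ℕ} (he : e ≤ n) (K : ℕ) : (K + 1) ^ e ≤ n ^ n * bq e K := by
  rcases Nat.eq_zero_or_pos e with rfl | h
  · have h1 := bq_ge' 0 K
    rw [zero_mul] at h1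
    have h2 := h1.trans (bq_mono 0 (Nat.zero_le K))
    have h3 : 1 ≤ n ^ n := by
      rcases Nat.eq_zero_or_pos n with rfl | h
      · simp
      · exact Nat.one_le_pow _ _ h
    exact h2.trans (Nat.le_mul_of_pos_left _ h3)
  · have h1 : K + 1 ≤ e * (K / e + 1) := by
      have := Nat.lt_mul_div_succ K h
      omega
    calc (K + 1) ^ e ≤ (e * (K / e + 1)) ^ e := Nat.pow_le_pow_left h1 e
      _ = e ^ e * (K / e + 1) ^ e := mul_pow _ _ _
      _ ≤ n ^ n * bq e K := by
        refine Nat.mul_le_mul ?_ ((bq_ge' e (K / e)).trans (bq_mono e (Nat.mul_div_le K e)))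
        exact (Nat.pow_le_pow_left he e).trans (Nat.pow_le_pow_right (h.trans_le he) he)

lemma asym {x y : ℝ} (hx : 0 < x) {c s t : ℕ}
    (h : ∀ K : ℕ, x * ((K:ℝ) + 1) ^ s ≤ y * ((K:ℝ) + 1 + c) ^ t) : s ≤ t ∧ (s = t → x ≤ y) := by
  have hlim : Filter.Tendsto (fun K : ℕ => ((c:ℝ) * (1 / ((K:ℝ) + 1)))) Filter.atTop (nhds 0) := by
    have := tendsto_one_div_add_atTop_nhds_zero_nat (𝕜 := ℝ)
    simpa using this.const_mul (c:ℝ)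
  have hlim2 : Filter.Tendsto (fun K : ℕ => y * (1 + (c:ℝ) * (1 / ((K:ℝ) + 1))) ^ t) Filter.atTop (nhds y) := by
    have := ((hlim.const_add 1).pow t).const_mul y
    simpa using this
  have key : ∀ K : ℕ, ∀ u, s = t + u → x * ((K:ℝ) + 1) ^ u ≤ y * (1 + (c:ℝ) * (1 / ((K:ℝ) + 1))) ^ t := by
    intro K u hu
    have hK : (0:ℝ) < (K:ℝ) + 1 := by positivity
    have h1 := h K
    have h2 : ((K:ℝ) + 1 + c) = ((K:ℝ) + 1) * (1 + (c:ℝ) * (1 / ((K:ℝ) + 1))) := by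
      field_simp
    rw [h2, mul_pow, hu, pow_add] at h1
    have h3 : (0:ℝ) < ((K:ℝ) + 1) ^ t := by positivity
    nlinarith
  constructor
  · by_contra hlt
    push Not at hlt
    obtain ⟨u, rfl⟩ := Nat.exists_eq_add_of_lt hlt
    have hbig : Filter.Tendsto (fun K : ℕ => x * ((K:ℝ) + 1)) Filter.atTop Filter.atTop :=
      Filter.Tendsto.const_mul_atTop hx
        (Filter.tendsto_atTop_add_const_right _ _ tendsto_natCast_atTop_atTop)
    have hev := (hlim2.eventually (gt_mem_nhds (lt_add_one y))).and (hbig.eventually_ge_atTop (y + 1))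
    obtain ⟨K, hK1, hK2⟩ := hev.exists
    have h1 := key K (u + 1) (by ring)
    have h2 : x * ((K:ℝ) + 1) ≤ x * ((K:ℝ) + 1) ^ (u + 1) := by
      apply mul_le_mul_of_nonneg_left _ hx.le
      exact le_self_pow₀ (by linarith [Nat.cast_nonneg (α := ℝ) K]) (by omega)
    linarith
  · intro hst
    exact ge_of_tendsto' hlim2 fun K => by simpa using key K 0 (by omega)

lemma asymI {I : Ideal (MvPolynomial (Fin n) ℂ)} {e δ a c s : ℕ} {x B : ℝ} {h : ℕ → ℕ} (hx : 0 < x)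
    (hB : 0 ≤ B) (hI : ND I e δ) (hlow : ∀ K : ℕ, x * ((K:ℝ) + 1) ^ s ≤ (n:ℝ) ^ n * h (K + c))
    (hm : ∀ m, a ≤ m → (m:ℝ) * h m ≤ B * HI I m) :
    s + 1 ≤ e ∧ (s + 1 = e → x ≤ (n:ℝ) ^ n * B * δ) := by
  refine asym (c := a + c + 1) hx fun K => ?_
  have h1 := hlow (K + 1 + a)
  have h2 := hm (K + 1 + a + c) (by omega)
  have h3 : (HI I (K + 1 + a + c) : ℝ) ≤ δ * ((K:ℝ) + 1 + (a + c + 1 : ℕ)) ^ e := by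
    have h4 := (hI.2.1 (K + 1 + a + c)).trans (Nat.mul_le_mul_left δ (bq_le e _))
    have h5 : (HI I (K + 1 + a + c) : ℝ) ≤ δ * (((K + 1 + a + c : ℕ) : ℝ) + 1) ^ e := by exact_mod_cast h4
    refine h5.trans (le_of_eq ?_)
    push_cast; ring_nf
  have hnn : (0:ℝ) ≤ (n:ℝ) ^ n := by positivity
  have h6 : x * ((K:ℝ) + 1) ^ s ≤ (n:ℝ) ^ n * h (K + 1 + a + c) := by
    refine le_trans ?_ h1
    gcongr
    push_cast; linarith [Nat.cast_nonneg (α := ℝ) a]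
  calc x * ((K:ℝ) + 1) ^ (s + 1) = (x * ((K:ℝ) + 1) ^ s) * ((K:ℝ) + 1) := by ring
    _ ≤ ((n:ℝ) ^ n * h (K + 1 + a + c)) * ((K + 1 + a + c : ℕ) : ℝ) := by
      gcongr
      push_cast; linarith [Nat.cast_nonneg (α := ℝ) a, Nat.cast_nonneg (α := ℝ) c]
    _ = (n:ℝ) ^ n * (((K + 1 + a + c : ℕ) : ℝ) * h (K + 1 + a + c)) := by ring
    _ ≤ (n:ℝ) ^ n * (B * (δ * ((K:ℝ) + 1 + (a + c + 1 : ℕ)) ^ e)) := by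
      exact mul_le_mul_of_nonneg_left (h2.trans (mul_le_mul_of_nonneg_left h3 hB)) hnn
    _ = _ := by ring

end PartO

section PartP
variable {n}

def SP (I : Ideal (MvPolynomial (Fin n) ℂ)) (e δ : ℕ) : Prop :=
  ND I e δ ∧ ∃ y : Fin e → MvPolynomial (Fin n) ℂ, (∀ i, (y i).totalDegree ≤ 1) ∧
      (∀ f, aeval (R := ℂ) y f ∈ I → f = 0) ∧
      ((Ideal.Quotient.mkₐ ℂ I).comp (aeval (R := ℂ) y)).toRingHom.IsIntegral ∧
      ∃ c : Fin e → ℂ, ∃ φ : Fin δ → (Fin n → ℂ), Function.Injective φ ∧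
        ∀ k, (∀ f ∈ I, eval (φ k) f = 0) ∧ ∀ i, eval (φ k) (y i) = c i

lemma exists_SP (I : Ideal (MvPolynomial (Fin n) ℂ)) :
    ∃ p : ℕ × ℕ, p.1 ≤ n ∧ (I.IsPrime → SP I p.1 p.2) := by
  by_cases hI : I.IsPrime
  · obtain ⟨e, he, δ, h⟩ := struct_ideal I
    exact ⟨(e, δ), he, fun _ => h⟩
  · exact ⟨(0, 0), Nat.zero_le _, fun h => absurd h hI⟩

def ee (I : Ideal (MvPolynomial (Fin n) ℂ)) : ℕ := (exists_SP I).choose.1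
def dd (I : Ideal (MvPolynomial (Fin n) ℂ)) : ℕ := (exists_SP I).choose.2

lemma ee_le (I : Ideal (MvPolynomial (Fin n) ℂ)) : ee I ≤ n := (exists_SP I).choose_spec.1
lemma sp_spec (I : Ideal (MvPolynomial (Fin n) ℂ)) [h : I.IsPrime] : SP I (ee I) (dd I) :=
  (exists_SP I).choose_spec.2 h
lemma nd_spec (I : Ideal (MvPolynomial (Fin n) ℂ)) [I.IsPrime] : ND I (ee I) (dd I) := (sp_spec I).1
lemma dd_pos (I : Ideal (MvPolynomial (Fin n) ℂ)) [I.IsPrime] : 1 ≤ dd I := (nd_spec I).1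

lemma nd_low (I : Ideal (MvPolynomial (Fin n) ℂ)) [I.IsPrime] :
    ∃ c : ℕ, ∀ K : ℕ, ∀ c' ≥ c, (dd I : ℝ) * ((K:ℝ) + 1) ^ (ee I) ≤ (n:ℝ) ^ n * HI I (K + c') := by
  obtain ⟨c, hc⟩ := (nd_spec I).2.2
  refine ⟨c, fun K c' hc' => ?_⟩
  have h1 := hc K
  have h2 := bq_ge (ee_le I) K
  have h3 := HI_mono I (show K + c ≤ K + c' by omega)
  have : dd I * (K + 1) ^ (ee I) ≤ n ^ n * HI I (K + c') :=
    calc dd I * (K + 1) ^ (ee I) ≤ dd I * (n ^ n * bq (ee I) K) := Nat.mul_le_mul_left _ h2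
      _ = n ^ n * (dd I * bq (ee I) K) := by ring
      _ ≤ _ := Nat.mul_le_mul_left _ (h1.trans h3)
  exact_mod_cast this

/-- multiplicative drop -/
lemma mulHI (hn : 0 < n) {I J : Ideal (MvPolynomial (Fin n) ℂ)} [hI : I.IsPrime] (hIJ : I ≤ J)
    {f : MvPolynomial (Fin n) ℂ} (hf : f ∈ J) (hfI : f ∉ I) {a : ℕ} (ha : f.totalDegree ≤ a)
    (m : ℕ) (hm : a ≤ m) :
    (m:ℝ) * HI J m ≤ ((2 * (n:ℝ) ^ 2 + 2) * a) * HI I m := by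
  have h1 := Ladd hIJ hf (Q := I) (fun g hg => (hI.mem_or_mem hg).resolve_left hfI) ha hm
  have h2 := HI_inc I hn a m
  have h3 : (HI J m : ℝ) ≤ HI I m - HI I (m - a) := by
    have : (HI J m : ℝ) + HI I (m - a) ≤ HI I m := by exact_mod_cast h1
    linarith
  exact (mul_le_mul_of_nonneg_left h3 (Nat.cast_nonneg m)).trans h2

lemma ee_lt {I Q : Ideal (MvPolynomial (Fin n) ℂ)} [hI : I.IsPrime] [hQ : Q.IsPrime] (h : I < Q) :
    ee Q < ee I := by
  obtain ⟨f, hfQ, hfI⟩ := SetLike.exists_of_lt h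
  rcases Nat.eq_zero_or_pos n with rfl | hn
  · exfalso
    rw [eq_C_of_isEmpty f] at hfQ hfI
    by_cases hz : coeff 0 f = 0
    · rw [hz, C_0] at hfI; exact hfI I.zero_mem
    · exact hQ.ne_top (Ideal.eq_top_of_isUnit_mem _ hfQ ((isUnit_iff_ne_zero.2 hz).map C))
  · obtain ⟨c, hc⟩ := nd_low Q
    exact (asymI (h := HI Q) (a := f.totalDegree) (B := (2 * (n:ℝ) ^ 2 + 2) * f.totalDegree) (x := dd Q) (by exact_mod_cast dd_pos Q) (by positivity) (nd_spec I)
      (fun K => hc K c le_rfl) (fun m hm => mulHI hn h.le hfQ hfI (a := f.totalDegree) le_rfl m hm)).1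

lemma ee_le_of_le {I Q : Ideal (MvPolynomial (Fin n) ℂ)} [hI : I.IsPrime] [hQ : Q.IsPrime] (h : I ≤ Q) :
    ee Q ≤ ee I := by
  rcases h.lt_or_eq with h | h
  · exact (ee_lt h).le
  · rw [h]

lemma sum_low (s : Finset (Ideal (MvPolynomial (Fin n) ℂ))) (hp : ∀ q ∈ s, q.IsPrime)
    (hinc : ∀ q ∈ s, ∀ q' ∈ s, q ≤ q' → q = q') :
    ∃ c, ∀ m, ∑ q ∈ s, HI q m ≤ HI (s.inf id) (m + c) := by
  classical
  induction s using Finset.induction_on with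
  | empty => exact ⟨0, by simp⟩
  | insert q s hq ih =>
    obtain ⟨c, hc⟩ := ih (fun q' h => hp q' (Finset.mem_insert_of_mem h))
      (fun q' h q'' h' => hinc q' (Finset.mem_insert_of_mem h) q'' (Finset.mem_insert_of_mem h'))
    have hqp := hp q (Finset.mem_insert_self _ _)
    have hnle : ¬ s.inf id ≤ q := by
      intro hle
      obtain ⟨q', hq', hle'⟩ := (Ideal.IsPrime.inf_le' hqp).1 hle
      have := hinc q' (Finset.mem_insert_of_mem hq') q (Finset.mem_insert_self _ _) hle'
      exact hq (this ▸ hq')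
    obtain ⟨f, hf, hfq⟩ := SetLike.not_le_iff_exists.1 hnle
    refine ⟨c + f.totalDegree, fun m => ?_⟩
    rw [Finset.sum_insert hq, Finset.inf_insert]
    have h1 := Ladd (I := id q ⊓ s.inf id) inf_le_right hf (Q := q)
      (fun g hg => (hqp.mem_or_mem hg.1).resolve_left hfq) le_rfl
      (show f.totalDegree ≤ m + (c + f.totalDegree) by omega)
    have h2 := hc m
    have h3 := HI_mono (s.inf id) (show m + c ≤ m + (c + f.totalDegree) by omega)
    have h4 := HI_mono q (show m ≤ m + (c + f.totalDegree) - f.totalDegree by omega)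
    omega

lemma bezout_low (hn : 0 < n) {I : Ideal (MvPolynomial (Fin n) ℂ)} [hI : I.IsPrime]
    (s : Finset (Ideal (MvPolynomial (Fin n) ℂ))) (hp : ∀ q ∈ s, q.IsPrime)
    (hinc : ∀ q ∈ s, ∀ q' ∈ s, q ≤ q' → q = q') (hle : ∀ q ∈ s, I ≤ q)
    (he : ∀ q ∈ s, ee q + 1 = ee I)
    {f : MvPolynomial (Fin n) ℂ} (hf : ∀ q ∈ s, f ∈ q) (hfI : f ∉ I) :
    (∑ q ∈ s, (dd q : ℝ)) ≤ (n:ℝ) ^ n * ((2 * (n:ℝ) ^ 2 + 2) * f.totalDegree) * dd I := by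
  rcases s.eq_empty_or_nonempty with rfl | hs
  · simp; positivity
  obtain ⟨c, hc⟩ := sum_low s hp hinc
  obtain ⟨q0, hq0⟩ := hs
  have hlow : ∃ c : ℕ, ∀ q ∈ s, ∀ K : ℕ, (dd q : ℝ) * ((K:ℝ) + 1) ^ (ee q) ≤ (n:ℝ) ^ n * HI q (K + c) := by
    have h1 : ∀ q ∈ s, ∃ c : ℕ, ∀ K : ℕ, ∀ c' ≥ c, (dd q : ℝ) * ((K:ℝ) + 1) ^ (ee q) ≤ (n:ℝ) ^ n * HI q (K + c') := by
      intro q hq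
      have := hp q hq
      exact nd_low q
    choose! c hc using h1
    exact ⟨s.sup c, fun q hq K => hc q hq K _ (Finset.le_sup hq)⟩
  obtain ⟨c', hc'⟩ := hlow
  have hpos : (0:ℝ) < ∑ q ∈ s, (dd q : ℝ) := by
    have := hp q0 hq0
    refine Finset.sum_pos' (fun _ _ => Nat.cast_nonneg _) ⟨q0, hq0, ?_⟩
    exact_mod_cast dd_pos q0
  have h1 := asymI (h := HI (s.inf id)) (a := f.totalDegree)
    (B := (2 * (n:ℝ) ^ 2 + 2) * f.totalDegree) (c := c' + c) (s := ee q0) hpos (by positivity) (nd_spec I) ?_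
    (fun m hm => mulHI hn (Finset.le_inf hle) (by rw [Submodule.mem_finsetInf]; exact hf) hfI
      (a := f.totalDegree) le_rfl m hm)
  · exact h1.2 (he q0 hq0)
  · intro K
    have h2 := hc (K + c')
    have h3 : ∑ q ∈ s, (HI q (K + c') : ℝ) ≤ HI (s.inf id) (K + (c' + c)) := by
      rw [← add_assoc]; exact_mod_cast h2
    calc (∑ q ∈ s, (dd q : ℝ)) * ((K:ℝ) + 1) ^ (ee q0) = ∑ q ∈ s, (dd q : ℝ) * ((K:ℝ) + 1) ^ (ee q) := by
          rw [Finset.sum_mul]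
          refine Finset.sum_congr rfl fun q hq => ?_
          have : ee q = ee q0 := by have := he q hq; have := he q0 hq0; omega
          rw [this]
      _ ≤ ∑ q ∈ s, (n:ℝ) ^ n * HI q (K + c') := Finset.sum_le_sum fun q hq => hc' q hq K
      _ = (n:ℝ) ^ n * ∑ q ∈ s, (HI q (K + c') : ℝ) := by rw [Finset.mul_sum]
      _ ≤ _ := by gcongr

end PartP

section PartQ
variable {n}

lemma krull_aux {B A : Type} [CommRing B] [IsDomain B] [UniqueFactorizationMonoid B]
    [CommRing A] [IsDomain A] (ρ : B →+* A) (hρ : Function.Injective ρ) (hint : ρ.IsIntegral)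
    (Q : Ideal A) [hQ : Q.IsPrime] (hQ0 : Q ≠ ⊥) (hht : Q.height ≤ 1) :
    ∃ h : B, Prime h ∧ Q.comap ρ = Ideal.span {h} := by
  letI : Algebra B A := ρ.toAlgebra
  have hfs : FaithfulSMul B A := (faithfulSMul_iff_algebraMap_injective B A).2 hρ
  have hI : Algebra.IsIntegral B A := ⟨hint⟩
  have h0 : Q.comap (algebraMap B A) ≠ ⊥ := fun h => hQ0 (Ideal.eq_bot_of_comap_eq_bot h)
  have hp : (Q.comap (algebraMap B A)).IsPrime := hQ.comap _
  obtain ⟨h, hmem, hh⟩ := hp.exists_mem_prime_of_ne_bot h0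
  refine ⟨h, hh, ?_⟩
  by_contra hne
  have hlt : Ideal.span {h} < Q.comap (algebraMap B A) :=
    lt_of_le_of_ne ((Ideal.span_singleton_le_iff_mem _).2 hmem) (fun h => hne h.symm)
  have hsp : (Ideal.span {h}).IsPrime := (Ideal.span_singleton_prime hh.ne_zero).2 hh
  have hlo : Q.LiesOver (Q.comap (algebraMap B A)) := ⟨rfl⟩
  obtain ⟨P, hPQ, hPp, hPl⟩ := Ideal.exists_ideal_lt_liesOver_of_lt Q hlt
  have hP0 : ⊥ < P := by
    rw [bot_lt_iff_ne_bot]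
    rintro rfl
    have h1 := hPl.over
    have h2 : h ∈ Ideal.under B (⊥ : Ideal A) := by rw [← h1]; exact Ideal.mem_span_singleton_self h
    have h3 : ρ h = 0 := h2
    exact hh.ne_zero ((injective_iff_map_eq_zero ρ).1 hρ h h3)
  have hb : (⊥ : Ideal A).IsPrime := Ideal.isPrime_bot
  have h4 := Ideal.height_add_one_le_of_lt_of_isPrime hP0
  have h5 := Ideal.height_add_one_le_of_lt_of_isPrime hPQ
  have h6 : (1 : ℕ∞) + 1 ≤ 1 := by
    calc (1 : ℕ∞) + 1 ≤ P.height + 1 := by gcongr; exact le_add_self.trans h4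
      _ ≤ _ := h5.trans hht
  exact absurd h6 (by decide)

lemma krull {I q : Ideal (MvPolynomial (Fin n) ℂ)} [hI : I.IsPrime] {f : MvPolynomial (Fin n) ℂ}
    (hf : f ∉ I) (hq : q ∈ (I ⊔ Ideal.span {f}).minimalPrimes) : ee q + 1 = ee I := by
  have hqp : q.IsPrime := hq.isPrime
  have hle : I ≤ q := le_sup_left.trans hq.1.2
  have hfq : f ∈ q := (le_sup_right.trans hq.1.2) (Ideal.mem_span_singleton_self f)
  have hlt : I < q := lt_of_le_of_ne hle (fun h => hf (h ▸ hfq))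
  have hee := ee_lt hlt
  refine le_antisymm hee ?_
  obtain ⟨-, y, hy1, hind, hint, -⟩ := sp_spec I
  have hht := Ideal.map_height_le_one_of_mem_minimalPrimes hq
  have hker : RingHom.ker (Ideal.Quotient.mk I) ≤ q := by rw [Ideal.mk_ker]; exact hle
  have hQ : (q.map (Ideal.Quotient.mk I)).IsPrime :=
    Ideal.map_isPrime_of_surjective Ideal.Quotient.mk_surjective hker
  have hcm : ∀ p, Ideal.Quotient.mk I p ∈ q.map (Ideal.Quotient.mk I) ↔ p ∈ q := by
    intro p
    rw [← Ideal.mem_comap, Ideal.comap_map_of_surjective _ Ideal.Quotient.mk_surjective]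
    rw [← RingHom.ker_eq_comap_bot, sup_eq_left.2 hker]
  have hQ0 : q.map (Ideal.Quotient.mk I) ≠ ⊥ := by
    intro h0
    have := (hcm f).2 hfq
    rw [h0, Ideal.mem_bot] at this
    exact hf (Ideal.Quotient.eq_zero_iff_mem.1 this)
  obtain ⟨h, hh, hspan⟩ := krull_aux ((Ideal.Quotient.mkₐ ℂ I).comp (aeval (R := ℂ) y)).toRingHom
    (by
      rw [injective_iff_map_eq_zero]
      intro p hp
      exact hind p (Ideal.Quotient.eq_zero_iff_mem.1 hp)) hint (q.map (Ideal.Quotient.mk I)) hQ0 hht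
  have hdvd : ∀ p, aeval y p ∈ q → h ∣ p := by
    intro p hp
    rw [← Ideal.mem_span_singleton, ← hspan, Ideal.mem_comap]
    exact (hcm _).2 hp
  obtain ⟨e', he'⟩ : ∃ e', ee I = e' + 1 := ⟨ee I - 1, by omega⟩
  obtain ⟨j, hj⟩ : ∃ j, h.degreeOf j ≠ 0 := by
    by_contra hcon
    have hv : h.vars = ∅ := by
      rw [Finset.eq_empty_iff_forall_notMem]
      intro j hj
      exact hcon ⟨j, mem_vars_iff_degreeOf_ne_zero.1 hj⟩
    rw [vars_eq_empty_iff_eq_C] at hv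
    apply hh.not_unit
    rw [hv]
    refine (isUnit_iff_ne_zero.2 fun h0 => hh.ne_zero ?_).map C
    rw [hv, h0, C_0]
  have key : ∀ (e : ℕ) (y : Fin e → MvPolynomial (Fin n) ℂ) (h : MvPolynomial (Fin e) ℂ) (j : Fin e),
      e = e' + 1 → (∀ i, (y i).totalDegree ≤ 1) → (∀ p, aeval y p ∈ q → h ∣ p) → h.degreeOf j ≠ 0 →
      ∀ K, bq e' K ≤ HI q K := by
    clear hj hdvd hspan h hh hind hint hy1 y j
    intro e y h j he hy1 hdvd hj K
    subst he
    let x : Fin n → MvPolynomial (Fin n) ℂ ⧸ q := fun i => Ideal.Quotient.mkₐ ℂ q (X i)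
    have hX : (sp x).FG := by
      classical
      exact ⟨insert 1 (Finset.univ.image x), by simp [sp]⟩
    have h1 := core_lower (δ := 1) (c := 0) (K := K) (one_mem_sp x) hX
      (y := fun i => Ideal.Quotient.mkₐ ℂ q (y (j.succAbove i))) (b := fun _ => 1) ?_ ?_ ?_
    · rw [one_mul, add_zero] at h1
      rw [HI_eq_sp]; exact h1
    · intro i
      have h2 := aeval_mem (one_mem_sp x) (mem_sp x) (hy1 (j.succAbove i))
      rw [pow_one] at h2
      rw [← mk_eq_aeval]; exact h2
    · intro i
      rw [pow_zero]; exact Submodule.one_le.1 le_rfl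
    · intro p hp
      rw [Psi_apply] at hp
      simp only [Finset.univ_unique, Fin.default_eq_zero, Finset.sum_singleton, mul_one] at hp
      have h3 : aeval y (rename j.succAbove (p 0)) ∈ q := by
        rw [aeval_rename]
        apply Ideal.Quotient.eq_zero_iff_mem.1
        rw [← hp]
        have : (Ideal.Quotient.mkₐ ℂ q).comp (aeval (y ∘ j.succAbove)) =
          aeval (fun i => Ideal.Quotient.mkₐ ℂ q (y (j.succAbove i))) := by ext i; simp
        rw [← this]; rfl
      obtain ⟨w, hw⟩ := hdvd _ h3
      by_contra hne
      have hp0 : p 0 ≠ 0 := fun h0 => hne (by funext i; rw [Fin.fin_one_eq_zero i]; exact h0)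
      have hr0 : rename j.succAbove (p 0) ≠ 0 := fun h0 =>
        hp0 (rename_injective _ Fin.succAbove_right_injective (by rw [h0, map_zero]))
      have hh0 : h ≠ 0 := by rintro rfl; rw [zero_mul] at hw; exact hr0 hw
      have hw0 : w ≠ 0 := by rintro rfl; rw [mul_zero] at hw; exact hr0 hw
      have hd : (rename j.succAbove (p 0)).degreeOf j = 0 := by
        by_contra hd
        classical
        have := mem_vars_iff_degreeOf_ne_zero.2 hd
        have := vars_rename _ _ this
        rw [Finset.mem_image] at this
        obtain ⟨i, -, hi⟩ := this
        exact Fin.succAbove_ne j i hi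
      rw [hw, degreeOf_mul_eq hh0 hw0] at hd
      omega
  have hk := key _ y h j he' hy1 hdvd hj
  have h7 : e' ≤ ee q := by
    refine (asym (c := 0) (x := 1) (y := (n:ℝ) ^ n * dd q) one_pos fun K => ?_).1
    have h8 : (K + 1) ^ e' ≤ n ^ n * (dd q * (K + 1) ^ (ee q)) :=
      (bq_ge (by have := ee_le I; omega) K).trans (Nat.mul_le_mul_left _
        ((hk K).trans (((nd_spec q).2.1 K).trans (Nat.mul_le_mul_left _ (bq_le _ _)))))
    have h9 : ((K:ℝ) + 1) ^ e' ≤ (n:ℝ) ^ n * (dd q * ((K:ℝ) + 1) ^ (ee q)) := by exact_mod_cast h8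
    simpa [mul_assoc] using h9
  omega

end PartQ

section PartR
variable {n}

abbrev Zl (I : Ideal (MvPolynomial (Fin n) ℂ)) : Set (Fin n → ℂ) := zeroLocus n (I : Set (MvPolynomial (Fin n) ℂ))

lemma null (q : Ideal (MvPolynomial (Fin n) ℂ)) [hq : q.IsPrime] : vanishingIdeal n (Zl q) = q := by
  have h := MvPolynomial.IsPrime.vanishingIdeal_zeroLocus (K := ℂ) q
  have hz : Zl q = MvPolynomial.zeroLocus ℂ q := by
    ext x
    simp only [zeroLocus, MvPolynomial.mem_zeroLocus_iff, Set.mem_ofPred_eq]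
    rfl
  rw [hz]
  ext f
  rw [← SetLike.mem_coe]
  conv_rhs => rw [← h]
  rfl

lemma mem_Zl_vI {W : Set (Fin n → ℂ)} {x : Fin n → ℂ} (hx : x ∈ W) : x ∈ Zl (vanishingIdeal n W) :=
  fun _ hf => hf x hx

lemma alg_eq {W : Set (Fin n → ℂ)} (h : IsAlgebraicSet n W) : Zl (vanishingIdeal n W) = W := by
  obtain ⟨I, rfl⟩ := h
  refine Set.Subset.antisymm (fun x hx f hf => hx f (fun y hy => hy f hf)) (fun x hx => mem_Zl_vI hx)

lemma Zl_alg (I : Ideal (MvPolynomial (Fin n) ℂ)) : IsAlgebraicSet n (Zl I) := ⟨_, rfl⟩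

lemma Zl_anti {I J : Ideal (MvPolynomial (Fin n) ℂ)} (h : I ≤ J) : Zl J ⊆ Zl I := fun _ hx f hf => hx f (h hf)

lemma irred_prime {W : Set (Fin n → ℂ)} (h : IsIrredVariety n W) : (vanishingIdeal n W).IsPrime := by
  refine ⟨vI_ne_top h.2.1, fun {f g} hfg => ?_⟩
  have h1 := h.2.2 (zeroLocus n {f}) (zeroLocus n {g}) ⟨_, rfl⟩ ⟨_, rfl⟩ (by
    intro x hx
    have := hfg x hx
    rw [map_mul, mul_eq_zero] at this
    rcases this with h | h
    · left; rintro _ rfl; exact h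
    · right; rintro _ rfl; exact h)
  rcases h1 with h1 | h1
  · exact Or.inl fun x hx => h1 hx f rfl
  · exact Or.inr fun x hx => h1 hx g rfl

lemma Zl_irred (q : Ideal (MvPolynomial (Fin n) ℂ)) [hq : q.IsPrime] : IsIrredVariety n (Zl q) := by
  refine ⟨Zl_alg q, ?_, ?_⟩
  · by_contra hne
    rw [Set.not_nonempty_iff_eq_empty] at hne
    apply hq.ne_top
    rw [← null q, hne, Ideal.eq_top_iff_one]
    intro x hx; exact absurd hx (by simp)
  · rintro V₁ V₂ ⟨I, rfl⟩ ⟨J, rfl⟩ hsub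
    by_contra hcon
    push Not at hcon
    obtain ⟨h1, h2⟩ := hcon
    obtain ⟨x, hx, hxI⟩ := Set.not_subset.1 h1
    obtain ⟨y, hy, hyJ⟩ := Set.not_subset.1 h2
    simp only [zeroLocus, Set.mem_ofPred_eq, not_forall] at hxI hyJ
    obtain ⟨f, hfI, hf⟩ := hxI
    obtain ⟨g, hgJ, hg⟩ := hyJ
    have hfg : f * g ∈ q := by
      rw [← null q]
      intro z hz
      rw [map_mul]
      rcases hsub hz with h | h
      · rw [h f hfI, zero_mul]
      · rw [h g hgJ, mul_zero]
    rcases hq.mem_or_mem hfg with h | h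
    · exact hf (hx f h)
    · exact hg (hy g h)

def mp (x : Fin n → ℂ) : Ideal (MvPolynomial (Fin n) ℂ) := RingHom.ker (eval x)
instance mp_prime (x : Fin n → ℂ) : (mp x).IsPrime := RingHom.ker_isPrime _
lemma mem_mp {x : Fin n → ℂ} {f : MvPolynomial (Fin n) ℂ} : f ∈ mp x ↔ eval x f = 0 := RingHom.mem_ker
lemma le_mp {x : Fin n → ℂ} {I : Ideal (MvPolynomial (Fin n) ℂ)} : I ≤ mp x ↔ x ∈ Zl I := Iff.rfl

lemma Zl_mp (x : Fin n → ℂ) : Zl (mp x) = {x} := by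
  ext z
  constructor
  · intro hz
    funext i
    have := hz (X i - C (x i)) (by rw [SetLike.mem_coe, mem_mp]; simp)
    simpa [sub_eq_zero] using this
  · rintro rfl
    exact le_mp.1 le_rfl

lemma ee_mp (x : Fin n → ℂ) : ee (mp x) = 0 := by
  by_contra hne
  obtain ⟨c, hc⟩ := nd_low (mp x)
  have hH : ∀ m, HI (mp x) m ≤ 1 := by
    intro m
    rw [HI_eq_range]
    have h := finrank_range_le_of_ker
      ((MvPolynomial.aeval x).toLinearMap.comp (restrictTotalDegree (Fin n) ℂ m).subtype) (qmap (mp x) m) (by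
        intro p hp
        rw [qmap_eq_zero, mem_mp]
        exact hp)
    refine h.trans ?_
    refine (Submodule.finrank_le _).trans ?_
    simp
  have h1 := (asym (c := 0) (x := dd (mp x)) (y := (n:ℝ) ^ n) (s := ee (mp x)) (t := 0)
    (by exact_mod_cast dd_pos (mp x)) fun K => by
      have h2 := hc K c le_rfl
      refine h2.trans ?_
      have h3 : (HI (mp x) (K + c) : ℝ) ≤ 1 := by exact_mod_cast hH _
      have : (0:ℝ) ≤ (n:ℝ) ^ n := by positivity
      nlinarith).1
  omega

lemma bezout (hn : 0 < n) (I : Ideal (MvPolynomial (Fin n) ℂ)) [hI : I.IsPrime]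
    {f : MvPolynomial (Fin n) ℂ} (hf : f ∉ I) :
    ∃ s : Finset (Ideal (MvPolynomial (Fin n) ℂ)),
      (∀ q ∈ s, q.IsPrime ∧ I ≤ q ∧ ee q + 1 = ee I ∧ f ∈ q) ∧
      (∀ x ∈ Zl I, eval x f = 0 → ∃ q ∈ s, x ∈ Zl q) ∧
      (∑ q ∈ s, (dd q : ℝ)) ≤ (n:ℝ) ^ n * (2 * (n:ℝ) ^ 2 + 2) * f.totalDegree * dd I := by
  have hfin := (I ⊔ Ideal.span {f}).finite_minimalPrimes_of_isNoetherianRing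
  refine ⟨hfin.toFinset, ?_, ?_, ?_⟩
  · intro q hq
    rw [Set.Finite.mem_toFinset] at hq
    exact ⟨hq.isPrime, le_sup_left.trans hq.1.2, krull hf hq,
      (le_sup_right.trans hq.1.2) (Ideal.mem_span_singleton_self f)⟩
  · intro x hx hfx
    obtain ⟨q, hq, hle⟩ := Ideal.exists_minimalPrimes_le (I := I ⊔ Ideal.span {f}) (J := mp x)
      (sup_le (le_mp.2 hx) ((Ideal.span_singleton_le_iff_mem _).2 (mem_mp.2 hfx)))
    exact ⟨q, by rwa [Set.Finite.mem_toFinset], le_mp.1 hle⟩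
  · have h := bezout_low hn hfin.toFinset (I := I) (f := f) ?_ ?_ ?_ ?_ ?_ hf
    · refine h.trans (le_of_eq (by ring))
    · intro q hq
      rw [Set.Finite.mem_toFinset] at hq
      exact hq.isPrime
    · intro q hq q' hq' hle
      rw [Set.Finite.mem_toFinset] at hq hq'
      exact le_antisymm hle (hq'.2 hq.1 hle)
    · intro q hq
      rw [Set.Finite.mem_toFinset] at hq
      exact le_sup_left.trans hq.1.2
    · intro q hq
      rw [Set.Finite.mem_toFinset] at hq
      exact krull hf hq
    · intro q hq
      rw [Set.Finite.mem_toFinset] at hq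
      exact (le_sup_right.trans hq.1.2) (Ideal.mem_span_singleton_self f)

lemma chain_exists : ∀ (e : ℕ) (I : Ideal (MvPolynomial (Fin n) ℂ)) [I.IsPrime], ee I = e →
    ∃ W : Fin (e + 1) → Set (Fin n → ℂ), (∀ i, IsIrredVariety n (W i)) ∧
      (∀ i j, i < j → W i ⊂ W j) ∧ W (Fin.last e) = Zl I := by
  intro e
  induction e with
  | zero =>
    intro I hI _
    exact ⟨fun _ => Zl I, fun _ => Zl_irred I, fun i j h => absurd h (by omega), rfl⟩
  | succ e ih =>
    intro I hI he
    obtain ⟨x, hx⟩ := (Zl_irred I).2.1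
    have hne : ¬ mp x ≤ I := by
      intro hle
      have := le_antisymm hle (le_mp.2 hx)
      rw [← this, ee_mp] at he
      omega
    obtain ⟨f, hfx, hfI⟩ := SetLike.not_le_iff_exists.1 hne
    obtain ⟨q, hq, hle⟩ := Ideal.exists_minimalPrimes_le (I := I ⊔ Ideal.span {f}) (J := mp x)
      (sup_le (le_mp.2 hx) ((Ideal.span_singleton_le_iff_mem _).2 hfx))
    have hqp : q.IsPrime := hq.isPrime
    have hk := krull hfI hq
    obtain ⟨W, h1, h2, h3⟩ := ih q (by omega)
    have hlt : Zl q ⊂ Zl I := by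
      refine Set.ssubset_iff_subset_ne.2 ⟨Zl_anti (le_sup_left.trans hq.1.2), fun heq => ?_⟩
      have : q = I := by rw [← null q, heq, null I]
      rw [this] at hk
      omega
    have hWle : ∀ i, W i ⊆ Zl q := by
      intro i
      rw [← h3]
      rcases (Fin.le_last i).lt_or_eq with h | h
      · exact (h2 _ _ h).1
      · rw [h]
    refine ⟨Fin.snoc W (Zl I), ?_, ?_, by simp⟩
    · intro i
      refine Fin.lastCases ?_ (fun j => ?_) i
      · simpa using Zl_irred I
      · simpa using h1 j
    · intro i j
      induction i using Fin.lastCases with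
      | last => intro h; exact absurd h (not_lt.2 (Fin.le_last j))
      | cast i =>
        induction j using Fin.lastCases with
        | last =>
          intro _
          simpa using lt_of_le_of_lt (hWle i) hlt
        | cast j =>
          intro h
          simpa using h2 i j (by simpa using h)

lemma dim_eq {W : Set (Fin n → ℂ)} (hW : IsIrredVariety n W) : dim n W = ee (vanishingIdeal n W) := by
  have hp := irred_prime hW
  have hub : ∀ d, HasChain n W d → d ≤ ee (vanishingIdeal n W) := by
    rintro d ⟨U, h1, h2, h3⟩
    have hstep : ∀ i : ℕ, ∀ hi : i < d + 1, i ≤ ee (vanishingIdeal n (U ⟨i, hi⟩)) := by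
      intro i
      induction i with
      | zero => intro _; exact Nat.zero_le _
      | succ i ih =>
        intro hi
        have h4 := ih (by omega)
        have hs := h2 ⟨i, by omega⟩ ⟨i + 1, hi⟩ (by simp)
        have hp1 := irred_prime (h1 ⟨i, by omega⟩)
        have hp2 := irred_prime (h1 ⟨i + 1, hi⟩)
        have : vanishingIdeal n (U ⟨i + 1, hi⟩) < vanishingIdeal n (U ⟨i, by omega⟩) := by
          refine lt_of_le_of_ne (vI_anti hs.1) fun heq => hs.ne ?_
          rw [← alg_eq (h1 ⟨i, by omega⟩).1, ← heq, alg_eq (h1 _).1]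
        have := ee_lt this
        omega
    have hpd := irred_prime (h1 (Fin.last d))
    have h5 : d ≤ ee (vanishingIdeal n (U (Fin.last d))) := hstep d (by omega)
    exact h5.trans (ee_le_of_le (vI_anti h3))
  have hmem : HasChain n W (ee (vanishingIdeal n W)) := by
    obtain ⟨U, h1, h2, h3⟩ := chain_exists _ (vanishingIdeal n W) rfl
    exact ⟨U, h1, h2, by rw [h3, alg_eq hW.1]⟩
  exact le_antisymm (csSup_le ⟨_, hmem⟩ hub) (le_csSup ⟨_, hub⟩ hmem)

end PartR

section PartS
variable {n}

def lp {m : ℕ} (u : (Fin m → ℂ) →ₗ[ℂ] ℂ) (p : Fin m → ℂ) : MvPolynomial (Fin m) ℂ :=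
  ∑ i, C (u (Pi.single i 1)) * (X i - C (p i))

lemma eval_lp {m : ℕ} (u : (Fin m → ℂ) →ₗ[ℂ] ℂ) (p x : Fin m → ℂ) : eval x (lp u p) = u (x - p) := by
  conv_rhs => rw [← Finset.univ_sum_single (x - p)]
  rw [lp, map_sum, map_sum]
  refine Finset.sum_congr rfl fun i _ => ?_
  have : (Pi.single i ((x - p) i) : Fin m → ℂ) = (x i - p i) • Pi.single i 1 := by
    rw [← Pi.single_smul]; simp
  rw [this, map_smul]
  simp [mul_comm]

lemma deg_lp {m : ℕ} (u : (Fin m → ℂ) →ₗ[ℂ] ℂ) (p : Fin m → ℂ) : (lp u p).totalDegree ≤ 1 := by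
  refine totalDegree_finsetSum_le fun i _ => ?_
  refine (totalDegree_mul _ _).trans ?_
  rw [totalDegree_C, zero_add]
  refine (totalDegree_sub _ _).trans ?_
  simp

lemma eval_aeval {e : ℕ} (x : Fin n → ℂ) (y : Fin e → MvPolynomial (Fin n) ℂ) (f : MvPolynomial (Fin e) ℂ) :
    eval x (aeval (R := ℂ) y f) = eval (fun i => eval x (y i)) f := by
  have : (eval x).comp (aeval (R := ℂ) y).toRingHom = eval (fun i => eval x (y i)) := by
    apply MvPolynomial.ringHom_ext <;> simp
  exact congrArg (fun g => g f) this

lemma lin_of_deg {m : ℕ} (y : MvPolynomial (Fin m) ℂ) (hy : y.totalDegree ≤ 1) :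
    ∃ u : (Fin m → ℂ) →ₗ[ℂ] ℂ, ∃ z : ℂ, ∀ x, eval x y = u x + z := by
  rw [y.as_sum]
  refine Finset.sum_induction _ (fun y => ∃ u : (Fin m → ℂ) →ₗ[ℂ] ℂ, ∃ z : ℂ, ∀ x, eval x y = u x + z)
    ?_ ⟨0, 0, by simp⟩ ?_
  · rintro a b ⟨u, z, h⟩ ⟨u', z', h'⟩
    exact ⟨u + u', z + z', fun x => by rw [map_add, h, h']; simp; ring⟩
  · intro s hs
    have h1 : s.degree ≤ 1 := (le_totalDegree hs).trans hy
    rcases Nat.le_one_iff_eq_zero_or_eq_one.1 h1 with h | h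
    · rw [Finsupp.degree_eq_zero_iff] at h
      subst h
      exact ⟨0, coeff 0 y, fun x => by simp⟩
    · obtain ⟨i, rfl⟩ := (Finsupp.sum_eq_one_iff s).1 (by rw [← h, Finsupp.degree_eq_sum, fsum])
      exact ⟨coeff (Finsupp.single i 1) y • LinearMap.proj i, 0, fun x => by simp [eval_monomial]⟩

abbrev Cn (n : ℕ) : ℝ := (n:ℝ) ^ n * (2 * (n:ℝ) ^ 2 + 2)

lemma one_le_nn (n : ℕ) : (1:ℝ) ≤ (n:ℝ) ^ n := by
  rcases Nat.eq_zero_or_pos n with rfl | h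
  · simp
  · exact one_le_pow₀ (by exact_mod_cast h)

lemma one_le_Cn (n : ℕ) : 1 ≤ Cn n := by
  have := one_le_nn n
  have h2 : (1:ℝ) ≤ 2 * (n:ℝ) ^ 2 + 2 := by nlinarith [sq_nonneg (n:ℝ)]
  exact one_le_mul_of_one_le_of_one_le this h2

lemma Zl_fin_le (I : Ideal (MvPolynomial (Fin n) ℂ)) [hI : I.IsPrime] (h : (Zl I).Finite) :
    ∃ x, Zl I = {x} := by
  have h1 : h.toFinset.inf (fun x => mp x) ≤ I := by
    intro f hf
    rw [← null I]
    intro x hx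
    have : h.toFinset.inf (fun x => mp x) ≤ mp x := Finset.inf_le (f := fun x => mp x) (h.mem_toFinset.2 hx)
    exact this hf
  obtain ⟨x, _, hx⟩ := (Ideal.IsPrime.inf_le' hI).1 h1
  have h2 := Zl_anti hx
  rw [Zl_mp] at h2
  exact ⟨x, ((Set.subset_singleton_iff_eq.1 h2).resolve_left (Zl_irred I).2.1.ne_empty)⟩

lemma sec (l : List (MvPolynomial (Fin n) ℂ)) (hl : ∀ g ∈ l, g.totalDegree ≤ 1) :
    ∀ (I : Ideal (MvPolynomial (Fin n) ℂ)) [I.IsPrime], {x | x ∈ Zl I ∧ ∀ g ∈ l, eval x g = 0}.Finite →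
      (({x | x ∈ Zl I ∧ ∀ g ∈ l, eval x g = 0}.ncard : ℕ) : ℝ) ≤ dd I * Cn n ^ l.length := by
  have hC := one_le_Cn n
  rcases Nat.eq_zero_or_pos n with rfl | hn
  · intro I hI _
    have h1 : {x | x ∈ Zl I ∧ ∀ g ∈ l, eval x g = 0}.ncard ≤ 1 := by
      rw [Set.ncard_le_one_iff]; intros; exact Subsingleton.elim _ _
    have h2 : (1:ℝ) ≤ dd I := by exact_mod_cast dd_pos I
    have h3 : (1:ℝ) ≤ Cn 0 ^ l.length := one_le_pow₀ hC
    calc _ ≤ (1:ℝ) := by exact_mod_cast h1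
      _ ≤ _ := one_le_mul_of_one_le_of_one_le h2 h3
  induction l with
  | nil =>
    intro I hI hfin
    have h2 : (1:ℝ) ≤ dd I := by exact_mod_cast dd_pos I
    have he : {x | x ∈ Zl I ∧ ∀ g ∈ ([] : List (MvPolynomial (Fin n) ℂ)), eval x g = 0} = Zl I := by
      ext x; simp
    rw [he] at hfin ⊢
    obtain ⟨x, hx⟩ := Zl_fin_le I hfin
    rw [hx]; simpa using h2
  | cons g l ih =>
    intro I hI hfin
    have ih := ih (fun g hg => hl g (List.mem_cons_of_mem _ hg))
    have hdeg := hl g List.mem_cons_self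
    have h2 : (1:ℝ) ≤ dd I := by exact_mod_cast dd_pos I
    by_cases hg : g ∈ I
    · have he : {x | x ∈ Zl I ∧ ∀ g' ∈ g :: l, eval x g' = 0} = {x | x ∈ Zl I ∧ ∀ g' ∈ l, eval x g' = 0} := by
        ext x
        simp only [Set.mem_ofPred_eq, List.forall_mem_cons]
        exact ⟨fun h => ⟨h.1, h.2.2⟩, fun h => ⟨h.1, h.1 g hg, h.2⟩⟩
      rw [he] at hfin ⊢
      refine (ih I hfin).trans ?_
      rw [List.length_cons]
      gcongr
      omega
    · obtain ⟨s, hs, hcov, hsum⟩ := bezout hn I hg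
      have hsub : ∀ q ∈ s, {x | x ∈ Zl q ∧ ∀ g ∈ l, eval x g = 0} ⊆ {x | x ∈ Zl I ∧ ∀ g' ∈ g :: l, eval x g' = 0} := by
        intro q hq x hx
        simp only [Set.mem_ofPred_eq, List.forall_mem_cons]
        exact ⟨Zl_anti (hs q hq).2.1 hx.1, hx.1 g (hs q hq).2.2.2, hx.2⟩
      have hle : {x | x ∈ Zl I ∧ ∀ g' ∈ g :: l, eval x g' = 0}.ncard ≤
          ∑ q ∈ s, {x | x ∈ Zl q ∧ ∀ g ∈ l, eval x g = 0}.ncard := by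
        refine le_trans (Set.ncard_le_ncard ?_ ?_) (Finset.set_ncard_biUnion_le s _)
        · intro x hx
          simp only [Set.mem_ofPred_eq, List.forall_mem_cons] at hx
          obtain ⟨q, hq, hxq⟩ := hcov x hx.1 hx.2.1
          exact Set.mem_biUnion (Finset.mem_coe.2 hq) ⟨hxq, hx.2.2⟩
        · exact Set.Finite.biUnion s.finite_toSet fun q hq => hfin.subset (hsub q hq)
      calc (({x | x ∈ Zl I ∧ ∀ g' ∈ g :: l, eval x g' = 0}.ncard : ℕ) : ℝ)
          ≤ ∑ q ∈ s, (({x | x ∈ Zl q ∧ ∀ g ∈ l, eval x g = 0}.ncard : ℕ) : ℝ) := by exact_mod_cast hle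
        _ ≤ ∑ q ∈ s, (dd q : ℝ) * Cn n ^ l.length := by
            refine Finset.sum_le_sum fun q hq => ?_
            haveI := (hs q hq).1
            exact ih q (hfin.subset (hsub q hq))
        _ = (∑ q ∈ s, (dd q : ℝ)) * Cn n ^ l.length := by rw [Finset.sum_mul]
        _ ≤ (Cn n * g.totalDegree * dd I) * Cn n ^ l.length := by gcongr
        _ ≤ (Cn n * 1 * dd I) * Cn n ^ l.length := by
            gcongr
            exact_mod_cast hdeg
        _ = _ := by rw [List.length_cons, pow_succ]; ring

lemma deg_bdd {V : Set (Fin n → ℂ)} (hV : IsIrredVariety n V) :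
    BddAbove { m | ∃ L : AffineSubspace ℂ (Fin n → ℂ),
      Module.finrank ℂ L.direction = n - dim n V ∧ (V ∩ ↑L).Finite ∧ (V ∩ ↑L).ncard = m } := by
  have hp := irred_prime hV
  have hC := one_le_Cn n
  refine ⟨⌈(dd (vanishingIdeal n V) : ℝ) * Cn n ^ n⌉₊, ?_⟩
  rintro _ ⟨L, -, hfin, rfl⟩
  rcases Set.eq_empty_or_nonempty (L : Set (Fin n → ℂ)) with h | ⟨p, hpL⟩
  · rw [h]; simp
  let Q := (Fin n → ℂ) ⧸ L.direction
  let bs := Module.finBasis ℂ Q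
  let l : List (MvPolynomial (Fin n) ℂ) :=
    List.ofFn fun j => lp ((bs.coord j).comp L.direction.mkQ) p
  have hset : V ∩ ↑L = {x | x ∈ Zl (vanishingIdeal n V) ∧ ∀ g ∈ l, eval x g = 0} := by
    ext x
    rw [alg_eq hV.1]
    refine and_congr_right fun _ => ?_
    have hx : x ∈ (L : Set _) ↔ x - p ∈ L.direction := by
      rw [SetLike.mem_coe, ← AffineSubspace.vsub_right_mem_direction_iff_mem hpL, vsub_eq_sub]
    rw [hx, ← Submodule.Quotient.mk_eq_zero, ← bs.forall_coord_eq_zero_iff]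
    simp only [l, List.forall_mem_ofFn_iff, eval_lp]
    rfl
  rw [hset] at hfin ⊢
  have h := sec l (by
    simp only [l, List.forall_mem_ofFn_iff]
    exact fun _ => deg_lp _ _) (vanishingIdeal n V) hfin
  have hlen : l.length ≤ n := by
    simp only [l, List.length_ofFn]
    refine (Submodule.finrank_quotient_le _).trans ?_
    simp
  have h2 : ((_ : ℕ) : ℝ) ≤ _ := h.trans (mul_le_mul_of_nonneg_left (pow_le_pow_right₀ hC hlen) (by positivity))
  exact_mod_cast h2.trans (Nat.le_ceil _)

lemma dd_le_degree {V : Set (Fin n → ℂ)} (hV : IsIrredVariety n V) :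
    dd (vanishingIdeal n V) ≤ degree n V := by
  have hp := irred_prime hV
  obtain ⟨-, y, hy1, hy2, hint, c, φ, hinj, hφ⟩ := sp_spec (vanishingIdeal n V)
  choose u z huz using fun i => lin_of_deg (y i) (hy1 i)
  let Λ : (Fin n → ℂ) →ₗ[ℂ] (Fin (ee (vanishingIdeal n V)) → ℂ) := LinearMap.pi u
  let p := φ ⟨0, dd_pos _⟩
  let L : AffineSubspace ℂ (Fin n → ℂ) := AffineSubspace.mk' p (LinearMap.ker Λ)
  have hsurj : LinearMap.range Λ = ⊤ := by
    by_contra hne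
    obtain ⟨w, hw0, hw⟩ := Submodule.exists_le_ker_of_lt_top _ (lt_top_iff_ne_top.2 hne)
    have h0 : lp w 0 - C (w z) = 0 := by
      apply hy2
      have : aeval (R := ℂ) y (lp w 0 - C (w z)) = 0 := by
        apply MvPolynomial.funext
        intro x
        rw [map_zero]
        have h1 : eval x (aeval (R := ℂ) y (lp w 0 - C (w z))) = eval (fun i => eval x (y i)) (lp w 0 - C (w z)) := eval_aeval _ _ _
        rw [h1, map_sub, eval_lp, eval_C, sub_zero]
        have h2 : (fun i => eval x (y i)) = Λ x + z := by
          funext i; simp [huz, Λ]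
        have h3 : w (Λ x) = 0 := hw (LinearMap.mem_range_self Λ x)
        rw [h2, map_add, h3]; ring
      rw [this]; exact Ideal.zero_mem _
    apply hw0
    ext1 i
    have h4 : ∀ v, w v = w z := by
      intro v
      have := congrArg (eval v) h0
      rwa [map_sub, eval_lp, eval_C, map_zero, sub_zero, sub_eq_zero] at this
    have h5 := h4 0
    rw [map_zero] at h5
    ext
    simp [h4, ← h5]
  have hL : ∀ x, x ∈ L ↔ ∀ i, eval x (y i) = c i := by
    intro x
    rw [AffineSubspace.mem_mk', LinearMap.mem_ker, vsub_eq_sub, map_sub, sub_eq_zero, _root_.funext_iff]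
    refine forall_congr' fun i => ?_
    rw [← (hφ ⟨0, dd_pos _⟩).2 i, huz, huz]
    simp [Λ, p]
  have hVx : ∀ x, x ∈ V ↔ ∀ f ∈ vanishingIdeal n V, eval x f = 0 := by
    intro x
    conv_lhs => rw [← alg_eq hV.1]
    rfl
  have hfin : (V ∩ ↑L).Finite := by
    have hroot : ∀ j : Fin n, ∃ P : Polynomial ℂ, P.Monic ∧ ∀ x ∈ V ∩ ↑L, P.eval (x j) = 0 := by
      intro j
      obtain ⟨P, hPm, hP⟩ := hint (Ideal.Quotient.mk _ (X j))
      refine ⟨P.map (eval c), hPm.map _, ?_⟩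
      rintro x ⟨hxV, hxL⟩
      let ev := Ideal.Quotient.lift (vanishingIdeal n V) (eval x) (fun f hf => (hVx x).1 hxV f hf)
      have h1 := congrArg ev hP
      rw [Polynomial.hom_eval₂, map_zero] at h1
      rw [Polynomial.eval_map]
      have h2 : ev.comp ((Ideal.Quotient.mkₐ ℂ (vanishingIdeal n V)).comp (aeval (R := ℂ) y)).toRingHom = eval c := by
        apply MvPolynomial.ringHom_ext
        · intro a
          simp [ev]
        · intro i
          simpa [ev] using (hL x).1 hxL i
      rw [h2] at h1
      simpa [ev] using h1
    choose P hPm hP using hroot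
    refine (Set.Finite.pi (t := fun j => {a | (P j).IsRoot a}) fun j => Polynomial.finite_setOfPred_isRoot (hPm j).ne_zero).subset ?_
    intro x hx j _
    exact hP j x hx
  have hcard : dd (vanishingIdeal n V) ≤ (V ∩ ↑L).ncard := by
    have h1 : (Set.range φ).ncard = dd (vanishingIdeal n V) := by
      rw [← Set.image_univ, Set.ncard_image_of_injective _ hinj, Set.ncard_univ, Nat.card_fin]
    rw [← h1]
    refine Set.ncard_le_ncard ?_ hfin
    rintro _ ⟨k, rfl⟩
    exact ⟨(hVx _).2 (hφ k).1, (hL _).2 (hφ k).2⟩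
  refine hcard.trans (le_csSup (deg_bdd hV) ⟨L, ?_, hfin, rfl⟩)
  rw [AffineSubspace.direction_mk', dim_eq hV]
  have h1 := LinearMap.finrank_range_add_finrank_ker Λ
  rw [hsurj, finrank_top] at h1
  simp at h1
  omega

end PartS

section PartT
variable {n}

lemma bq_step (e K : ℕ) : bq (e + 1) K + bq e (K + 1) ≤ bq (e + 1) (K + 1) := by
  rw [bq_eq, bq_eq, bq_eq]
  have hfin : ∀ e K : ℕ, Finite {α : Fin e →₀ ℕ | (α.sum fun _ m => m) ≤ K} := fun e K => by
    have : Module.Finite ℂ (restrictSupport ℂ {α : Fin e →₀ ℕ | (α.sum fun _ m => m) ≤ K}) := finP (n := e) K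
    exact Module.Finite.finite_basis (basisRestrictSupport ℂ {α : Fin e →₀ ℕ | (α.sum fun _ m => m) ≤ K})
  have := hfin e (K + 1)
  have := hfin (e + 1) K
  have := hfin (e + 1) (K + 1)
  rw [← Nat.card_sum]
  let F : {α : Fin (e + 1) →₀ ℕ | (α.sum fun _ m => m) ≤ K} ⊕ {α : Fin e →₀ ℕ | (α.sum fun _ m => m) ≤ K + 1} →
      {α : Fin (e + 1) →₀ ℕ | (α.sum fun _ m => m) ≤ K + 1} :=
    Sum.elim (fun α => ⟨α.1, by have := α.2; simp only [Set.mem_ofPred_eq] at *; omega⟩)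
      (fun α => ⟨Finsupp.cons (K + 1 - α.1.sum fun _ m => m) α.1, by
        have := α.2
        simp only [Set.mem_ofPred_eq] at *
        rw [fsum, Fin.sum_univ_succ]
        simp only [Finsupp.cons_zero, Finsupp.cons_succ, ← fsum]
        omega⟩)
  have hs : ∀ α : {α : Fin e →₀ ℕ | (α.sum fun _ m => m) ≤ K + 1}, ((F (Sum.inr α)).1.sum fun _ m => m) = K + 1 := by
    intro α
    have := α.2
    simp only [Set.mem_ofPred_eq] at this
    simp only [F, Sum.elim_inr]
    rw [fsum, Fin.sum_univ_succ]
    simp only [Finsupp.cons_zero, Finsupp.cons_succ, ← fsum]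
    omega
  refine Nat.card_le_card_of_injective F ?_
  have hl : ∀ α : {α : Fin (e + 1) →₀ ℕ | (α.sum fun _ m => m) ≤ K}, ((F (Sum.inl α)).1.sum fun _ m => m) ≤ K := fun α => α.2
  rintro (α | α) (β | β) h
  · simp only [F, Sum.elim_inl, Subtype.mk.injEq] at h
    rw [Subtype.ext h]
  · have h1 := hl α; rw [h, hs] at h1; omega
  · have h1 := hl β; rw [← h, hs] at h1; omega
  · simp only [F, Sum.elim_inr, Subtype.mk.injEq] at h
    have : α = β := Subtype.ext (by
      have := congrArg Finsupp.tail h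
      simpa using this)
    rw [this]

lemma bq_iter (e K a : ℕ) : bq (e + 1) K + a * bq e K ≤ bq (e + 1) (K + a) := by
  induction a with
  | zero => simp
  | succ a ih =>
    have h1 := bq_step e (K + a)
    have h2 : bq e K ≤ bq e (K + a + 1) := bq_mono e (by omega)
    rw [← add_assoc, add_mul]
    omega

lemma HI_bot (m : ℕ) : HI (⊥ : Ideal (MvPolynomial (Fin n) ℂ)) m = bq n m := by
  rw [HI_eq_range, bq]
  refine LinearMap.finrank_range_of_inj ?_
  rw [← LinearMap.ker_eq_bot, LinearMap.ker_eq_bot']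
  intro p hp
  rw [qmap_eq_zero, Ideal.mem_bot] at hp
  exact Subtype.ext hp

lemma ee_bot : ee (⊥ : Ideal (MvPolynomial (Fin n) ℂ)) = n := by
  have : (⊥ : Ideal (MvPolynomial (Fin n) ℂ)).IsPrime := Ideal.isPrime_bot
  refine le_antisymm (ee_le _) ?_
  refine (asym (c := 0) (x := 1) (y := (n:ℝ) ^ n * dd (⊥ : Ideal (MvPolynomial (Fin n) ℂ))) one_pos fun K => ?_).1
  have h1 := (nd_spec (⊥ : Ideal (MvPolynomial (Fin n) ℂ))).2.1 K
  rw [HI_bot] at h1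
  have h2 := bq_ge (le_refl n) K
  have h3 : (K + 1) ^ n ≤ n ^ n * (dd (⊥ : Ideal (MvPolynomial (Fin n) ℂ)) * (K + 1) ^ ee (⊥ : Ideal (MvPolynomial (Fin n) ℂ))) :=
    h2.trans (Nat.mul_le_mul_left _ (h1.trans (Nat.mul_le_mul_left _ (bq_le _ _))))
  have h4 : ((K:ℝ) + 1) ^ n ≤ (n:ℝ) ^ n * (dd (⊥ : Ideal (MvPolynomial (Fin n) ℂ)) * ((K:ℝ) + 1) ^ ee (⊥ : Ideal (MvPolynomial (Fin n) ℂ))) := by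
    exact_mod_cast h3
  simp only [Nat.cast_zero, add_zero, one_mul]
  linarith

lemma HI_princ (g : MvPolynomial (Fin n) ℂ) (hg : g ≠ 0) (K : ℕ) :
    bq n (K + g.totalDegree) ≤ HI (Ideal.span {g}) (K + g.totalDegree) + bq n K := by
  have := finP (n := n) (K + g.totalDegree)
  have := finP (n := n) K
  have h1 := LinearMap.finrank_range_add_finrank_ker (qmap (Ideal.span {g}) (K + g.totalDegree))
  rw [← HI_eq_range] at h1
  rw [bq, ← h1]
  refine Nat.add_le_add_left ?_ _
  let A := Submodule.map (LinearMap.mulLeft ℂ g) (restrictTotalDegree (Fin n) ℂ K)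
  have h2 : Module.finrank ℂ A ≤ bq n K := Submodule.finrank_map_le _ _
  refine le_trans ?_ h2
  have h3 : Submodule.map (Submodule.subtype _) (LinearMap.ker (qmap (Ideal.span {g}) (K + g.totalDegree))) ≤ A := by
    rintro _ ⟨p, hp, rfl⟩
    have hp1 : qmap _ _ p = 0 := hp
    rw [qmap_eq_zero, Ideal.mem_span_singleton] at hp1
    obtain ⟨h, hh⟩ := hp1
    refine ⟨h, ?_, hh.symm⟩
    by_cases h0 : h = 0
    · rw [h0]; exact Submodule.zero_mem _
    · have h5 := p.2
      rw [mem_restrictTotalDegree, hh, totalDegree_mul_of_isDomain hg h0] at h5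
      rw [SetLike.mem_coe, mem_restrictTotalDegree]
      omega
  have h4 := Submodule.finrank_mono h3
  rwa [LinearEquiv.finrank_eq (Submodule.equivMapOfInjective _ (Submodule.injective_subtype _) _).symm] at h4

lemma principal (hn : 0 < n) (q : Ideal (MvPolynomial (Fin n) ℂ)) [hq : q.IsPrime] (he : ee q = n - 1) :
    ∃ g, q = Ideal.span {g} ∧ (g.totalDegree : ℝ) ≤ (n:ℝ) ^ n * dd q := by
  have hne : q ≠ ⊥ := by
    rintro rfl
    rw [ee_bot] at he
    omega
  obtain ⟨g, hgq, hg⟩ := hq.exists_mem_prime_of_ne_bot hne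
  have hgp : (Ideal.span {g}).IsPrime := (Ideal.span_singleton_prime hg.ne_zero).2 hg
  have : (⊥ : Ideal (MvPolynomial (Fin n) ℂ)).IsPrime := Ideal.isPrime_bot
  have h1 : ee (Ideal.span {g}) < n := by
    have := ee_lt (I := ⊥) (Q := Ideal.span {g}) (bot_lt_iff_ne_bot.2 (by simpa using hg.ne_zero))
    rwa [ee_bot] at this
  have hqe : Ideal.span {g} = q := by
    by_contra hne
    have := ee_lt (lt_of_le_of_ne ((Ideal.span_singleton_le_iff_mem _).2 hgq) hne)
    omega
  refine ⟨g, hqe.symm, ?_⟩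
  rcases Nat.eq_zero_or_pos g.totalDegree with h0 | h0
  · rw [h0, Nat.cast_zero]; positivity
  refine (asym (c := g.totalDegree) (x := g.totalDegree) (y := (n:ℝ) ^ n * dd q) (s := n - 1) (t := ee q) (by exact_mod_cast h0) fun K => ?_).2 he.symm
  have h2 := HI_princ g hg.ne_zero K
  rw [hqe] at h2
  obtain ⟨e, rfl⟩ : ∃ e, n = e + 1 := ⟨n - 1, by omega⟩
  have h3 := bq_iter e K g.totalDegree
  have h4 := (nd_spec q).2.1 (K + g.totalDegree)
  have h5 : g.totalDegree * bq e K ≤ dd q * (K + g.totalDegree + 1) ^ ee q :=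
    le_trans (by omega) (h4.trans (Nat.mul_le_mul_left _ (bq_le _ _)))
  have h6 := bq_ge (n := e + 1) (e := e) (by omega) K
  have h7 : g.totalDegree * (K + 1) ^ e ≤ (e + 1) ^ (e + 1) * dd q * (K + 1 + g.totalDegree) ^ ee q := by
    calc g.totalDegree * (K + 1) ^ e ≤ g.totalDegree * ((e + 1) ^ (e + 1) * bq e K) := Nat.mul_le_mul_left _ h6
      _ = (e + 1) ^ (e + 1) * (g.totalDegree * bq e K) := by ring
      _ ≤ (e + 1) ^ (e + 1) * (dd q * (K + g.totalDegree + 1) ^ ee q) := Nat.mul_le_mul_left _ h5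
      _ = _ := by ring
  simp only [Nat.add_sub_cancel]
  exact_mod_cast h7

lemma comps {t : Set (Fin n → ℂ)} (ht : IsAlgebraicSet n t) :
    {W | IsIrredComponent n W t} = (fun q => Zl q) '' (vanishingIdeal n t).minimalPrimes := by
  ext W
  constructor
  · rintro ⟨h1, h2, h3⟩
    have := irred_prime h1
    obtain ⟨q, hq, hle⟩ := Ideal.exists_minimalPrimes_le (vI_anti h2)
    have : q.IsPrime := hq.isPrime
    refine ⟨q, hq, h3 _ (Zl_irred q) ?_ ?_⟩
    · have := Zl_anti hle
      rwa [alg_eq h1.1] at this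
    · have := Zl_anti hq.1.2
      rwa [alg_eq ht] at this
  · rintro ⟨q, hq, rfl⟩
    have : q.IsPrime := hq.isPrime
    refine ⟨Zl_irred q, ?_, ?_⟩
    · have := Zl_anti hq.1.2
      rwa [alg_eq ht] at this
    · intro W' h1 h2 h3
      have h4 := vI_anti h2
      rw [null] at h4
      have h5 := hq.2 ⟨irred_prime h1, vI_anti h3⟩ h4
      rw [← alg_eq h1.1, le_antisymm h4 h5]

lemma hyp {t : Set (Fin n → ℂ)} (ht : IsAlgSetOfDim n t (n - 1)) :
    1 ≤ degreeSum n t ∧ (0 < n → ∃ f : MvPolynomial (Fin n) ℂ, (∀ x, x ∈ t ↔ eval x f = 0) ∧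
      (f.totalDegree : ℝ) ≤ (n:ℝ) ^ n * degreeSum n t) := by
  classical
  obtain ⟨hta, htne, htd⟩ := ht
  have hfin := (vanishingIdeal n t).finite_minimalPrimes_of_isNoetherianRing
  have hpr : ∀ q ∈ (vanishingIdeal n t).minimalPrimes, q.IsPrime := fun q hq => hq.isPrime
  have hsum : degreeSum n t = ∑ q ∈ hfin.toFinset, degree n (Zl q) := by
    rw [degreeSum, comps hta, finsum_mem_image, finsum_mem_eq_finite_toFinset_sum _ hfin]
    intro q hq q' hq' h
    have := hpr q hq
    have := hpr q' hq'
    simp only at h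
    rw [← null q, h, null q']
  have hdd : ∀ q ∈ (vanishingIdeal n t).minimalPrimes, dd q ≤ degree n (Zl q) := by
    intro q hq
    have := hpr q hq
    have := dd_le_degree (Zl_irred q)
    rwa [null] at this
  have hmem : ∀ x, x ∈ t ↔ ∃ q ∈ (vanishingIdeal n t).minimalPrimes, x ∈ Zl q := by
    intro x
    constructor
    · intro hx
      obtain ⟨q, hq, hle⟩ := Ideal.exists_minimalPrimes_le (I := vanishingIdeal n t) (J := mp x) (le_mp.2 (mem_Zl_vI hx))
      exact ⟨q, hq, le_mp.1 hle⟩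
    · rintro ⟨q, hq, hx⟩
      rw [← alg_eq hta]
      exact Zl_anti hq.1.2 hx
  constructor
  · obtain ⟨x, hx⟩ := htne
    obtain ⟨q, hq, -⟩ := (hmem x).1 hx
    have := hpr q hq
    rw [hsum]
    exact ((dd_pos q).trans (hdd q hq)).trans
      (Finset.single_le_sum (f := fun q => degree n (Zl q)) (fun _ _ => Nat.zero_le _) (hfin.mem_toFinset.2 hq))
  · intro hn
    have hg : ∀ q, ∃ g : MvPolynomial (Fin n) ℂ, q ∈ (vanishingIdeal n t).minimalPrimes →
        q = Ideal.span {g} ∧ (g.totalDegree : ℝ) ≤ (n:ℝ) ^ n * dd q := by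
      intro q
      by_cases hq : q ∈ (vanishingIdeal n t).minimalPrimes
      · have := hpr q hq
        have hc : IsIrredComponent n (Zl q) t := by
          have : Zl q ∈ {W | IsIrredComponent n W t} := by rw [comps hta]; exact ⟨q, hq, rfl⟩
          exact this
        have he := htd _ hc
        rw [dim_eq (Zl_irred q), null] at he
        obtain ⟨g, h⟩ := principal hn q he
        exact ⟨g, fun _ => h⟩
      · exact ⟨0, fun h => absurd h hq⟩
    choose g hg using hg
    refine ⟨∏ q ∈ hfin.toFinset, g q, fun x => ?_, ?_⟩
    · rw [hmem, map_prod, Finset.prod_eq_zero_iff]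
      simp only [Set.Finite.mem_toFinset]
      refine exists_congr fun q => and_congr_right fun hq => ?_
      rw [← le_mp, (hg q hq).1, Ideal.span_singleton_le_iff_mem, mem_mp, ← (hg q hq).1]
    · calc ((∏ q ∈ hfin.toFinset, g q).totalDegree : ℝ) ≤ ∑ q ∈ hfin.toFinset, ((g q).totalDegree : ℝ) := by
            exact_mod_cast totalDegree_finsetProd _ _
        _ ≤ ∑ q ∈ hfin.toFinset, (n:ℝ) ^ n * degree n (Zl q) := by
            refine Finset.sum_le_sum fun q hq => ?_
            rw [Set.Finite.mem_toFinset] at hq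
            refine (hg q hq).2.trans ?_
            gcongr
            exact_mod_cast hdd q hq
        _ = _ := by rw [hsum, ← Finset.mul_sum]; push_cast; rfl

end PartT

section PartU
variable {n}

open Classical in
lemma part2 (hn : 0 < n) {β : Type*} (S : Finset (Fin n → ℂ)) (T : Finset β) (inc : (Fin n → ℂ) → β → Prop)
    (f : β → MvPolynomial (Fin n) ℂ) (hf : ∀ t ∈ T, ∀ x, inc x t ↔ eval x (f t) = 0) (k b : ℕ) (hk : 1 ≤ k)
    (hfree : ∀ P, P ⊆ S → P.card = k → ((T.filter (fun t => ∀ x ∈ P, inc x t)).card : ℝ) ≤ b - 1)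
    (R D : ℝ) (hR : 0 < R) (hD : ∑ t ∈ T, ((f t).totalDegree : ℝ) ≤ D)
    (hrich : ∀ x ∈ S, R + b - 1 ≤ ((T.filter (fun t => inc x t)).card : ℝ))
    (hX : 1 ≤ Cn n * D / R) :
    ∀ (e : ℕ) (I : Ideal (MvPolynomial (Fin n) ℂ)) [I.IsPrime], ee I = e →
      ((S.filter (fun x => x ∈ Zl I)).card : ℝ) ≤ k * dd I * (Cn n * D / R) ^ e := by
  set X := Cn n * D / R with hXd
  intro e
  induction e using Nat.strong_induction_on with
  | _ e ih =>
  intro I hI he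
  have hd1 : (1:ℝ) ≤ dd I := by exact_mod_cast dd_pos I
  have hXe : 1 ≤ X ^ e := one_le_pow₀ hX
  by_cases hc : (S.filter (fun x => x ∈ Zl I)).card ≤ k
  · calc ((S.filter (fun x => x ∈ Zl I)).card : ℝ) ≤ k * 1 * 1 := by
          rw [mul_one, mul_one]; exact_mod_cast hc
      _ ≤ _ := by gcongr
  obtain ⟨P, hPS, hPk⟩ := Finset.exists_subset_card_eq (not_le.1 hc).le
  have hTI : ((T.filter (fun t => f t ∈ I)).card : ℝ) ≤ b - 1 := by
    refine le_trans ?_ (hfree P (hPS.trans (Finset.filter_subset _ _)) hPk)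
    refine Nat.cast_le.2 (Finset.card_le_card fun t ht => ?_)
    rw [Finset.mem_filter] at ht ⊢
    refine ⟨ht.1, fun x hx => (hf t ht.1 x).2 ?_⟩
    exact (Finset.mem_filter.1 (hPS hx)).2 (f t) ht.2
  have hx : ∀ x ∈ S, R ≤ (((T.filter (fun t => f t ∉ I)).filter (fun t => inc x t)).card : ℝ) := by
    intro x hx
    have h1 := hrich x hx
    have h2 : (T.filter (fun t => inc x t)).card ≤ (T.filter (fun t => f t ∈ I)).card +
        ((T.filter (fun t => f t ∉ I)).filter (fun t => inc x t)).card := by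
      refine (Finset.card_le_card fun t ht => ?_).trans (Finset.card_union_le _ _)
      simp only [Finset.mem_union, Finset.mem_filter] at ht ⊢
      tauto
    have h3 : ((T.filter (fun t => inc x t)).card : ℝ) ≤ (T.filter (fun t => f t ∈ I)).card +
        ((T.filter (fun t => f t ∉ I)).filter (fun t => inc x t)).card := by exact_mod_cast h2
    linarith
  have ht : ∀ t ∈ T.filter (fun t => f t ∉ I),
      X * (((S.filter (fun x => x ∈ Zl I)).filter (fun x => inc x t)).card : ℝ) ≤
        k * X ^ e * (Cn n * (f t).totalDegree * dd I) := by
    intro t ht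
    rw [Finset.mem_filter] at ht
    obtain ⟨s, hs, hcov, hsum⟩ := bezout hn I ht.2
    have h1 : ((S.filter (fun x => x ∈ Zl I)).filter (fun x => inc x t)).card ≤
        ∑ q ∈ s, (S.filter (fun x => x ∈ Zl q)).card := by
      refine (Finset.card_le_card fun x hx => ?_).trans Finset.card_biUnion_le
      simp only [Finset.mem_filter, Finset.mem_biUnion] at hx ⊢
      obtain ⟨q, hq, hxq⟩ := hcov x hx.1.2 ((hf t ht.1 x).1 hx.2)
      exact ⟨q, hq, hx.1.1, hxq⟩
    calc X * (((S.filter (fun x => x ∈ Zl I)).filter (fun x => inc x t)).card : ℝ)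
        ≤ X * ∑ q ∈ s, ((S.filter (fun x => x ∈ Zl q)).card : ℝ) := by
          gcongr; exact_mod_cast h1
      _ = ∑ q ∈ s, X * ((S.filter (fun x => x ∈ Zl q)).card : ℝ) := Finset.mul_sum _ _ _
      _ ≤ ∑ q ∈ s, k * X ^ e * dd q := by
          refine Finset.sum_le_sum fun q hq => ?_
          have hqp := (hs q hq).1
          have hqe := (hs q hq).2.2.1
          have h2 := ih (ee q) (by omega) q rfl
          have h3 : e = ee q + 1 := by omega
          calc X * ((S.filter (fun x => x ∈ Zl q)).card : ℝ) ≤ X * (k * dd q * X ^ ee q) := by gcongr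
            _ = _ := by rw [h3, pow_succ]; ring
      _ = k * X ^ e * ∑ q ∈ s, (dd q : ℝ) := by rw [Finset.mul_sum]
      _ ≤ _ := by gcongr
  have hdc : (S.filter (fun x => x ∈ Zl I)).card * R ≤
      ∑ t ∈ T.filter (fun t => f t ∉ I), (((S.filter (fun x => x ∈ Zl I)).filter (fun x => inc x t)).card : ℝ) := by
    have h1 := Finset.sum_card_bipartiteAbove_eq_sum_card_bipartiteBelow (s := S.filter (fun x => x ∈ Zl I))
      (t := T.filter (fun t => f t ∉ I)) (fun x t => inc x t)
    simp only [Finset.bipartiteAbove, Finset.bipartiteBelow] at h1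
    rw [← Nat.cast_sum, ← h1, Nat.cast_sum, ← nsmul_eq_mul]
    exact Finset.card_nsmul_le_sum _ _ _ fun x hx' => hx x (Finset.mem_filter.1 hx').1
  have hfin : X * ((S.filter (fun x => x ∈ Zl I)).card * R) ≤ k * X ^ e * dd I * (X * R) := by
    calc X * ((S.filter (fun x => x ∈ Zl I)).card * R)
        ≤ X * ∑ t ∈ T.filter (fun t => f t ∉ I), (((S.filter (fun x => x ∈ Zl I)).filter (fun x => inc x t)).card : ℝ) := by
          gcongr
      _ ≤ ∑ t ∈ T.filter (fun t => f t ∉ I), k * X ^ e * (Cn n * (f t).totalDegree * dd I) := by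
          rw [Finset.mul_sum]; exact Finset.sum_le_sum ht
      _ ≤ ∑ t ∈ T, k * X ^ e * (Cn n * (f t).totalDegree * dd I) := by
          refine Finset.sum_le_sum_of_subset_of_nonneg (Finset.filter_subset _ _) fun t _ _ => ?_
          have : 0 ≤ Cn n := by linarith [one_le_Cn n]
          positivity
      _ = k * X ^ e * dd I * (Cn n * ∑ t ∈ T, ((f t).totalDegree : ℝ)) := by
          rw [Finset.mul_sum, Finset.mul_sum]
          refine Finset.sum_congr rfl fun t _ => ?_
          ring
      _ ≤ k * X ^ e * dd I * (Cn n * D) := by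
          have : 0 ≤ Cn n := by linarith [one_le_Cn n]
          gcongr
      _ = _ := by rw [hXd]; field_simp
  have hXR : 0 < X * R := by positivity
  refine le_of_mul_le_mul_right (a := X * R) ?_ hXR
  linarith

end PartU

section PartV
variable {n}

def CC (n : ℕ) : ℝ := (16 * Cn n + 8) ^ n + (16 * (Cn n * (n:ℝ) ^ n)) ^ n

lemma CC_pos (n : ℕ) : 0 < CC n := by
  have := one_le_Cn n
  have := one_le_nn n
  unfold CC
  positivity

open Classical in
lemma core (hn : 0 < n) {V : Set (Fin n → ℂ)} (hV : IsIrredVariety n V) {d : ℕ} (hd : dim n V = d + 1)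
    (T : Finset (Set (Fin n → ℂ))) (hT : ∀ t ∈ T, IsAlgSetOfDim n t (n - 1)) (k b : ℕ) (hk : 2 ≤ k) (hb : 1 ≤ b)
    (S : Finset (Fin n → ℂ)) (hSV : ∀ x ∈ S, x ∈ V)
    (hfree : ∀ P : Finset (Fin n → ℂ), P ⊆ S → P.card = k →
      ((T.filter (fun t => ∀ x ∈ P, x ∈ t)).card : ℝ) ≤ b - 1)
    (R q : ℝ) (hR : 0 < R) (hq : 0 < q) (hqk : q^(k-1) = b / R)
    (hrich : ∀ x ∈ S, R + b - 1 ≤ ((T.filter (fun t => x ∈ t)).card : ℝ))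
    (hRD : R ≤ degFamily n T) :
    (S.card : ℝ) ≤ k * degree n V * (2 * degFamily n T / R +
      CC n * ((degFamily n T / R) * (q * degFamily n T / R) ^ d)) := by
  have hp := irred_prime hV
  set I := vanishingIdeal n V with hI
  have hee : ee I = d + 1 := by rw [← dim_eq hV, hd]
  have hdn : d + 1 ≤ n := by rw [← hee]; exact ee_le I
  have hdeg : (dd I : ℝ) ≤ degree n V := by exact_mod_cast dd_le_degree hV
  have hdd1 : (1:ℝ) ≤ dd I := by exact_mod_cast dd_pos I
  have hb1 : (1:ℝ) ≤ b := by exact_mod_cast hb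
  have hC := one_le_Cn n
  have hN := one_le_nn n
  have hf : ∀ t : Set (Fin n → ℂ), ∃ f : MvPolynomial (Fin n) ℂ, t ∈ T → (∀ x, x ∈ t ↔ eval x f = 0) ∧
      (f.totalDegree : ℝ) ≤ (n:ℝ) ^ n * degreeSum n t := by
    intro t
    by_cases ht : t ∈ T
    · obtain ⟨f, h⟩ := (hyp (hT t ht)).2 hn
      exact ⟨f, fun _ => h⟩
    · exact ⟨0, fun h => absurd h ht⟩
  choose f hf using hf
  have hTD : (T.card : ℝ) ≤ degFamily n T := by
    have : T.card • 1 ≤ degFamily n T := Finset.card_nsmul_le_sum _ _ _ fun t ht => (hyp (hT t ht)).1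
    rw [smul_eq_mul, mul_one] at this
    exact_mod_cast this
  have hD' : ∑ t ∈ T, ((f t).totalDegree : ℝ) ≤ (n:ℝ) ^ n * degFamily n T := by
    refine (Finset.sum_le_sum fun t ht => (hf t ht).2).trans (le_of_eq ?_)
    rw [degFamily, ← Finset.mul_sum]; push_cast; rfl
  set D : ℝ := (degFamily n T : ℝ) with hDd
  have hD0 : 0 < D := lt_of_lt_of_le hR hRD
  have hrich' : ∀ x ∈ S, R ≤ ((T.filter (fun t => x ∈ t)).card : ℝ) := fun x hx => by
    linarith [hrich x hx]
  have hM0 : 0 < q * D / R := by positivity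
  have hY : 0 ≤ CC n * ((D / R) * (q * D / R) ^ d) := by have := CC_pos n; positivity
  suffices h : (S.card : ℝ) ≤ k * dd I * (2 * D / R + CC n * ((D / R) * (q * D / R) ^ d)) by
    refine h.trans ?_
    gcongr
  by_cases hM : q * D / R ≤ 1 / 4
  · have h := part0 S T (fun x t => x ∈ t) k b hk hb hfree R D q hR hq hqk hTD hrich' hM
    calc (S.card : ℝ) ≤ 2 * k * D / R := h
      _ = k * 1 * (2 * D / R + 0) := by ring
      _ ≤ _ := by gcongr
  push Not at hM
  by_cases hq16 : q ≤ 1 / 16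
  · set m := ⌈16 * Cn n * (q * D / R)⌉₊ with hm
    have hm0 : 16 * Cn n * (q * D / R) ≤ m := Nat.le_ceil _
    have hm1 : 1 ≤ m := Nat.ceil_pos.2 (by positivity)
    have h := part1 hn S T (fun x t => x ∈ t) f (fun t ht x => (hf t ht).1 x) k b hk hb hfree R
      ((n:ℝ) ^ n * D) q hR hq hqk hD' hrich' hq16 m hm1 (by
        calc 16 * (2 * (n:ℝ)^2 + 2) * q * ((n:ℝ) ^ n * D) = 16 * Cn n * (q * D / R) * R := by
              unfold Cn; field_simp
          _ ≤ m * R := by gcongr)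
    have h1 : HI (vanishingIdeal n (S : Set (Fin n → ℂ))) m ≤ dd I * (m + 1) ^ (d + 1) := by
      refine (HI_le_of_le (vI_anti hSV) m).trans (((nd_spec I).2.1 m).trans ?_)
      rw [hee]
      exact Nat.mul_le_mul_left _ (bq_le _ _)
    have h1' : (HI (vanishingIdeal n (S : Set (Fin n → ℂ))) m : ℝ) ≤ dd I * ((m:ℝ) + 1) ^ (d + 1) := by
      exact_mod_cast h1
    have hm2 : (m:ℝ) + 1 ≤ (16 * Cn n + 8) * (q * D / R) := by
      have := Nat.ceil_lt_add_one (a := 16 * Cn n * (q * D / R)) (by positivity)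
      linarith
    have hpw : (16 * Cn n + 8) ^ (d + 1) ≤ CC n := by
      have h2 : (16 * Cn n + 8) ^ (d + 1) ≤ (16 * Cn n + 8) ^ n := pow_le_pow_right₀ (by linarith) hdn
      have h3 : (0:ℝ) ≤ (16 * (Cn n * (n:ℝ) ^ n)) ^ n := by positivity
      unfold CC; linarith
    have h4 : (S.card : ℝ) * (6 * q) ≤ k * dd I * (CC n * ((D / R) * (q * D / R) ^ d)) * q := by
      calc (S.card : ℝ) * (6 * q) ≤ k * (dd I * ((m:ℝ) + 1) ^ (d + 1)) := h.trans (by gcongr)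
        _ ≤ k * (dd I * ((16 * Cn n + 8) * (q * D / R)) ^ (d + 1)) := by gcongr
        _ = k * dd I * ((16 * Cn n + 8) ^ (d + 1) * ((D / R) * (q * D / R) ^ d)) * q := by
            rw [mul_pow, pow_succ (q * D / R)]; ring
        _ ≤ _ := by gcongr
    have h5 : (S.card : ℝ) * 6 ≤ k * dd I * (CC n * ((D / R) * (q * D / R) ^ d)) := by
      refine le_of_mul_le_mul_right (a := q) ?_ hq
      linarith
    have h6 : 0 ≤ k * dd I * (2 * D / R) := by positivity
    have h7 : (0:ℝ) ≤ S.card := by positivity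
    rw [mul_add]
    linarith
  · push Not at hq16
    have hX : 1 ≤ Cn n * ((n:ℝ) ^ n * D) / R := by
      rw [le_div_iff₀ hR]
      have h1 : 1 ≤ Cn n * (n:ℝ) ^ n := one_le_mul_of_one_le_of_one_le hC hN
      nlinarith
    have h := part2 hn S T (fun x t => x ∈ t) f (fun t ht x => (hf t ht).1 x) k b (by omega) hfree R
      ((n:ℝ) ^ n * D) hR hD' hrich hX (d + 1) I hee
    have hfl : S.filter (fun x => x ∈ Zl I) = S :=
      Finset.filter_true_of_mem fun x hx => mem_Zl_vI (hSV x hx)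
    rw [hfl] at h
    have hpw : (16 * (Cn n * (n:ℝ) ^ n)) ^ (d + 1) ≤ CC n := by
      have h1 : 1 ≤ Cn n * (n:ℝ) ^ n := one_le_mul_of_one_le_of_one_le hC hN
      have h2 : (16 * (Cn n * (n:ℝ) ^ n)) ^ (d + 1) ≤ (16 * (Cn n * (n:ℝ) ^ n)) ^ n :=
        pow_le_pow_right₀ (by linarith) hdn
      have h3 : (0:ℝ) ≤ (16 * Cn n + 8) ^ n := by positivity
      unfold CC; linarith
    have h5 : (Cn n * ((n:ℝ) ^ n * D) / R) ^ (d + 1) ≤ CC n * ((D / R) * (q * D / R) ^ d) := by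
      calc (Cn n * ((n:ℝ) ^ n * D) / R) ^ (d + 1)
          = (Cn n * (n:ℝ) ^ n) ^ (d + 1) * ((D / R) * (1 * D / R) ^ d) := by
            rw [one_mul, ← pow_succ', ← mul_pow]; ring
        _ ≤ (Cn n * (n:ℝ) ^ n) ^ (d + 1) * ((D / R) * (16 * q * D / R) ^ d) := by
            gcongr; linarith
        _ = 16 ^ d * (Cn n * (n:ℝ) ^ n) ^ (d + 1) * ((D / R) * (q * D / R) ^ d) := by
            have : 16 * q * D / R = 16 * (q * D / R) := by ring
            rw [this, mul_pow]; ring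
        _ ≤ (16 * (Cn n * (n:ℝ) ^ n)) ^ (d + 1) * ((D / R) * (q * D / R) ^ d) := by
            rw [mul_pow 16]
            gcongr
            · norm_num
            · omega
        _ ≤ _ := by gcongr
    have h6 : 0 ≤ k * dd I * (2 * D / R) := by positivity
    calc (S.card : ℝ) ≤ k * dd I * (Cn n * ((n:ℝ) ^ n * D) / R) ^ (d + 1) := h
      _ ≤ k * dd I * (0 + CC n * ((D / R) * (q * D / R) ^ d)) := by rw [zero_add]; gcongr
      _ ≤ _ := by gcongr; positivity

lemma rpow_id (k d b : ℕ) (hk : 2 ≤ k) (R D : ℝ) (hR : 0 < R) :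
    (b:ℝ) ^ ((((d + 1 : ℕ) : ℝ) - 1) / ((k : ℝ) - 1)) * D ^ (d + 1) / R ^ ((1 : ℝ) / (1 - alpha k (d + 1)))
      = (D / R) * (((b:ℝ) / R) ^ ((1:ℝ) / ((k:ℝ) - 1)) * D / R) ^ d := by
  have hk1 : (0:ℝ) < (k:ℝ) - 1 := by
    have : (2:ℝ) ≤ k := by exact_mod_cast hk
    linarith
  have hkR : (2:ℝ) ≤ k := by exact_mod_cast hk
  have hd0 : (0:ℝ) ≤ d := by positivity
  have hden : (0:ℝ) < ((d:ℝ) + 1) * k - 1 := by nlinarith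
  have hal : (1:ℝ) / (1 - alpha k (d + 1)) = ((d + 1 : ℕ) : ℝ) + (d:ℝ) / ((k:ℝ) - 1) := by
    have h1 : 1 - alpha k (d + 1) = ((k:ℝ) - 1) / (((d:ℝ) + 1) * k - 1) := by
      rw [alpha, if_neg (by omega)]
      push_cast
      rw [eq_div_iff hden.ne', sub_mul, div_mul_cancel₀ _ hden.ne']
      ring
    rw [h1, one_div_div]
    push_cast
    rw [div_eq_iff hk1.ne', add_mul _ _ ((k:ℝ) - 1), div_mul_cancel₀ _ hk1.ne']
    ring
  have e1 : (((d + 1 : ℕ) : ℝ) - 1) / ((k : ℝ) - 1) = (d:ℝ) / ((k:ℝ) - 1) := by push_cast; ring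
  rw [hal, Real.rpow_add hR, Real.rpow_natCast, e1]
  have e2 : ((b:ℝ) / R) ^ ((1:ℝ) / ((k:ℝ) - 1)) * D / R = ((b:ℝ) / R) ^ ((1:ℝ) / ((k:ℝ) - 1)) * (D / R) := by ring
  rw [e2, mul_pow, ← Real.rpow_mul_natCast (by positivity), one_div_mul_eq_div,
    Real.div_rpow (by positivity) hR.le, div_pow]
  have := Real.rpow_pos_of_pos hR ((d:ℝ) / ((k:ℝ) - 1))
  field_simp
  try ring

lemma main_bound (n : ℕ) :
      ∀ (V : Set (Fin n → ℂ)) (d : ℕ), IsIrredVariety n V → dim n V = d →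
        ∀ T : Finset (Set (Fin n → ℂ)), (∀ t ∈ T, IsAlgSetOfDim n t (n - 1)) →
          ∀ k b r : ℕ, 1 ≤ k → 1 ≤ b → b ≤ r →
            ∀ S : Finset (Fin n → ℝ),
              (∀ x ∈ S, toC n x ∈ V ∧ toC n x ∈ richPts n T r) →
              KBFree (fun s t => toC n s ∈ t) S T k b →
              (S.card : ℝ) ≤ (k : ℝ) * (degree n V : ℝ) *
                (2 * (degFamily n T : ℝ) / ((r : ℝ) - (b : ℝ) + 1) +
                  CC n * (b : ℝ) ^ (((d : ℝ) - 1) / ((k : ℝ) - 1)) * (degFamily n T : ℝ) ^ d /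
                    ((r : ℝ) - (b : ℝ) + 1) ^ ((1 : ℝ) / (1 - alpha k d))) := by
  classical
  intro V d hV hd T hT k b r hk hb hbr S hS hfree
  have hp := irred_prime hV
  have hR : (0:ℝ) < (r:ℝ) - b + 1 := by
    have : (b:ℝ) ≤ r := by exact_mod_cast hbr
    linarith
  have hCC := CC_pos n
  have hY : 0 ≤ CC n * (b : ℝ) ^ (((d : ℝ) - 1) / ((k : ℝ) - 1)) * (degFamily n T : ℝ) ^ d /
      ((r : ℝ) - (b : ℝ) + 1) ^ ((1 : ℝ) / (1 - alpha k d)) := by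
    have := Real.rpow_pos_of_pos hR ((1 : ℝ) / (1 - alpha k d))
    positivity
  rcases S.eq_empty_or_nonempty with rfl | ⟨x₀, hx₀⟩
  · rw [Finset.card_empty, Nat.cast_zero]; positivity
  have hrich : ∀ x ∈ S, r ≤ (T.filter (fun t => toC n x ∈ t)).card := by
    intro x hx
    have h1 := (hS x hx).2
    rw [richPts, Set.mem_ofPred_eq] at h1
    refine h1.trans (le_of_eq ?_)
    rw [← Set.ncard_coe_finset]
    congr 1
    ext t
    simp
  have hTD : T.card ≤ degFamily n T := by
    have : T.card • 1 ≤ degFamily n T := Finset.card_nsmul_le_sum _ _ _ fun t ht => (hyp (hT t ht)).1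
    rwa [smul_eq_mul, mul_one] at this
  have hrD : (r:ℝ) ≤ degFamily n T := by
    exact_mod_cast (hrich x₀ hx₀).trans ((Finset.card_filter_le _ _).trans hTD)
  have hb1 : (1:ℝ) ≤ b := by exact_mod_cast hb
  have hRD : (r:ℝ) - b + 1 ≤ degFamily n T := by linarith
  have hk2 : 2 ≤ k := by
    by_contra hcon
    have hk1 : k = 1 := by omega
    obtain ⟨B, hB, hBc⟩ := Finset.exists_subset_card_eq (hbr.trans (hrich x₀ hx₀))
    refine hfree ⟨{x₀}, B, by simpa using hx₀, hB.trans (Finset.filter_subset _ _), by simp [hk1], hBc, ?_⟩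
    intro s hs t ht
    rw [Finset.mem_singleton] at hs
    rw [hs]
    exact (Finset.mem_filter.1 (hB ht)).2
  have hinj : Function.Injective (toC n) := by
    intro x y h
    funext i
    exact Complex.ofReal_injective (congrFun h i)
  rcases Nat.eq_zero_or_pos d with rfl | hdpos
  · have he : ee (vanishingIdeal n V) = 0 := by rw [← dim_eq hV, hd]
    have hV1 : ∀ x ∈ V, ∀ y ∈ V, x = y := by
      intro x hx y hy
      have h1 : vanishingIdeal n V = mp x := by
        by_contra hne
        have := ee_lt (lt_of_le_of_ne (le_mp.2 (mem_Zl_vI hx)) hne)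
        omega
      have h2 := mem_Zl_vI hy
      rw [h1, Zl_mp] at h2
      exact h2.symm
    have hc : S.card ≤ 1 := Finset.card_le_one.2 fun x hx y hy => hinj (hV1 _ (hS x hx).1 _ (hS y hy).1)
    have hdeg : (1:ℝ) ≤ degree n V := by exact_mod_cast (dd_pos _).trans (dd_le_degree hV)
    have hk1 : (1:ℝ) ≤ k := by exact_mod_cast hk
    have h2 : 1 ≤ 2 * (degFamily n T : ℝ) / ((r : ℝ) - (b : ℝ) + 1) := by
      rw [le_div_iff₀ hR]; linarith
    calc (S.card : ℝ) ≤ 1 := by exact_mod_cast hc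
      _ ≤ _ := one_le_mul_of_one_le_of_one_le (one_le_mul_of_one_le_of_one_le hk1 hdeg) (by linarith)
  obtain ⟨d, rfl⟩ : ∃ e, d = e + 1 := ⟨d - 1, by omega⟩
  have hn : 0 < n := by
    have := ee_le (vanishingIdeal n V)
    rw [← dim_eq hV, hd] at this
    omega
  have hfree' : ∀ P : Finset (Fin n → ℂ), P ⊆ S.image (toC n) → P.card = k →
      ((T.filter (fun t => ∀ x ∈ P, x ∈ t)).card : ℝ) ≤ b - 1 := by
    intro P hP hPc
    obtain ⟨P', hP', rfl⟩ := Finset.subset_image_iff.1 hP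
    rw [Finset.card_image_of_injective _ hinj] at hPc
    by_contra hcon
    push Not at hcon
    have h1 : b ≤ (T.filter (fun t => ∀ x ∈ P'.image (toC n), x ∈ t)).card := by
      have : (b:ℝ) < (T.filter (fun t => ∀ x ∈ P'.image (toC n), x ∈ t)).card + 1 := by linarith
      have h3 : b < (T.filter (fun t => ∀ x ∈ P'.image (toC n), x ∈ t)).card + 1 := by exact_mod_cast this
      omega
    obtain ⟨B, hB, hBc⟩ := Finset.exists_subset_card_eq h1
    refine hfree ⟨P', B, hP', hB.trans (Finset.filter_subset _ _), hPc, hBc, fun s hs t ht => ?_⟩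
    exact (Finset.mem_filter.1 (hB ht)).2 _ (Finset.mem_image_of_mem _ hs)
  have hbR : 0 < (b:ℝ) / ((r : ℝ) - (b : ℝ) + 1) := by positivity
  have h := core hn hV hd T hT k b hk2 hb (S.image (toC n)) (by
      intro x hx
      obtain ⟨y, hy, rfl⟩ := Finset.mem_image.1 hx
      exact (hS y hy).1) hfree' ((r:ℝ) - b + 1) (((b:ℝ) / ((r:ℝ) - b + 1)) ^ ((1:ℝ) / ((k:ℝ) - 1))) hR
      (Real.rpow_pos_of_pos hbR _) (by
        rw [← Real.rpow_natCast, ← Real.rpow_mul hbR.le, Nat.cast_sub hk, Nat.cast_one, one_div_mul_cancel, Real.rpow_one]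
        have : (2:ℝ) ≤ k := by exact_mod_cast hk2
        linarith) (by
        intro x hx
        obtain ⟨y, hy, rfl⟩ := Finset.mem_image.1 hx
        have h1 : (r:ℝ) ≤ (T.filter (fun t => toC n y ∈ t)).card := by exact_mod_cast hrich y hy
        linarith) hRD
  rw [Finset.card_image_of_injective _ hinj, ← rpow_id k d b hk2 _ _ hR] at h
  refine h.trans (le_of_eq ?_)
  ring

end PartV

/-- Corollary 8 of the paper: a bound for maximal `(k,b)`-free subsets of the
`r`-rich points of a family of hypersurfaces lying on the real points of an irreducible
variety. -/
theorem statement7 (n : ℕ) :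
    ∃ C : ℝ, 0 < C ∧
      ∀ (V : Set (Fin n → ℂ)) (d : ℕ), IsIrredVariety n V → dim n V = d →
        ∀ T : Finset (Set (Fin n → ℂ)), (∀ t ∈ T, IsAlgSetOfDim n t (n - 1)) →
          ∀ k b r : ℕ, 1 ≤ k → 1 ≤ b → ¬(k = 1 ∧ d = 1) → b ≤ r →
            ∀ S : Finset (Fin n → ℝ),
              (∀ x ∈ S, toC n x ∈ V ∧ toC n x ∈ richPts n T r) →
              KBFree (fun s t => toC n s ∈ t) S T k b →
              (∀ S' : Finset (Fin n → ℝ),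
                  (∀ x ∈ S', toC n x ∈ V ∧ toC n x ∈ richPts n T r) →
                  KBFree (fun s t => toC n s ∈ t) S' T k b → S ⊆ S' → S' = S) →
              (S.card : ℝ) ≤ (k : ℝ) * (degree n V : ℝ) *
                (2 * (degFamily n T : ℝ) / ((r : ℝ) - (b : ℝ) + 1) +
                  C * (b : ℝ) ^ (((d : ℝ) - 1) / ((k : ℝ) - 1)) * (degFamily n T : ℝ) ^ d /
                    ((r : ℝ) - (b : ℝ) + 1) ^ ((1 : ℝ) / (1 - alpha k d))) := by
  exact ⟨CC n, CC_pos n, fun V d hV hd T hT k b r hk hb _ hbr S hS hf _ =>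
    main_bound n V d hV hd T hT k b r hk hb hbr S hS hf⟩

end Paper
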